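/- Let B ⊂ ℂⁿ be the unit ball centered at the origin with standard complex structure Ĵ and Ĵ-holomorphic coordinates (z₁,…,zₙ). Suppose (J_i) is a sequence of (integrable) complex structures on B converging locally smoothly to Ĵ. Then there exists a smaller ball B̂ ⊂ B centered at the origin such that for all i sufficiently large there exist J_i-holomorphic coordinates (z₁^{(i)},…,zₙ^{(i)}) on B̂ with z_j^{(i)} → z_j locally smoothly on B̂ as i → ∞. -/

import Mathlib

noncomputable section

/-- `ℂⁿ`, with its Euclidean (Hermitian) norm. -/
abbrev Cn (n : ℕ) := EuclideanSpace ℂ (Fin n)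

/-- The standard complex structure `Ĵ` on `ℂⁿ` (multiplication by `i`), viewed as a
real-linear endomorphism. -/
def Jstd (n : ℕ) : Cn n →L[ℝ] Cn n :=
  (Complex.I • ContinuousLinearMap.id ℂ (Cn n)).restrictScalars ℝ

/-- The Nijenhuis tensor of the almost complex structure `J` at the point `x`,
evaluated on the constant vector fields `u, v`:
`N_J(u,v) = [Ju,Jv] − J[Ju,v] − J[u,Jv] − [u,v]`. -/
def nijenhuis {n : ℕ} (J : Cn n → (Cn n →L[ℝ] Cn n)) (x u v : Cn n) : Cn n :=
  (fderiv ℝ J x (J x u)) v - (fderiv ℝ J x (J x v)) u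
    + J x ((fderiv ℝ J x v) u) - J x ((fderiv ℝ J x u) v)

/-- `J` is an (integrable) complex structure on the open set `U ⊆ ℂⁿ`: a smooth
field of real-linear endomorphisms with `J² = −id` whose Nijenhuis tensor vanishes
(by the Newlander–Nirenberg theorem this is equivalent to integrability). -/
def IsComplexStructureOn {n : ℕ} (J : Cn n → (Cn n →L[ℝ] Cn n))
    (U : Set (Cn n)) : Prop :=
  ContDiffOn ℝ (⊤ : ℕ∞) J U ∧
    (∀ x ∈ U, (J x).comp (J x) = -ContinuousLinearMap.id ℝ (Cn n)) ∧
    ∀ x ∈ U, ∀ u v : Cn n, nijenhuis J x u v = 0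

/-- `h : ℂⁿ → ℂ` is `J`-holomorphic on `U`, i.e. `∂̄_J h = 0`; equivalently
`dh ∘ J = i·dh` on `U`. -/
def IsJHolomorphicOn {n : ℕ} (J : Cn n → (Cn n →L[ℝ] Cn n)) (h : Cn n → ℂ)
    (U : Set (Cn n)) : Prop :=
  ContDiffOn ℝ (⊤ : ℕ∞) h U ∧
    ∀ x ∈ U, ∀ u : Cn n, fderiv ℝ h x (J x u) = Complex.I * fderiv ℝ h x u

/-- `w = (w₁,…,wₙ)` are `J`-holomorphic coordinates on `U`: each `w_j` is
`J`-holomorphic on `U` and `(w₁,…,wₙ)` is a diffeomorphism onto its image (it is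
injective on `U` with invertible differential at every point of `U`). -/
def AreJHolomorphicCoordinatesOn {n : ℕ} (J : Cn n → (Cn n →L[ℝ] Cn n))
    (w : Fin n → Cn n → ℂ) (U : Set (Cn n)) : Prop :=
  (∀ j, IsJHolomorphicOn J (w j) U) ∧
    Set.InjOn (fun x => (fun j => w j x)) U ∧
    ∀ x ∈ U, Function.Bijective fun u : Cn n => (fun j => fderiv ℝ (w j) x u)

/-- `f i → g` locally smoothly on `U`: all iterated derivatives converge uniformly
on every compact subset of `U`. -/
def TendstoLocallySmoothlyOn {E F : Type*} [NormedAddCommGroup E] [NormedSpace ℝ E]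
    [NormedAddCommGroup F] [NormedSpace ℝ F]
    (f : ℕ → E → F) (g : E → F) (U : Set E) : Prop :=
  ∀ K : Set E, K ⊆ U → IsCompact K → ∀ m : ℕ,
    TendstoUniformlyOn (fun i x => iteratedFDeriv ℝ m (f i) x)
      (iteratedFDeriv ℝ m g) Filter.atTop K

namespace NN
open MeasureTheory Filter Topology Set
open scoped ContDiff ComplexConjugate ENNReal

section basic
variable {E : Type*} [NormedAddCommGroup E] [InnerProductSpace ℝ E]

def D (e : E) (u : E → ℂ) (x : E) : ℂ := fderiv ℝ u x e

abbrev Sm (u : E → ℂ) : Prop := ContDiff ℝ ∞ u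

structure Ts (O : Set E) (u : E → ℂ) : Prop where
  sm : Sm u
  cs : HasCompactSupport u
  sub : tsupport u ⊆ O

theorem Sm.da {u : E → ℂ} (h : Sm u) (x : E) : DifferentiableAt ℝ u x :=
  h.differentiable (by simp) x

theorem Sm.D {u : E → ℂ} (h : Sm u) (e : E) : Sm (D e u) :=
  (h.fderiv_right (m := ∞) (by simp)).clm_apply contDiff_const

theorem Sm.conj {u : E → ℂ} (h : Sm u) : Sm (fun x => conj (u x)) :=
  Complex.conjCLE.contDiff.comp h

theorem D_add {u v : E → ℂ} {x : E} (hu : DifferentiableAt ℝ u x) (hv : DifferentiableAt ℝ v x)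
    (e : E) : D e (fun y => u y + v y) x = D e u x + D e v x := by
  simp [D, fderiv_fun_add hu hv]

theorem D_sub {u v : E → ℂ} {x : E} (hu : DifferentiableAt ℝ u x) (hv : DifferentiableAt ℝ v x)
    (e : E) : D e (fun y => u y - v y) x = D e u x - D e v x := by
  simp [D, fderiv_fun_sub hu hv]

theorem D_neg (u : E → ℂ) (x e : E) : D e (fun y => - u y) x = - D e u x := by
  simp [D, fderiv_fun_neg]

theorem D_mul {u v : E → ℂ} {x : E} (hu : DifferentiableAt ℝ u x) (hv : DifferentiableAt ℝ v x)
    (e : E) : D e (fun y => u y * v y) x = D e u x * v x + u x * D e v x := by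
  simp [D, fderiv_fun_mul hu hv]; ring

theorem D_sum {ι : Type*} {s : Finset ι} {u : ι → E → ℂ} {x : E}
    (hu : ∀ i ∈ s, DifferentiableAt ℝ (u i) x) (e : E) :
    D e (fun y => ∑ i ∈ s, u i y) x = ∑ i ∈ s, D e (u i) x := by
  simp [D, fderiv_fun_sum hu]

theorem D_conj {u : E → ℂ} {x : E} (hu : DifferentiableAt ℝ u x) (e : E) :
    D e (fun y => conj (u y)) x = conj (D e u x) := by
  have := (Complex.conjCLE.hasFDerivAt.comp x hu.hasFDerivAt).fderiv
  have h2 : (fun y => conj (u y)) = Complex.conjCLE ∘ u := by ext; simp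
  simp only [D, h2]; rw [this]; simp

theorem D_const (a : ℂ) (x e : E) : D e (fun _ => a) x = 0 := by simp [D]

theorem D_congr {u v : E → ℂ} {O : Set E} (hO : IsOpen O) (h : ∀ y ∈ O, u y = v y) {x : E}
    (hx : x ∈ O) (e : E) : D e u x = D e v x := by
  have : u =ᶠ[𝓝 x] v := by filter_upwards [hO.mem_nhds hx] with y hy using h y hy
  simp [D, this.fderiv_eq]

theorem D_comm {u : E → ℂ} (hu : Sm u) (e f x : E) : D e (D f u) x = D f (D e u) x := by
  have h1 : DifferentiableAt ℝ (fderiv ℝ u) x :=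
    (hu.fderiv_right (m := ∞) (by simp)).differentiable (by simp) x
  have h2 := (hu.contDiffAt (x := x)).isSymmSndFDerivAt (by
    rw [minSmoothness_of_isRCLikeNormedField]; exact WithTop.coe_le_coe.2 le_top)
  have key : ∀ a b : E, D a (D b u) x = fderiv ℝ (fderiv ℝ u) x a b := by
    intro a b
    have := fderiv_clm_apply h1 (differentiableAt_const b)
    simp only [D] at *
    unfold NN.D
    rw [this]; simp
  rw [key, key]; exact h2 e f

theorem Ts.D {O : Set E} {u : E → ℂ} (h : Ts O u) (e : E) : Ts O (D e u) := by
  refine ⟨h.sm.D e, (h.cs.fderiv (𝕜 := ℝ)).comp_left (g := fun L : E →L[ℝ] ℂ => L e) (by simp), ?_⟩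
  refine (closure_minimal ?_ isClosed_closure).trans h.sub
  intro x hx
  apply support_fderiv_subset ℝ (f := u)
  intro h0
  exact hx (by simp [NN.D, h0])

theorem Ts.mul {O : Set E} {a u : E → ℂ} (h : Ts O u) (ha : Sm a) : Ts O (fun x => a x * u x) :=
  ⟨ha.mul h.sm, h.cs.mul_left, (tsupport_mul_subset_right).trans h.sub⟩

theorem Ts.mul' {O : Set E} {a u : E → ℂ} (h : Ts O u) (ha : Sm a) : Ts O (fun x => u x * a x) := by
  simpa only [mul_comm] using h.mul ha

theorem Ts.add {O : Set E} {u v : E → ℂ} (hu : Ts O u) (hv : Ts O v) : Ts O (fun x => u x + v x) :=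
  ⟨hu.sm.add hv.sm, hu.cs.add hv.cs, (tsupport_add u v).trans (union_subset hu.sub hv.sub)⟩

theorem Ts.zero (O : Set E) : Ts O (fun _ => (0 : ℂ)) :=
  ⟨contDiff_const, HasCompactSupport.zero, by simp [tsupport]⟩

theorem Ts.sum {O : Set E} {ι : Type*} {s : Finset ι} {u : ι → E → ℂ} (hu : ∀ i, Ts O (u i)) :
    Ts O (fun x => ∑ i ∈ s, u i x) := by
  classical
  induction s using Finset.induction_on with
  | empty => simpa using Ts.zero O
  | insert i s hi ih => simpa [Finset.sum_insert hi] using (hu i).add ih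

theorem Ts.neg {O : Set E} {u : E → ℂ} (hu : Ts O u) : Ts O (fun x => - u x) := by
  simpa using hu.mul (a := fun _ => -1) contDiff_const

theorem Ts.sub' {O : Set E} {u v : E → ℂ} (hu : Ts O u) (hv : Ts O v) : Ts O (fun x => u x - v x) := by
  simpa [sub_eq_add_neg] using hu.add hv.neg

theorem Ts.conj {O : Set E} {u : E → ℂ} (hu : Ts O u) : Ts O (fun x => conj (u x)) := by
  have h : tsupport (fun x => conj (u x)) = tsupport u := by
    unfold tsupport; congr 1; ext; simp
  exact ⟨hu.sm.conj, by simpa [HasCompactSupport, h] using hu.cs, by simpa [h] using hu.sub⟩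

theorem Ts.mono {O O' : Set E} {u : E → ℂ} (hu : Ts O u) (h : O ⊆ O') : Ts O' u :=
  ⟨hu.sm, hu.cs, hu.sub.trans h⟩

theorem Ts.zero_of {O : Set E} {u : E → ℂ} (hu : Ts O u) {x : E} (hx : x ∉ O) : u x = 0 :=
  image_eq_zero_of_notMem_tsupport fun h => hx (hu.sub h)

/-- product with a function smooth on the open set only -/
theorem Ts.mulOn {O : Set E} {a u : E → ℂ} (h : Ts O u) (ha : ContDiffOn ℝ ∞ a O) (hO : IsOpen O) :
    Ts O (fun x => a x * u x) := by
  refine ⟨?_, h.cs.mul_left, (tsupport_mul_subset_right).trans h.sub⟩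
  refine contDiff_iff_contDiffAt.2 fun x => ?_
  by_cases hx : x ∈ tsupport u
  · exact (ha.contDiffAt (hO.mem_nhds (h.sub hx))).mul h.sm.contDiffAt
  · refine (contDiffAt_const (c := (0 : ℂ))).congr_of_eventuallyEq ?_
    filter_upwards [(isClosed_tsupport u).isOpen_compl.mem_nhds hx] with y hy
    rw [image_eq_zero_of_notMem_tsupport hy, mul_zero]

variable {α : Type*} [Fintype α]

def V (b : α → E) (ξ : α → E → ℂ) (u : E → ℂ) (x : E) : ℂ := ∑ a, ξ a x * D (b a) u x

def Pt (b : α → E) (ξ : α → E → ℂ) (g : E → ℂ) (x : E) : ℂ := ∑ a, - D (b a) (fun y => ξ a y * g y) x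

variable {b : α → E} {ξ η : α → E → ℂ}

theorem Sm.sum' {ι : Type*} {s : Finset ι} {u : ι → E → ℂ} (h : ∀ i, Sm (u i)) :
    Sm (fun x => ∑ i ∈ s, u i x) := ContDiff.sum fun i _ => h i

theorem Sm.V {u : E → ℂ} (hξ : ∀ a, Sm (ξ a)) (hu : Sm u) : Sm (V b ξ u) :=
  Sm.sum' fun a => (hξ a).mul (hu.D _)

theorem Ts.V {O : Set E} {u : E → ℂ} (hξ : ∀ a, Sm (ξ a)) (hu : Ts O u) : Ts O (V b ξ u) :=
  Ts.sum fun a => (hu.D _).mul (hξ a)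

theorem Ts.Pt {O : Set E} {u : E → ℂ} (hξ : ∀ a, Sm (ξ a)) (hu : Ts O u) : Ts O (Pt b ξ u) :=
  Ts.sum fun a => ((hu.mul (hξ a)).D _).neg

theorem V_add {u v : E → ℂ} (hu : Sm u) (hv : Sm v) (x : E) :
    V b ξ (fun y => u y + v y) x = V b ξ u x + V b ξ v x := by
  simp only [V, D_add (hu.da x) (hv.da x), mul_add, Finset.sum_add_distrib]

theorem V_mul {u v : E → ℂ} (hu : Sm u) (hv : Sm v) (x : E) :
    V b ξ (fun y => u y * v y) x = V b ξ u x * v x + u x * V b ξ v x := by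
  simp only [V, D_mul (hu.da x) (hv.da x), Finset.sum_mul, Finset.mul_sum,
    ← Finset.sum_add_distrib]
  exact Finset.sum_congr rfl fun a _ => by ring

theorem V_neg (u : E → ℂ) (x : E) : V b ξ (fun y => - u y) x = - V b ξ u x := by
  simp [V, D_neg]

theorem V_conj {u : E → ℂ} (hu : Sm u) (x : E) :
    V b ξ (fun y => conj (u y)) x = conj (V b (fun a y => conj (ξ a y)) u x) := by
  simp [V, D_conj (hu.da x)]

theorem V_comm (hξ : ∀ a, Sm (ξ a)) (hη : ∀ a, Sm (η a)) {u : E → ℂ} (hu : Sm u) (x : E) :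
    V b ξ (V b η u) x - V b η (V b ξ u) x =
      V b (fun a y => V b ξ (η a) y - V b η (ξ a) y) u x := by
  have h : ∀ (ξ η : α → E → ℂ), (∀ a, Sm (η a)) → V b ξ (V b η u) x =
      V b (fun a y => V b ξ (η a) y) u x +
        ∑ a, ∑ c, ξ a x * η c x * D (b a) (D (b c) u) x := by
    intro ξ η hη
    have : ∀ a, D (b a) (V b η u) x = ∑ c, (D (b a) (η c) x * D (b c) u x +
        η c x * D (b a) (D (b c) u) x) := by
      intro a
      unfold V
      rw [D_sum fun c _ => Sm.da ((hη c).mul (hu.D _)) x]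
      exact Finset.sum_congr rfl fun c _ => D_mul ((hη c).da x) ((hu.D _).da x) _
    rw [V]
    simp only [this, Finset.mul_sum, mul_add, Finset.sum_add_distrib]
    congr 1
    · simp only [V, Finset.sum_mul]
      rw [Finset.sum_comm]
      exact Finset.sum_congr rfl fun c _ => Finset.sum_congr rfl fun a _ => by ring
    · exact Finset.sum_congr rfl fun c _ => Finset.sum_congr rfl fun a _ => by ring
  have h3 : (∑ a, ∑ c, ξ a x * η c x * D (b a) (D (b c) u) x) =
      ∑ a, ∑ c, η a x * ξ c x * D (b a) (D (b c) u) x := by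
    rw [Finset.sum_comm]
    exact Finset.sum_congr rfl fun c _ => Finset.sum_congr rfl fun a _ => by
      rw [D_comm hu]; ring
  rw [h ξ η hη, h η ξ hξ, h3]
  simp only [V, sub_mul, Finset.sum_sub_distrib]; ring

theorem Pt_eq {g : E → ℂ} (hξ : ∀ a, Sm (ξ a)) (hg : Sm g) (x : E) :
    Pt b ξ g x = - V b ξ g x - (∑ a, D (b a) (ξ a) x) * g x := by
  simp only [Pt, V, D_mul ((hξ _).da x) (hg.da x), Finset.sum_mul, ← Finset.sum_neg_distrib,
    ← Finset.sum_sub_distrib]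
  exact Finset.sum_congr rfl fun c _ => by ring

theorem Pt_mul {χ g : E → ℂ} (hξ : ∀ a, Sm (ξ a)) (hχ : Sm χ) (hg : Sm g) (x : E) :
    Pt b ξ (fun y => χ y * g y) x = χ x * Pt b ξ g x - V b ξ χ x * g x := by
  rw [Pt_eq hξ (hχ.mul hg), Pt_eq hξ hg, V_mul hχ hg]; ring

variable [FiniteDimensional ℝ E] [MeasurableSpace E] [BorelSpace E]

theorem Ts.int {O : Set E} {u : E → ℂ} (hu : Ts O u) : Integrable u :=
  hu.sm.continuous.integrable_of_hasCompactSupport hu.cs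

theorem Ts.lp {O : Set E} {u : E → ℂ} (hu : Ts O u) (p : ℝ≥0∞) : MemLp u p :=
  hu.sm.continuous.memLp_of_hasCompactSupport hu.cs

theorem ibp {O : Set E} {u g : E → ℂ} (hu : Sm u) (hg : Ts O g) (e : E) :
    ∫ x, D e u x * g x = - ∫ x, u x * D e g x := by
  have h := integral_mul_fderiv_eq_neg_fderiv_mul_of_integrable (μ := (volume : Measure E))
    (f := g) (g := u) (v := e) (((hg.D e).mul' hu).int) ((hg.mul' (hu.D e)).int)
    ((hg.mul' hu).int) (fun x _ => hg.sm.da x) (fun x _ => hu.da x)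
  simp only [D]
  rw [show (∫ x, fderiv ℝ u x e * g x) = ∫ x, g x * fderiv ℝ u x e by simp only [mul_comm], h]
  simp only [mul_comm]

theorem ibpV {O : Set E} {u g : E → ℂ} (hξ : ∀ a, Sm (ξ a)) (hu : Sm u) (hg : Ts O g) :
    ∫ x, V b ξ u x * g x = ∫ x, u x * Pt b ξ g x := by
  simp only [V, Pt, Finset.sum_mul, Finset.mul_sum]
  rw [integral_finsetSum, integral_finsetSum]
  · refine Finset.sum_congr rfl fun a _ => ?_
    have := ibp hu (hg.mul (hξ a)) (b a)
    simp only [mul_neg, integral_neg]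
    rw [← this]; exact integral_congr_ae (.of_forall fun x => by ring_nf)
  · exact fun a _ => (((hg.mul (hξ a)).D _).neg.mul hu).int
  · exact fun a _ => (hg.mul ((hξ a).mul (hu.D _))).int

end basic
end NN

namespace NN
open MeasureTheory Filter Topology Set
open scoped ContDiff ComplexConjugate ENNReal

section fr
variable {E : Type*} [NormedAddCommGroup E] [InnerProductSpace ℝ E]
  [FiniteDimensional ℝ E] [MeasurableSpace E] [BorelSpace E]

def N2 (f : E → ℂ) : ℝ≥0∞ := ∫⁻ x, ‖f x‖ₑ ^ 2

theorem N2_eq (f : E → ℂ) : N2 f = eLpNorm f 2 volume ^ 2 := by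
  rw [eLpNorm_eq_lintegral_rpow_enorm_toReal (by simp) (by simp), N2, ← ENNReal.rpow_natCast,
    ← ENNReal.rpow_mul]
  simp

theorem N2_lt {f : E → ℂ} (h : MemLp f 2) : N2 f < ⊤ := by
  rw [N2_eq]; exact ENNReal.pow_lt_top h.2

theorem memLp_of_N2 {f : E → ℂ} (h : AEStronglyMeasurable f) (h2 : N2 f < ⊤) : MemLp f 2 := by
  refine ⟨h, ?_⟩
  rw [N2_eq] at h2
  exact (ENNReal.pow_lt_top_iff.1 h2).resolve_right (by norm_num)

theorem N2_mono {f g : E → ℂ} (h : ∀ x, ‖f x‖ ≤ ‖g x‖) : N2 f ≤ N2 g :=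
  lintegral_mono fun x => by gcongr; exact enorm_le_iff_norm_le.2 (h x)

theorem tc {v : E → ℂ} (hv : MemLp v 2) :
    Tendsto (fun w : E => N2 (fun x => v (x - w) - v x)) (𝓝 0) (𝓝 0) := by
  have hmp : ∀ w : E, MeasurePreserving (ContinuousMap.mk (fun x : E => x - w) (by fun_prop)) volume volume :=
    fun w => measurePreserving_sub_right volume w
  have hc : Continuous fun w : E => (ContinuousMap.mk (fun x : E => x - w) (by fun_prop) : C(E, E)) :=
    (ContinuousMap.curry ⟨fun p : E × E => p.2 - p.1, by fun_prop⟩).continuous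
  have h := (continuous_const (y := hv.toLp v)).compMeasurePreservingLp hc hmp (by simp)
  have h0 := h.tendsto 0
  rw [Lp.tendsto_Lp_iff_tendsto_eLpNorm'] at h0
  have := (ENNReal.continuous_pow 2).tendsto _ |>.comp h0
  simp only [ne_eq, OfNat.ofNat_ne_zero, not_false_eq_true, zero_pow] at this
  refine this.congr fun w => ?_
  rw [N2_eq]
  simp only [Function.comp]
  congr 1
  refine eLpNorm_congr_ae ?_
  have e1 := Lp.coeFn_compMeasurePreserving (hv.toLp v) (hmp w)
  have e2 := Lp.coeFn_compMeasurePreserving (hv.toLp v) (hmp 0)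
  have e3 := (hmp w).quasiMeasurePreserving.ae_eq_comp hv.coeFn_toLp
  have e4 := (hmp 0).quasiMeasurePreserving.ae_eq_comp hv.coeFn_toLp
  filter_upwards [e1, e2, e3, e4] with x h1 h2 h3 h4
  simp only [Pi.sub_apply, h1, h2, h3, h4]
  simp

theorem cs {mm f : E → ℝ≥0∞} (hm : Measurable mm) (hf : Measurable f) :
    (∫⁻ z, mm z * f z) ^ 2 ≤ (∫⁻ z, mm z) * ∫⁻ z, mm z * f z ^ 2 := by
  have h := ENNReal.lintegral_mul_le_Lp_mul_Lq (volume : Measure E)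
    (Real.HolderConjugate.two_two) (f := fun z => mm z ^ (1/2:ℝ))
    (g := fun z => mm z ^ (1/2:ℝ) * f z) (by fun_prop) (by fun_prop)
  simp only [Pi.mul_apply, ← mul_assoc, ← ENNReal.rpow_add_of_nonneg (1/2:ℝ) (1/2:ℝ) (by norm_num) (by norm_num),
    ENNReal.mul_rpow_of_nonneg _ _ (zero_le_two : (0:ℝ) ≤ 2), ← ENNReal.rpow_mul] at h
  norm_num at h
  calc _ ≤ _ := pow_le_pow_left' h 2
    _ = _ := by
      rw [mul_pow, ← ENNReal.rpow_natCast, ← ENNReal.rpow_natCast, ← ENNReal.rpow_mul, ← ENNReal.rpow_mul]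
      simp

theorem schur {mm : E → ℝ≥0∞} (hm : Measurable mm) (hA : ∫⁻ z, mm z ≠ ⊤)
    (h0 : ∀ z, 1 < ‖z‖ → mm z = 0) {v : E → ℂ} (hvm : Measurable v) (hv : MemLp v 2)
    {ε : ℕ → ℝ} (hε : Tendsto ε atTop (𝓝 0)) {F : ℕ → E → ℂ} {Λ : ℝ≥0∞} (hΛ : Λ ≠ ⊤)
    (hF : ∀ ν x, ‖F ν x‖ₑ ≤ Λ * ∫⁻ z, mm z * ‖v (x - ε ν • z) - v x‖ₑ) :
    Tendsto (fun ν => N2 (F ν)) atTop (𝓝 0) := by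
  set A := ∫⁻ z, mm z
  have key : ∀ ν, N2 (F ν) ≤ Λ ^ 2 * (A * ∫⁻ z, mm z * N2 (fun x => v (x - ε ν • z) - v x)) := by
    intro ν
    calc N2 (F ν) ≤ ∫⁻ x, Λ ^ 2 * (A * ∫⁻ z, mm z * ‖v (x - ε ν • z) - v x‖ₑ ^ 2) := by
          refine lintegral_mono fun x => (pow_le_pow_left' (hF ν x) 2).trans ?_
          rw [mul_pow]
          gcongr
          exact cs hm (by fun_prop)
      _ = _ := by
          rw [lintegral_const_mul' _ _ (by simp [hΛ]), lintegral_const_mul' _ _ hA, lintegral_lintegral_swap]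
          · congr 3 with z
            rw [lintegral_const_mul _ (by fun_prop)]; rfl
          · exact Measurable.aemeasurable (by fun_prop)
  rw [ENNReal.tendsto_nhds_zero]
  intro δ hδ
  have hK : Λ ^ 2 * (A * A) ≠ ⊤ := by finiteness
  obtain ⟨δ', hδ', hd⟩ : ∃ δ' : ℝ≥0∞, 0 < δ' ∧ Λ ^ 2 * (A * A) * δ' ≤ δ := by
    rcases eq_or_ne (Λ ^ 2 * (A * A)) 0 with h | h
    · exact ⟨1, one_pos, by simp [h]⟩
    · refine ⟨δ / (Λ ^ 2 * (A * A)), ENNReal.div_pos hδ.ne' hK, ?_⟩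
      exact ENNReal.mul_div_le
  obtain ⟨r, hr, hr2⟩ := Metric.eventually_nhds_iff.1 (ENNReal.tendsto_nhds_zero.1 (tc hv) δ' hδ')
  have := Metric.tendsto_nhds.1 hε r hr
  filter_upwards [this] with ν hν
  refine (key ν).trans (le_trans ?_ hd)
  rw [mul_assoc, mul_assoc]
  gcongr
  rw [mul_comm A δ', ← lintegral_const_mul _ hm]
  · refine lintegral_mono fun z => ?_
    by_cases hz : 1 < ‖z‖
    · simp [h0 z hz]
    · rw [mul_comm]
      gcongr
      refine hr2 ?_
      rw [dist_zero_right, norm_smul]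
      simp at hν
      simp only [Real.norm_eq_abs]
      nlinarith [abs_nonneg (ε ν), norm_nonneg z]

end fr
end NN

namespace NN
open MeasureTheory Filter Topology Set
open scoped ContDiff ComplexConjugate ENNReal

section mol
variable {E : Type*} [NormedAddCommGroup E] [InnerProductSpace ℝ E]
  [FiniteDimensional ℝ E] [MeasurableSpace E] [BorelSpace E]

theorem bump_ex : ∃ ρ : E → ℂ, Ts (Metric.ball 0 2) ρ ∧ (∀ z, 1 < ‖z‖ → ρ z = 0) ∧ ∫ z, ρ z = 1 := by
  let f : ContDiffBump (0 : E) := ⟨1/2, 1, by norm_num, by norm_num⟩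
  have hs : tsupport (fun z => ((f.normed volume z : ℝ) : ℂ)) = Metric.closedBall 0 1 := by
    rw [← f.tsupport_normed_eq (μ := volume)]
    unfold tsupport; congr 1; ext; simp
  refine ⟨fun z => (f.normed volume z : ℂ), ⟨Complex.ofRealCLM.contDiff.comp f.contDiff_normed, ?_, ?_⟩, ?_, ?_⟩
  · rw [HasCompactSupport, hs]; exact isCompact_closedBall _ _
  · rw [hs]; exact Metric.closedBall_subset_ball (by norm_num)
  · intro z hz
    refine image_eq_zero_of_notMem_tsupport (f := fun z => ((f.normed volume z : ℝ) : ℂ)) ?_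
    rw [hs]; simpa using hz
  · rw [integral_complex_ofReal, f.integral_normed]; simp

def rho : E → ℂ := Classical.choose bump_ex
theorem rho_ts : Ts (Metric.ball (0:E) 2) rho := (Classical.choose_spec bump_ex).1
theorem rho_z : ∀ z : E, 1 < ‖z‖ → rho z = 0 := (Classical.choose_spec bump_ex).2.1
theorem rho_i : ∫ z : E, rho z = 1 := (Classical.choose_spec bump_ex).2.2

def eps (ν : ℕ) : ℝ := 1 / (ν + 1)
theorem eps_pos (ν : ℕ) : 0 < eps ν := by unfold eps; positivity
theorem eps_t : Tendsto eps atTop (𝓝 0) := tendsto_one_div_add_atTop_nhds_zero_nat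

def re (ν : ℕ) (z : E) : ℂ := (((eps ν) ^ Module.finrank ℝ E)⁻¹ : ℝ) * rho ((eps ν)⁻¹ • z)

theorem re_sm (ν : ℕ) : Sm (re (E := E) ν) :=
  contDiff_const.mul (rho_ts.sm.comp (contDiff_const_smul _))

theorem re_cs (ν : ℕ) : HasCompactSupport (re (E := E) ν) :=
  HasCompactSupport.mul_left (rho_ts.cs.comp_smul (inv_ne_zero (eps_pos ν).ne'))

theorem re_z (ν : ℕ) {z : E} (h : eps ν < ‖z‖) : re ν z = 0 := by
  rw [re, rho_z, mul_zero]
  rw [norm_smul, norm_inv, Real.norm_of_nonneg (eps_pos ν).le, inv_mul_eq_div, one_lt_div (eps_pos ν)]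
  exact h

theorem re_i (ν : ℕ) : ∫ z : E, re ν z = 1 := by
  simp only [re]
  rw [integral_const_mul, Measure.integral_comp_inv_smul, rho_i]
  have := eps_pos ν
  rw [abs_of_pos (by positivity), Complex.real_smul, mul_one, ← Complex.ofReal_mul, inv_mul_cancel₀ (by positivity)]
  simp

theorem ere {t : ℝ} (h : 0 ≤ t) : ‖(t : ℂ)‖ₑ = ENNReal.ofReal t := by
  rw [← ofReal_norm, Complex.norm_real, Real.norm_of_nonneg h]

def R (ν : ℕ) (v : E → ℂ) (x : E) : ℂ := ∫ y, v y * re ν (x - y)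

theorem R_conv (ν : ℕ) (v : E → ℂ) :
    R ν v = convolution v (re ν) (ContinuousLinearMap.mul ℝ ℂ) volume := rfl

theorem li {v : E → ℂ} (hv : MemLp v 2) : LocallyIntegrable v := hv.locallyIntegrable (by norm_num)

theorem R_sm {v : E → ℂ} (hv : MemLp v 2) (ν : ℕ) : Sm (R ν v) := by
  rw [R_conv]
  exact (re_cs ν).contDiff_convolution_right (n := (⊤ : ℕ∞)) _ (li hv) (re_sm ν)

theorem R_D {v : E → ℂ} (hv : MemLp v 2) (ν : ℕ) (e x : E) :
    D e (R ν v) x = ∫ y, v y * D e (re ν) (x - y) := by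
  have h1 : ContDiff ℝ 1 (re (E := E) ν) := (re_sm ν).of_le (by simp)
  rw [D, R_conv, ((re_cs ν).hasFDerivAt_convolution_right (ContinuousLinearMap.mul ℝ ℂ) (li hv) h1 x).fderiv,
    convolution_precompR_apply _ (li hv) ((re_cs ν).fderiv ℝ) (h1.continuous_fderiv one_ne_zero)]
  rfl

theorem R_ts {v : E → ℂ} (hv : MemLp v 2) (hc : HasCompactSupport v) {O : Set E} (hO : IsOpen O)
    (hs : tsupport v ⊆ O) : ∀ᶠ ν in atTop, Ts O (R ν v) := by
  obtain ⟨δ, hδ, h⟩ := hc.isCompact.exists_cthickening_subset_open hO hs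
  filter_upwards [(tendsto_order.1 eps_t).2 δ hδ] with ν hν
  have hsub : tsupport (R ν v) ⊆ Metric.cthickening δ (tsupport v) := by
    refine closure_minimal ?_ Metric.isClosed_cthickening
    rw [R_conv]
    refine (support_convolution_subset _).trans ?_
    rintro _ ⟨a, ha, c, hc', rfl⟩
    refine Metric.mem_cthickening_of_dist_le _ a _ _ (subset_tsupport _ ha) ?_
    simp only [dist_eq_norm, add_sub_cancel_left]
    by_contra! hh
    exact hc' (re_z ν (hν.trans hh))
  exact ⟨R_sm hv ν, (hc.isCompact.cthickening).of_isClosed_subset (isClosed_tsupport _) hsub, hsub.trans h⟩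

theorem cv (x : E) (ν : ℕ) {f : E → ℝ≥0∞} (hf : Measurable f) :
    ∫⁻ y, f y = ∫⁻ z, ENNReal.ofReal (eps ν ^ Module.finrank ℝ E) * f (x - eps ν • z) := by
  have h0 := eps_pos ν
  have h2 : ∫⁻ z, f (x - eps ν • z) = ∫⁻ w, f (x - w) ∂(Measure.map (eps ν • ·) volume) :=
    (lintegral_map (f := fun w => f (x - w)) (by fun_prop) (by fun_prop)).symm
  rw [lintegral_const_mul _ (by fun_prop), h2, Measure.map_addHaar_smul _ h0.ne', lintegral_smul_measure,
    lintegral_sub_left_eq_self, smul_eq_mul, ← mul_assoc, ← ENNReal.ofReal_mul (by positivity),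
    abs_of_pos (by positivity), mul_inv_cancel₀ (by positivity)]
  simp

theorem KB (x : E) (ν : ℕ) {k v : E → ℂ} {mm : E → ℝ≥0∞} {Λ : ℝ≥0∞} (hΛ : Λ ≠ ⊤)
    (hkm : Measurable k) (hv : Measurable v)
    (hk : ∀ z, ENNReal.ofReal (eps ν ^ Module.finrank ℝ E) * ‖k (x - eps ν • z)‖ₑ ≤ Λ * mm z) :
    ‖∫ y, k y * (v y - v x)‖ₑ ≤ Λ * ∫⁻ z, mm z * ‖v (x - eps ν • z) - v x‖ₑ := by
  refine (enorm_integral_le_lintegral_enorm _).trans ?_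
  rw [cv x ν (by fun_prop), ← lintegral_const_mul' _ _ hΛ]
  refine lintegral_mono fun z => ?_
  rw [enorm_mul, ← mul_assoc, ← mul_assoc]
  exact mul_le_mul_left (hk z) _

structure L2T (f : ℕ → E → ℂ) (g : E → ℂ) : Prop where
  mf : ∀ ν, AEStronglyMeasurable (f ν) volume
  mg : MemLp g 2
  t : Tendsto (fun ν => N2 (fun x => f ν x - g x)) atTop (𝓝 0)

theorem N2_add {f g : E → ℂ} (hf : AEStronglyMeasurable f volume) :
    N2 (fun x => f x + g x) ≤ 2 * (N2 f + N2 g) := by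
  unfold N2
  rw [← lintegral_add_left' (by fun_prop), ← lintegral_const_mul' _ _ (by simp)]
  refine lintegral_mono fun x => (pow_le_pow_left' (enorm_add_le _ _) 2).trans ?_
  have := ENNReal.rpow_add_le_mul_rpow_add_rpow ‖f x‖ₑ ‖g x‖ₑ (p := 2) (by norm_num)
  norm_num at this
  exact this

theorem L2T.add {f f' : ℕ → E → ℂ} {g g' : E → ℂ} (h : L2T f g) (h' : L2T f' g') :
    L2T (fun ν x => f ν x + f' ν x) (fun x => g x + g' x) := by
  refine ⟨fun ν => (h.mf ν).add (h'.mf ν), h.mg.add h'.mg, ?_⟩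
  have := ENNReal.Tendsto.const_mul (a := 2) (h.t.add h'.t) (by simp)
  simp only [add_zero, mul_zero] at this
  refine tendsto_of_tendsto_of_tendsto_of_le_of_le tendsto_const_nhds this (fun _ => zero_le) fun ν => ?_
  have := N2_add (f := fun x => f ν x - g x) (g := fun x => f' ν x - g' x) ((h.mf ν).sub h.mg.1)
  refine le_trans (le_of_eq ?_) this
  congr 1; ext x; ring

theorem L2T.mul {f : ℕ → E → ℂ} {g a : E → ℂ} (h : L2T f g) (ha : AEStronglyMeasurable a volume) {C : ℝ}
    (hC : ∀ x, ‖a x‖ ≤ C) : L2T (fun ν x => a x * f ν x) (fun x => a x * g x) := by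
  refine ⟨fun ν => ha.mul (h.mf ν), h.mg.mul (r := 2) (p := ⊤) (memLp_top_of_bound ha C (.of_forall hC)), ?_⟩
  have := ENNReal.Tendsto.const_mul (a := ENNReal.ofReal C ^ 2) h.t (.inr (by finiteness))
  rw [mul_zero] at this
  refine tendsto_of_tendsto_of_tendsto_of_le_of_le tendsto_const_nhds this (fun _ => zero_le) fun ν => ?_
  unfold N2
  dsimp only
  rw [← lintegral_const_mul' _ _ (by finiteness)]
  refine lintegral_mono fun x => ?_
  dsimp only
  rw [← mul_sub, enorm_mul, mul_pow]
  gcongr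
  rw [← ofReal_norm]
  exact ENNReal.ofReal_le_ofReal (hC x)

theorem L2T.const {g : E → ℂ} (h : MemLp g 2) : L2T (fun _ => g) g :=
  ⟨fun _ => h.1, h, by simp [N2]⟩

theorem L2T.neg {f : ℕ → E → ℂ} {g : E → ℂ} (h : L2T f g) : L2T (fun ν x => - f ν x) (fun x => - g x) := by
  simpa using h.mul (a := fun _ => -1) (by fun_prop) (C := 1) (by simp)

theorem L2T.sub {f f' : ℕ → E → ℂ} {g g' : E → ℂ} (h : L2T f g) (h' : L2T f' g') :
    L2T (fun ν x => f ν x - f' ν x) (fun x => g x - g' x) := by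
  simpa [sub_eq_add_neg] using h.add h'.neg

theorem L2T.sum {ι : Type*} {s : Finset ι} {f : ι → ℕ → E → ℂ} {g : ι → E → ℂ} (h : ∀ i, L2T (f i) (g i)) :
    L2T (fun ν x => ∑ i ∈ s, f i ν x) (fun x => ∑ i ∈ s, g i x) := by
  classical
  induction s using Finset.induction_on with
  | empty => simpa using L2T.const (E := E) (g := fun _ => 0) MemLp.zero
  | insert i s hi ih => simpa [Finset.sum_insert hi] using (h i).add ih

theorem L2T.lim {f : ℕ → E → ℂ} {g : E → ℂ} (h : L2T f g) :
    Tendsto (fun ν => N2 (f ν)) atTop (𝓝 (N2 g)) := by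
  simp only [N2_eq]
  refine ((ENNReal.continuous_pow 2).tendsto _).comp (?_ : Tendsto (fun ν => eLpNorm (f ν) 2 volume) _ _)
  have ht : Tendsto (fun ν => eLpNorm (fun x => f ν x - g x) 2 volume) atTop (𝓝 0) := by
    have h1 := h.t
    simp only [N2_eq] at h1
    have := (ENNReal.continuous_rpow_const (y := 1/2)).tendsto _ |>.comp h1
    simp only [Function.comp_def, ← ENNReal.rpow_natCast, ← ENNReal.rpow_mul] at this
    norm_num at this
    exact this
  have g2 := (tendsto_const_nhds (x := eLpNorm g 2 volume)).add ht
  have g1 := ENNReal.Tendsto.sub (tendsto_const_nhds (x := eLpNorm g 2 volume)) ht (.inl h.mg.2.ne)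
  simp only [tsub_zero, add_zero] at g1 g2
  refine tendsto_of_tendsto_of_tendsto_of_le_of_le g1 g2 (fun ν => ?_) fun ν => ?_
  · refine tsub_le_iff_right.2 ?_
    have := eLpNorm_sub_le (h.mf ν) ((h.mf ν).sub h.mg.1) (p := 2) (by norm_num)
    simpa [Pi.sub_def] using this
  · have := eLpNorm_add_le h.mg.1 ((h.mf ν).sub h.mg.1) (p := 2) (by norm_num)
    simpa [Pi.sub_def, Pi.add_def] using this

theorem L2T.congr {f f' : ℕ → E → ℂ} {g : E → ℂ} (h : L2T f g) (e : ∀ ν x, f ν x = f' ν x) : L2T f' g := by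
  have : f = f' := by ext; exact e _ _
  rwa [← this]

theorem R_L2T {v : E → ℂ} (hm : Measurable v) (hv : MemLp v 2) : L2T (fun ν => R ν v) v := by
  refine ⟨fun ν => (R_sm hv ν).continuous.aestronglyMeasurable, hv, ?_⟩
  refine schur (mm := fun z => ‖rho z‖ₑ) (Λ := 1) rho_ts.sm.continuous.enorm.measurable
    (rho_ts.int.2.ne) (fun z hz => by simp [rho_z z hz]) hm hv eps_t (by simp) fun ν x => ?_
  have hi : ∀ x : E, ∫ y, re ν (x - y) = 1 := fun x => by
    rw [integral_sub_left_eq_self (re ν)]; exact re_i ν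
  have hii : ∀ x : E, Integrable fun y => re ν (x - y) := fun x =>
    ((re_sm ν).continuous.integrable_of_hasCompactSupport (re_cs ν)).comp_sub_left x
  have e : R ν v x - v x = ∫ y, re ν (x - y) * (v y - v x) := by
    simp only [mul_sub]
    rw [integral_sub, integral_mul_const, hi, one_mul, R]
    · simp only [mul_comm]
    · have := ((re_cs ν).convolutionExists_right (ContinuousLinearMap.mul ℝ ℂ) (li hv) (re_sm ν).continuous) x
      exact this.congr (.of_forall fun y => by simp [mul_comm])
    · exact (hii x).mul_const _
  rw [e]
  refine KB x ν (by simp) ((re_sm ν).continuous.measurable.comp (by fun_prop)) hm fun z => ?_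
  have := eps_pos ν
  rw [one_mul, sub_sub_cancel, re, smul_smul, inv_mul_cancel₀ this.ne', one_smul, enorm_mul, ← mul_assoc,
    ere (by positivity), ← ENNReal.ofReal_mul (by positivity),
    mul_inv_cancel₀ (by positivity)]
  simp

set_option maxHeartbeats 1000000 in
theorem FR1 {ι α : Type*} [Fintype ι] [Fintype α] {b : α → E} {v : ι → E → ℂ} {C : ι → α → E → ℂ} {h : E → ℂ}
    (hvm : ∀ m, Measurable (v m)) (hv : ∀ m, MemLp (v m) 2) (hhm : Measurable h) (hh : MemLp h 2)
    (hC : ∀ m a, Sm (C m a)) {Λ : ℝ} (hΛ : ∀ m a x, ‖fderiv ℝ (C m a) x‖ ≤ Λ)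
    (hw : ∀ g, Ts univ g → ∫ x, ∑ m, v m x * Pt b (C m) g x = ∫ x, h x * g x) :
    L2T (fun ν x => ∑ m, V b (C m) (R ν (v m)) x) h := by
  let k : ℕ → E → ι → α → E → ℂ := fun ν x m a => D (b a) (fun y => (C m a y - C m a x) * re ν (x - y))
  have hrt : ∀ ν (x : E), Ts univ (fun y => re ν (x - y)) := fun ν x =>
    ⟨(re_sm ν).comp (contDiff_const.sub contDiff_id), (re_cs ν).comp_homeomorph (Homeomorph.subLeft x), subset_univ _⟩
  have hkt : ∀ ν x m a, Ts univ (k ν x m a) := fun ν x m a =>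
    ((hrt ν x).mul ((hC m a).sub contDiff_const)).D _
  have hint : ∀ {g : E → ℂ} m, Ts univ g → Integrable fun y => v m y * g y := fun m hg =>
    (hv m).integrable_mul (hg.lp 2)
  have hDr : ∀ ν (x y e : E), D e (fun y => re ν (x - y)) y = - D e (re ν) (x - y) := by
    intro ν x y e
    have := ((re_sm (E := E) ν).da (x - y)).hasFDerivAt.comp y ((hasFDerivAt_id y).const_sub x)
    simp only [D]
    erw [this.fderiv]; simp
  have hk0 : ∀ ν x m a, ∫ y, k ν x m a y = 0 := by
    intro ν x m a
    have := ibp (u := fun _ => (1:ℂ)) contDiff_const (((hrt ν x).mul ((hC m a).sub (contDiff_const (c := C m a x))))) (b a)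
    simp only [D_const, zero_mul, integral_zero, one_mul] at this
    simpa [eq_comm] using this
  have key : ∀ ν x, (∑ m, V b (C m) (R ν (v m)) x) - R ν h x = ∑ m, ∑ a, ∫ y, k ν x m a y * (v m y - v m x) := by
    intro ν x
    have e1 : R ν h x = ∑ m, ∑ a, ∫ y, v m y * - D (b a) (fun y => C m a y * re ν (x - y)) y := by
      rw [R, ← hw _ (hrt ν x), integral_finsetSum _ fun m _ => hint m ((hrt ν x).Pt (hC m))]
      refine Finset.sum_congr rfl fun m _ => ?_
      simp only [Pt, Finset.mul_sum]
      rw [integral_finsetSum _ fun a _ => hint m (((hrt ν x).mul (hC m a)).D _).neg]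
    rw [e1, ← Finset.sum_sub_distrib]
    refine Finset.sum_congr rfl fun m _ => ?_
    rw [V, ← Finset.sum_sub_distrib]
    refine Finset.sum_congr rfl fun a _ => ?_
    rw [R_D (hv m), ← integral_const_mul, ← integral_sub]
    · rw [← sub_zero (∫ y, _), ← mul_zero (v m x), ← hk0 ν x m a, ← integral_const_mul, ← integral_sub]
      · refine integral_congr_ae (.of_forall fun y => ?_)
        have h1 := (hrt ν x).sm.da y
        have h2 := (hC m a).da y
        simp only [k]
        rw [D_mul (h2.sub_const _) h1, D_mul h2 h1, D_sub h2 (differentiableAt_const _), D_const, hDr]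
        ring
      · refine ((hint m (((hrt ν x).D (b a)).mul' (contDiff_const (c := - C m a x)))).sub
          (hint m (((hrt ν x).mul (hC m a)).D (b a)).neg)).congr (.of_forall fun y => ?_)
        simp only [Pi.sub_apply, hDr]; ring
      · exact (hkt ν x m a).int.const_mul _
    · refine (hint m (((hrt ν x).D (b a)).mul' (contDiff_const (c := - C m a x)))).congr (.of_forall fun y => ?_)
      simp only [hDr]; ring
    · exact hint m (((hrt ν x).mul (hC m a)).D _).neg
  have part : ∀ m a, L2T (fun ν x => ∫ y, k ν x m a y * (v m y - v m x)) (fun _ => 0) := by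
    intro m a
    have hkx : ∀ ν x y, k ν x m a y = D (b a) (C m a) y * re ν (x - y) - (C m a y - C m a x) * D (b a) (re ν) (x - y) := by
      intro ν x y
      have h1 := (hrt ν x).sm.da y
      have h2 := (hC m a).da y
      simp only [k]
      rw [D_mul (h2.sub_const _) h1, D_sub h2 (differentiableAt_const _), D_const, hDr]
      ring
    have c1 := ((hC m a).D (b a)).continuous
    have c2 := (hC m a).continuous
    have hr := rho_ts (E := E)
    have c3 := (hr.D (b a)).sm.continuous
    have c4 := hr.sm.continuous
    refine ⟨fun ν => ?_, MemLp.zero, ?_⟩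
    · refine AEStronglyMeasurable.integral_prod_right' (f := fun p : E × E => k ν p.1 m a p.2 * (v m p.2 - v m p.1)) ?_
      simp only [hkx]
      have c3 := ((re_sm (E := E) ν).D (b a)).continuous
      have c4 := (re_sm (E := E) ν).continuous
      have c5 := hvm m
      refine Measurable.aestronglyMeasurable (Measurable.mul (Continuous.measurable (by fun_prop)) (by fun_prop))
    simp only [sub_zero]
    have hΛ0 : 0 ≤ Λ := (norm_nonneg _).trans (hΛ m a 0)
    refine schur (mm := fun z => ‖b a‖ₑ * ‖rho z‖ₑ + ‖z‖ₑ * ‖D (b a) rho z‖ₑ) (Λ := ENNReal.ofReal Λ)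
      ((c4.enorm.measurable.const_mul _).add (continuous_enorm.measurable.mul c3.enorm.measurable)) ?_ ?_ (hvm m) (hv m) eps_t (by simp) fun ν x => ?_
    · rw [lintegral_add_left (c4.enorm.measurable.const_mul _), lintegral_const_mul' _ _ (by simp)]
      refine ENNReal.add_ne_top.2 ⟨ENNReal.mul_ne_top (by simp) hr.int.2.ne, ?_⟩
      have : Integrable (fun z : E => (‖z‖ : ℝ) • D (b a) rho z) :=
        (continuous_norm.smul c3).integrable_of_hasCompactSupport (HasCompactSupport.smul_left (hr.D _).cs)
      have := this.2.ne
      simp only [enorm_smul, enorm_norm] at this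
      exact this
    · intro z hz
      have : z ∉ tsupport (rho : E → ℂ) := by
        intro h
        have : tsupport (rho : E → ℂ) ⊆ Metric.closedBall 0 1 := closure_minimal (fun y hy => by
          by_contra h'; simp at h'; exact hy (rho_z y h')) Metric.isClosed_closedBall
        have := this h; simp at this; linarith
      have e2 : D (b a) rho z = 0 := by
        by_contra h'; refine this (support_fderiv_subset ℝ (f := rho) ?_)
        intro h0
        exact h' (by simp [D, h0])
      simp [rho_z z hz, e2]
    · refine KB x ν (by simp) (hkt ν x m a).sm.continuous.measurable (hvm m) fun z => ?_
      have h0 := eps_pos ν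
      have hre : ∀ w : E, D (b a) (re ν) w = ((eps ν ^ Module.finrank ℝ E)⁻¹ : ℝ) * ((eps ν)⁻¹ : ℝ) * D (b a) rho ((eps ν)⁻¹ • w) := by
        intro w
        have h1 : DifferentiableAt ℝ (fun z : E => rho ((eps ν)⁻¹ • z)) w :=
          Sm.da (hr.sm.comp (contDiff_const_smul _)) w
        have h2 := (hr.sm.da ((eps ν)⁻¹ • w)).hasFDerivAt.comp w ((hasFDerivAt_id w).const_smul (eps ν)⁻¹)
        unfold re
        rw [D_mul (differentiableAt_const _) h1, D_const, zero_mul, zero_add, mul_assoc]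
        congr 1
        simp only [D]
        erw [h2.fderiv]; simp
      have hmv : ‖C m a (x - eps ν • z) - C m a x‖ ≤ Λ * (eps ν * ‖z‖) := by
        have := Convex.norm_image_sub_le_of_norm_fderiv_le (s := univ) (fun y _ => (hC m a).da y) (fun y _ => hΛ m a y)
          convex_univ (mem_univ x) (mem_univ (x - eps ν • z))
        simpa [norm_smul, abs_of_pos h0] using this
      have hd : ‖D (b a) (C m a) (x - eps ν • z)‖ ≤ Λ * ‖b a‖ :=
        (ContinuousLinearMap.le_opNorm _ _).trans (by gcongr; exact hΛ m a _)
      have hz : (eps ν)⁻¹ • (x - (x - eps ν • z)) = z := by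
        rw [sub_sub_cancel, smul_smul, inv_mul_cancel₀ h0.ne', one_smul]
      rw [hkx, hre, re, hz]
      set N := eps ν ^ Module.finrank ℝ E
      have hN : 0 < N := by positivity
      have e1 : ‖D (b a) (C m a) (x - eps ν • z) * (((N⁻¹ : ℝ) : ℂ) * rho z) - (C m a (x - eps ν • z) - C m a x) *
          (((N⁻¹ : ℝ) : ℂ) * ((eps ν)⁻¹ : ℝ) * D (b a) rho z)‖ ≤ N⁻¹ * (Λ * (‖b a‖ * ‖rho z‖ + ‖z‖ * ‖D (b a) rho z‖)) := by
        refine (norm_sub_le _ _).trans ?_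
        simp only [norm_mul, Complex.norm_real, norm_inv, Real.norm_of_nonneg hN.le, Real.norm_of_nonneg h0.le]
        calc _ ≤ Λ * ‖b a‖ * (N⁻¹ * ‖rho z‖) + Λ * (eps ν * ‖z‖) * (N⁻¹ * (eps ν)⁻¹ * ‖D (b a) rho z‖) := by gcongr
          _ = _ := by field_simp
      have e2 : ENNReal.ofReal Λ * (‖b a‖ₑ * ‖rho z‖ₑ + ‖z‖ₑ * ‖D (b a) rho z‖ₑ) =
          ENNReal.ofReal (Λ * (‖b a‖ * ‖rho z‖ + ‖z‖ * ‖D (b a) rho z‖)) := by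
        rw [ENNReal.ofReal_mul hΛ0, ENNReal.ofReal_add (by positivity) (by positivity), ENNReal.ofReal_mul (norm_nonneg _),
          ENNReal.ofReal_mul (norm_nonneg _)]
        simp only [ofReal_norm]
      rw [e2, ← ofReal_norm, ← ENNReal.ofReal_mul hN.le]
      refine ENNReal.ofReal_le_ofReal ?_
      calc _ ≤ N * _ := mul_le_mul_of_nonneg_left e1 hN.le
        _ = _ := by rw [← mul_assoc, mul_inv_cancel₀ hN.ne', one_mul]
  have := (L2T.sum (s := Finset.univ) fun m => L2T.sum (s := Finset.univ) fun a => part m a).add (R_L2T hhm hh)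
  simp only [Finset.sum_const_zero, zero_add] at this
  exact this.congr fun ν x => by rw [← key]; ring
end mol
end NN

namespace NN
open MeasureTheory Filter Topology Set
open scoped ContDiff ComplexConjugate ENNReal

section apriori
set_option linter.unusedSectionVars false
variable {E : Type*} [NormedAddCommGroup E] [InnerProductSpace ℝ E]
variable {ι α : Type*} [Fintype ι] [Fintype α]

def cj (c : α → E → ℂ) : α → E → ℂ := fun a x => conj (c a x)

structure Geo (b : α → E) (c : ι → α → E → ℂ) (p : α → ι → E → ℂ) : Prop where
  csm : ∀ j a, Sm (c j a)
  psm : ∀ a j, Sm (p a j)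
  dec : ∀ u, Sm u → ∀ x a, D (b a) u x = ∑ l, (p a l x * V b (c l) u x + conj (p a l x) * V b (cj (c l)) u x)

variable (b : α → E) (c : ι → α → E → ℂ) (p : α → ι → E → ℂ) (β : ι → E → ℂ)

def Λ (j : ι) (u : E → ℂ) (x : E) : ℂ := V b (c j) u x + β j x * u x
def kap (j : ι) (x : E) : ℂ := ∑ a, D (b a) (cj (c j) a) x
def gam (j : ι) (x : E) : ℂ := - kap b c j x + conj (β j x)
def Λs (j : ι) (u : E → ℂ) (x : E) : ℂ := - V b (cj (c j)) u x + gam b c β j x * u x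
def om (k j : ι) (a : α) (x : E) : ℂ := V b (c k) (cj (c j) a) x - V b (cj (c j)) (c k a) x
def ta (k j l : ι) (x : E) : ℂ := ∑ a, om b c k j a x * p a l x
def ta' (k j l : ι) (x : E) : ℂ := ∑ a, om b c k j a x * conj (p a l x)
def W (k j : ι) (x : E) : ℂ := V b (c k) (gam b c β j) x + V b (cj (c j)) (β k) x
def G (v : ι → E → ℂ) (j k : ι) (x : E) : ℂ :=
  (∑ l, (- (ta b c p k j l x * (Λ b c β l (v j) x - β l x * v j x) * conj (v k x))
    + v j x * conj (conj (ta' b c p k j l x) * Λ b c β l (v k) x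
      + V b (c l) (fun y => conj (ta' b c p k j l y)) x * v k x)
    - ta' b c p k j l x * gam b c β l x * v j x * conj (v k x)))
  + W b c β k j x * v j x * conj (v k x)

variable {b c p β}

theorem cj_sm {c : α → E → ℂ} (h : ∀ a, Sm (c a)) (a : α) : Sm (cj c a) := (h a).conj

theorem kap_sm (h : Geo b c p) (j : ι) : Sm (kap b c j) := Sm.sum' fun a => (cj_sm (h.csm j) a).D _
theorem gam_sm (h : Geo b c p) (hβ : ∀ j, Sm (β j)) (j : ι) : Sm (gam b c β j) :=
  (kap_sm h j).neg.add (hβ j).conj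
theorem om_sm (h : Geo b c p) (k j : ι) (a : α) : Sm (om b c k j a) :=
  (Sm.V (h.csm k) (cj_sm (h.csm j) a)).sub (Sm.V (cj_sm (h.csm j)) (h.csm k a))
theorem ta'_sm (h : Geo b c p) (k j l : ι) : Sm (ta' b c p k j l) :=
  Sm.sum' fun a => (om_sm h k j a).mul (h.psm a l).conj
theorem Ts.Λ {O : Set E} {u : E → ℂ} (h : Geo b c p) (hβ : ∀ j, Sm (β j)) (hu : Ts O u) (j : ι) :
    Ts O (Λ b c β j u) := (hu.V (h.csm j)).add (hu.mul (hβ j))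
theorem Ts.Λs {O : Set E} {u : E → ℂ} (h : Geo b c p) (hβ : ∀ j, Sm (β j)) (hu : Ts O u) (j : ι) :
    Ts O (Λs b c β j u) := (hu.V (cj_sm (h.csm j))).neg.add (hu.mul (gam_sm h hβ j))

theorem comm (h : Geo b c p) (hβ : ∀ j, Sm (β j)) {u : E → ℂ} (hu : Sm u) (k j : ι) (x : E) :
    Λ b c β k (Λs b c β j u) x - Λs b c β j (Λ b c β k u) x =
      - V b (om b c k j) u x + W b c β k j x * u x := by
  have h1 := h.csm k
  have h2 := cj_sm (h.csm j)
  have h3 := gam_sm h hβ j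
  have e := V_comm (b := b) h1 h2 hu x
  have e1 : V b (c k) (Λs b c β j u) x = - V b (c k) (V b (cj (c j)) u) x +
      (V b (c k) (gam b c β j) x * u x + gam b c β j x * V b (c k) u x) := by
    unfold Λs
    rw [V_add (Sm.V h2 hu).neg (h3.mul hu), V_neg, V_mul h3 hu]
  have e2 : V b (cj (c j)) (Λ b c β k u) x = V b (cj (c j)) (V b (c k) u) x +
      (V b (cj (c j)) (β k) x * u x + β k x * V b (cj (c j)) u x) := by
    unfold Λ
    rw [V_add (Sm.V h1 hu) ((hβ k).mul hu), V_mul (hβ k) hu]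
  rw [show Λ b c β k (Λs b c β j u) x = _ from rfl, show Λs b c β j (Λ b c β k u) x = _ from rfl]
  unfold Λ at e2 ⊢
  unfold Λs at e1 ⊢
  rw [e1, e2]
  have e3 : V b (om b c k j) u x = V b (fun a y => V b (c k) (cj (c j) a) y - V b (cj (c j)) (c k a) y) u x := rfl
  rw [e3, ← e, W]; ring

theorem om_dec (h : Geo b c p) {u : E → ℂ} (hu : Sm u) (k j : ι) (x : E) :
    V b (om b c k j) u x = ∑ l, (ta b c p k j l x * (Λ b c β l u x - β l x * u x)
      + ta' b c p k j l x * (- Λs b c β l u x + gam b c β l x * u x)) := by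
  simp only [V, ta, ta', Finset.sum_mul, ← Finset.sum_add_distrib]
  rw [Finset.sum_comm]
  refine Finset.sum_congr rfl fun a _ => ?_
  rw [h.dec u hu, Finset.mul_sum]
  refine Finset.sum_congr rfl fun l _ => ?_
  simp only [Λ, Λs]; ring

variable [FiniteDimensional ℝ E] [MeasurableSpace E] [BorelSpace E]

theorem adj (h : Geo b c p) (hβ : ∀ j, Sm (β j)) {O : Set E} {u v : E → ℂ} (hu : Ts O u) (hv : Ts O v) (j : ι) :
    ∫ x, Λ b c β j u x * conj (v x) = ∫ x, u x * conj (Λs b c β j v x) := by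
  have e1 := ibpV (b := b) (h.csm j) hu.sm hv.conj
  have e2 : ∀ x, Pt b (c j) (fun y => conj (v y)) x = conj (Λs b c β j v x) - β j x * conj (v x) := by
    intro x
    rw [Pt_eq (h.csm j) hv.conj.sm, V_conj hv.sm, Λs, gam, kap]
    have : conj (∑ a, D (b a) (cj (c j) a) x) = ∑ a, D (b a) (c j a) x := by
      rw [map_sum]
      refine Finset.sum_congr rfl fun a _ => ?_
      unfold cj; rw [D_conj ((h.csm j a).da x)]; simp
    have e4 : (fun a y => conj (c j a y)) = cj (c j) := rfl
    rw [e4]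
    simp only [map_add, map_neg, map_mul, this, Complex.conj_conj]; ring
  simp only [e2] at e1
  have i1 : Integrable fun x => β j x * u x * conj (v x) := (hv.conj.mul ((hβ j).mul hu.sm)).int
  simp only [Λ, add_mul]
  rw [integral_add ((hv.conj.mul (Sm.V (h.csm j) hu.sm)).int) i1, e1, ← integral_add _ i1]
  · exact integral_congr_ae (.of_forall fun x => by ring)
  · exact ((((hv.Λs h hβ j).conj).sub' (hv.conj.mul (hβ j))).mul hu.sm).int

theorem adj' (h : Geo b c p) (hβ : ∀ j, Sm (β j)) {O : Set E} {u v : E → ℂ} (hu : Ts O u) (hv : Ts O v) (j : ι) :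
    ∫ x, Λs b c β j u x * conj (v x) = ∫ x, u x * conj (Λ b c β j v x) := by
  have := congrArg conj (adj h hβ hv hu j)
  rw [← integral_conj, ← integral_conj] at this
  simp only [map_mul, Complex.conj_conj, mul_comm] at this ⊢
  exact this.symm

theorem int_shape {A A' W : E → ℂ} {X Y Y' Z : ι → E → ℂ} (hA : Integrable A) (hA' : Integrable A')
    (hW : Integrable W) (hX : ∀ l, Integrable (X l)) (hY : ∀ l, Integrable (Y l)) (hY' : ∀ l, Integrable (Y' l))
    (hZ : ∀ l, Integrable (Z l)) (e : ∫ x, A x = ∫ x, A' x) (e' : ∀ l, ∫ x, Y l x = ∫ x, Y' l x) :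
    ∫ x, (A x + ((∑ l, (X l x + Y l x - Z l x)) + W x)) = ∫ x, (A' x + ((∑ l, (X l x + Y' l x - Z l x)) + W x)) := by
  have i : ∀ {A : E → ℂ} {Y : ι → E → ℂ}, Integrable A → (∀ l, Integrable (Y l)) →
      Integrable fun x => A x + ((∑ l, (X l x + Y l x - Z l x)) + W x) := fun h1 h2 =>
    h1.add ((integrable_finsetSum _ fun l _ => ((hX l).add (h2 l)).sub (hZ l)).add hW)
  rw [← sub_eq_zero, ← integral_sub (i hA hY) (i hA' hY')]
  have : ∀ x, (A x + ((∑ l, (X l x + Y l x - Z l x)) + W x)) - (A' x + ((∑ l, (X l x + Y' l x - Z l x)) + W x)) =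
      (A x - A' x) + ∑ l, (Y l x - Y' l x) := by
    intro x; simp only [Finset.sum_sub_distrib, Finset.sum_add_distrib]; ring
  simp only [this]
  have i1 : Integrable fun x => A x - A' x := hA.sub hA'
  have i2 : ∀ l, Integrable fun x => Y l x - Y' l x := fun l => (hY l).sub (hY' l)
  rw [integral_add i1 (integrable_finsetSum _ fun l _ => i2 l), integral_finsetSum _ fun l _ => i2 l,
    integral_sub hA hA', e, sub_self, zero_add]
  refine Finset.sum_eq_zero fun l _ => ?_
  rw [integral_sub (hY l) (hY' l), e', sub_self]

theorem B0 (h : Geo b c p) (hβ : ∀ j, Sm (β j)) {O : Set E} {v : ι → E → ℂ} (hv : ∀ j, Ts O (v j)) (j k : ι) :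
    ∫ x, Λs b c β j (v j) x * conj (Λs b c β k (v k) x) =
      ∫ x, (Λ b c β k (v j) x * conj (Λ b c β j (v k) x) + G b c p β v j k x) := by
  have ht := fun l => ta'_sm (b := b) h k j l
  have hW : Sm (W b c β k j) := (Sm.V (h.csm k) (gam_sm h hβ j)).add (Sm.V (cj_sm (h.csm j)) (hβ k))
  have hta : ∀ l, Sm (ta b c p k j l) := fun l => Sm.sum' fun a => (om_sm h k j a).mul (h.psm a l)
  rw [← adj h hβ ((hv j).Λs h hβ j) (hv k) k]
  have e1 : ∀ x, Λ b c β k (Λs b c β j (v j)) x * conj (v k x) = Λs b c β j (Λ b c β k (v j)) x * conj (v k x)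
      + ((∑ l, (- (ta b c p k j l x * (Λ b c β l (v j) x - β l x * v j x) * conj (v k x))
        + Λs b c β l (v j) x * conj (conj (ta' b c p k j l x) * v k x)
        - ta' b c p k j l x * gam b c β l x * v j x * conj (v k x)))
        + W b c β k j x * v j x * conj (v k x)) := by
    intro x
    have := comm h hβ (hv j).sm k j x
    rw [om_dec (β := β) h (hv j).sm] at this
    rw [sub_eq_iff_eq_add.1 this, add_mul, add_mul, add_comm]
    congr 2
    rw [← Finset.sum_neg_distrib, Finset.sum_mul]
    refine Finset.sum_congr rfl fun l _ => ?_
    simp only [map_mul, Complex.conj_conj]; ring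
  have i0 := ((hv k).conj.mul (((hv j).Λ h hβ k).Λs h hβ j).sm).int
  have iW := ((hv k).conj.mul (hW.mul (hv j).sm)).int
  have i1 : ∀ l, Integrable fun x => - (ta b c p k j l x * (Λ b c β l (v j) x - β l x * v j x) * conj (v k x)) := fun l =>
    ((hv k).conj.mul ((hta l).mul (((hv j).Λ h hβ l).sm.sub ((hβ l).mul (hv j).sm)))).neg.int
  have i2 : ∀ l, Integrable fun x => Λs b c β l (v j) x * conj (conj (ta' b c p k j l x) * v k x) := fun l =>
    (((hv k).mul (ht l).conj).conj.mul ((hv j).Λs h hβ l).sm).int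
  have i3 : ∀ l, Integrable fun x => ta' b c p k j l x * gam b c β l x * v j x * conj (v k x) := fun l =>
    ((hv k).conj.mul (((ht l).mul (gam_sm h hβ l)).mul (hv j).sm)).int
  have i4 : ∀ l, Integrable fun x => v j x * conj (conj (ta' b c p k j l x) * Λ b c β l (v k) x
      + V b (c l) (fun y => conj (ta' b c p k j l y)) x * v k x) := fun l =>
    (((((hv k).Λ h hβ l).mul (ht l).conj).add ((hv k).mul (Sm.V (h.csm l) (ht l).conj))).conj.mul (hv j).sm).int
  have i5 : Integrable fun x => Λ b c β k (v j) x * conj (Λ b c β j (v k) x) :=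
    (((hv k).Λ h hβ j).conj.mul ((hv j).Λ h hβ k).sm).int
  simp only [e1, G]
  refine int_shape i0 i5 iW i1 i2 i4 i3 (adj' h hβ ((hv j).Λ h hβ k) (hv k) j) fun l => ?_
  rw [adj' h hβ (hv j) ((hv k).mul (ht l).conj) l]
  refine integral_congr_ae (.of_forall fun x => ?_)
  simp only [Λ]
  rw [V_mul (ht l).conj (hv k).sm]
  congr 2; ring
end apriori
end NN

namespace NN
open MeasureTheory Filter Topology Set
open scoped ContDiff ComplexConjugate ENNReal

section apriori2
set_option linter.unusedSectionVars false
variable {ι α : Type*} [Fintype ι] [Fintype α] [DecidableEq ι]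

theorem re_ge {z : ℂ} {r : ℝ} (h : ‖z‖ ≤ r) : -r ≤ z.re :=
  (neg_le_neg h).trans ((abs_le.1 (Complex.abs_re_le_norm z)).1)

theorem sum_sq_le (v : ι → ℝ) : (∑ j, v j) ^ 2 ≤ Fintype.card ι * ∑ j, v j ^ 2 :=
  sq_sum_le_card_mul_sum_sq

theorem pw {v β γ w : ι → ℂ} {A W : ι → ι → ℂ} {t t' d : ι → ι → ι → ℂ} {m m1 B ε : ℝ} (hm : 1 ≤ m) (hm1 : 0 ≤ m1)
    (hB : 0 ≤ B) (hε : 0 ≤ ε) (hεB : ε * (Fintype.card ι : ℝ) ^ 2 * (B + 4) ≤ 1 / 2)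
    (hβ : ∀ l, ‖β l‖ ≤ m * B / 2) (hγ : ∀ l, ‖γ l‖ ≤ 1 + m * B / 2)
    (ht : ∀ k j l, ‖t k j l‖ ≤ ε) (ht' : ∀ k j l, ‖t' k j l‖ ≤ ε) (hd : ∀ k j l, ‖d k j l‖ ≤ ε)
    (hW : ∀ k j, ‖W k j - (m1 * (w k * conj (w j)) + if j = k then (m:ℂ) else 0)‖ ≤ ε * m) :
    m / 2 * (∑ j, ‖v j‖ ^ 2) - ∑ j, ∑ l, ‖A l j‖ ^ 2 ≤ (∑ j, ∑ k, ((∑ l, (- (t k j l * (A l j - β l * v j) * conj (v k))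
    + v j * conj (conj (t' k j l) * A l k + d k j l * v k)
    - t' k j l * γ l * v j * conj (v k))) + W k j * v j * conj (v k))).re := by
  set a : ι → ℝ := fun j => ‖v j‖ with ha
  set S : ι → ℝ := fun j => ∑ l, ‖A l j‖ with hS
  set N : ℝ := (Fintype.card ι : ℝ) with hN
  have a0 : ∀ j, 0 ≤ a j := fun j => norm_nonneg _
  have S0 : ∀ j, 0 ≤ S j := fun j => Finset.sum_nonneg fun _ _ => norm_nonneg _
  have key : ∀ j k, (m1 * (w k * conj (w j)) * v j * conj (v k)).re + (if j = k then m * a j ^ 2 else 0)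
      - (ε * (S j * a k) + ε * (S k * a j) + (ε * N * (m * B + 2) + ε * m) * (a j * a k)) ≤
      ((∑ l, (- (t k j l * (A l j - β l * v j) * conj (v k)) + v j * conj (conj (t' k j l) * A l k + d k j l * v k)
    - t' k j l * γ l * v j * conj (v k))) + W k j * v j * conj (v k)).re := by
    intro j k
    have e1 : ∀ l, ‖- (t k j l * (A l j - β l * v j) * conj (v k)) + v j * conj (conj (t' k j l) * A l k + d k j l * v k)
        - t' k j l * γ l * v j * conj (v k)‖ ≤ ε * (‖A l j‖ * a k) + ε * (‖A l k‖ * a j) + ε * (m * B + 2) * (a j * a k) := by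
      intro l
      have x1 : ‖t k j l * (A l j - β l * v j) * conj (v k)‖ ≤ ε * (‖A l j‖ + m * B / 2 * a j) * a k := by
        rw [norm_mul, norm_mul, RCLike.norm_conj]
        refine mul_le_mul_of_nonneg_right (mul_le_mul (ht k j l) ((norm_sub_le _ _).trans ?_) (norm_nonneg _) hε) (a0 k)
        rw [norm_mul]; gcongr; exact hβ l
      have x2 : ‖v j * conj (conj (t' k j l) * A l k + d k j l * v k)‖ ≤ a j * (ε * ‖A l k‖ + ε * a k) := by
        rw [norm_mul, RCLike.norm_conj]
        refine mul_le_mul_of_nonneg_left ((norm_add_le _ _).trans ?_) (a0 j)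
        rw [norm_mul, norm_mul, RCLike.norm_conj]
        gcongr
        exacts [ht' k j l, hd k j l]
      have x3 : ‖t' k j l * γ l * v j * conj (v k)‖ ≤ ε * (1 + m * B / 2) * a j * a k := by
        rw [norm_mul, norm_mul, norm_mul, RCLike.norm_conj]
        gcongr
        exacts [ht' k j l, hγ l]
      refine (norm_sub_le _ _).trans ((add_le_add_left (norm_add_le _ _) _).trans ?_)
      rw [norm_neg]
      linarith
    have e2 : ‖∑ l, (- (t k j l * (A l j - β l * v j) * conj (v k)) + v j * conj (conj (t' k j l) * A l k + d k j l * v k)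
        - t' k j l * γ l * v j * conj (v k))‖ ≤ ε * (S j * a k) + ε * (S k * a j) + ε * N * (m * B + 2) * (a j * a k) := by
      refine (norm_sum_le_of_le _ fun l _ => e1 l).trans (le_of_eq ?_)
      simp only [Finset.sum_add_distrib, ← Finset.mul_sum, ← Finset.sum_mul, Finset.sum_const, Finset.card_univ, nsmul_eq_mul]
      simp only [hS, hN]; ring
    have e3 : ‖(W k j - (m1 * (w k * conj (w j)) + if j = k then (m:ℂ) else 0)) * v j * conj (v k)‖ ≤ ε * m * (a j * a k) := by
      rw [norm_mul, norm_mul, RCLike.norm_conj, mul_assoc]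
      gcongr; exact hW k j
    have e4 : ((if j = k then (m:ℂ) else 0) * v j * conj (v k)).re = if j = k then m * a j ^ 2 else 0 := by
      split_ifs with h
      · subst h
        rw [mul_assoc, Complex.mul_conj, ← Complex.ofReal_mul, Complex.ofReal_re, Complex.normSq_eq_norm_sq]
      · simp
    have e5 : W k j * v j * conj (v k) = (W k j - (m1 * (w k * conj (w j)) + if j = k then (m:ℂ) else 0)) * v j * conj (v k)
      + m1 * (w k * conj (w j)) * v j * conj (v k) + (if j = k then (m:ℂ) else 0) * v j * conj (v k) := by ring
    have := re_ge e2; have := re_ge e3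
    rw [Complex.add_re, e5, Complex.add_re, Complex.add_re, e4]
    linarith
  simp only [Complex.re_sum] 
  have key2 := Finset.sum_le_sum fun j (_ : j ∈ Finset.univ) => Finset.sum_le_sum fun k (_ : k ∈ Finset.univ) => key j k
  refine le_trans ?_ key2
  have z0 : 0 ≤ ∑ j, ∑ k, (m1 * (w k * conj (w j)) * v j * conj (v k)).re := by
    have : ∑ j, ∑ k, (m1 * (w k * conj (w j)) * v j * conj (v k)) =
        m1 * ((∑ j, conj (w j) * v j) * conj (∑ j, conj (w j) * v j)) := by
      simp only [map_sum, Finset.sum_mul, Finset.mul_sum, map_mul, Complex.conj_conj]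
      rw [Finset.sum_comm]
      exact Finset.sum_congr rfl fun j _ => Finset.sum_congr rfl fun k _ => by ring
    have := congrArg Complex.re this
    simp only [Complex.re_sum] at this
    rw [this, Complex.mul_conj, ← Complex.ofReal_mul, Complex.ofReal_re]
    exact mul_nonneg hm1 (Complex.normSq_nonneg _)
  have q1 := sum_sq_le a
  have q2 := sum_sq_le S
  have q3 : ∑ j, S j ^ 2 ≤ N * ∑ j, ∑ l, ‖A l j‖ ^ 2 := by
    rw [Finset.mul_sum]; exact Finset.sum_le_sum fun j _ => sum_sq_le _
  have N0 : 0 ≤ N := Nat.cast_nonneg _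
  have N1 : N ≤ N ^ 2 := by
    rcases Nat.eq_zero_or_pos (Fintype.card ι) with h | h
    · simp [hN, h]
    · have : (1:ℝ) ≤ N := Nat.one_le_cast.2 h
      nlinarith
  simp only [Finset.sum_sub_distrib, Finset.sum_add_distrib, ← Finset.mul_sum, ← Finset.sum_mul, Finset.sum_ite_eq,
    Finset.mem_univ, if_true]
  set s := ∑ j, a j
  set T := ∑ j, S j
  set X := ∑ j, ∑ l, ‖A l j‖ ^ 2
  set Y := ∑ j, a j ^ 2
  have s0 : 0 ≤ s := Finset.sum_nonneg fun j _ => a0 j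
  have X0 : 0 ≤ X := by positivity
  have Y0 : 0 ≤ Y := by positivity
  have T2 : T ^ 2 ≤ N ^ 2 * X := by nlinarith
  have c1 : ε * (T * s) + ε * (T * s) ≤ ε * (N ^ 2 * X) + ε * m * N ^ 2 * Y := by
    have : 2 * (T * s) ≤ T ^ 2 + s ^ 2 := by nlinarith [sq_nonneg (T - s)]
    have h2 : s ^ 2 ≤ m * N ^ 2 * Y := by
      calc s ^ 2 ≤ 1 * N * Y := by linarith
        _ ≤ m * N ^ 2 * Y := by gcongr
    nlinarith
  have c2 : (ε * N * (m * B + 2) + ε * m) * (s * s) ≤ ε * m * N ^ 2 * (B + 3) * Y := by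
    rcases Nat.eq_zero_or_pos (Fintype.card ι) with h | h
    · have : s * s ≤ 0 := by rw [← sq]; simpa [h] using q1
      have : s * s = 0 := le_antisymm this (mul_self_nonneg _)
      rw [this]; simp [hN, h]
    · have h1 : (1:ℝ) ≤ N := Nat.one_le_cast.2 h
      calc (ε * N * (m * B + 2) + ε * m) * (s * s) ≤ (ε * N * (m * B + 2 * m) + ε * (m * N)) * (N * Y) := by
            refine mul_le_mul ?_ (by rw [← sq]; exact q1) (by positivity) (by positivity)
            gcongr <;> nlinarith
        _ = _ := by ring
  have c3 : ε * m * N ^ 2 * Y + ε * m * N ^ 2 * (B + 3) * Y ≤ m / 2 * Y := by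
    have : ε * N ^ 2 * (B + 4) * (m * Y) ≤ 1 / 2 * (m * Y) := by gcongr
    linarith
  have c4 : ε * (N ^ 2 * X) ≤ X := by
    have : ε * N ^ 2 * 1 ≤ ε * N ^ 2 * (B + 4) := by gcongr; linarith
    nlinarith
  have : ∑ x, S x * s = T * s := by rw [← Finset.sum_mul]
  have : ∑ x, a x * s = s * s := by rw [← Finset.sum_mul]
  have : ∑ x, a x * T = T * s := by rw [← Finset.sum_mul, mul_comm]
  simp only [mul_comm T s] at *
  nlinarith


variable {E : Type*} [NormedAddCommGroup E] [InnerProductSpace ℝ E]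
  [FiniteDimensional ℝ E] [MeasurableSpace E] [BorelSpace E]

structure Pin (b : α → E) (c : ι → α → E → ℂ) (p : α → ι → E → ℂ) (β : ι → E → ℂ) (m : E → ℝ) (O : Set E) : Prop where
  geo : Geo b c p
  βsm : ∀ j, Sm (β j)
  pin : ∀ x ∈ O, ∃ (B ε m1 : ℝ) (w : ι → ℂ), 1 ≤ m x ∧ 0 ≤ m1 ∧ 0 ≤ B ∧ 0 ≤ ε ∧
    ε * (Fintype.card ι : ℝ) ^ 2 * (B + 4) ≤ 1 / 2 ∧ (∀ l, ‖β l x‖ ≤ m x * B / 2) ∧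
    (∀ l, ‖gam b c β l x‖ ≤ 1 + m x * B / 2) ∧ (∀ k j l, ‖ta b c p k j l x‖ ≤ ε) ∧ (∀ k j l, ‖ta' b c p k j l x‖ ≤ ε) ∧
    (∀ k j l, ‖V b (c l) (fun y => conj (ta' b c p k j l y)) x‖ ≤ ε) ∧
    ∀ k j, ‖W b c β k j x - (m1 * (w k * conj (w j)) + if j = k then (m x:ℂ) else 0)‖ ≤ ε * m x

variable {b : α → E} {c : ι → α → E → ℂ} {p : α → ι → E → ℂ} {β : ι → E → ℂ} {m : E → ℝ} {O : Set E}

theorem Ts.sq {u : E → ℂ} (hu : Ts O u) : Integrable fun x => ‖u x‖ ^ 2 := (memLp_two_iff_integrable_sq_norm hu.sm.continuous.aestronglyMeasurable).1 (hu.lp 2)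

theorem Ts.N2 {u : E → ℂ} (hu : Ts O u) : N2 u = ENNReal.ofReal (∫ x, ‖u x‖ ^ 2) := by
  rw [ofReal_integral_eq_lintegral_ofReal hu.sq (.of_forall fun x => by positivity), NN.N2]
  refine lintegral_congr fun x => ?_
  rw [ENNReal.ofReal_pow (norm_nonneg _), ofReal_norm]

theorem skew (A : ι → ι → ℂ) : (∑ j, ∑ k, A k j * conj (A j k)).re =
    (∑ j, ∑ k, ‖A k j‖ ^ 2) - (∑ j, ∑ k, ‖A j k - A k j‖ ^ 2) / 2 := by
  have h : ∀ j k, ‖A j k - A k j‖ ^ 2 = ‖A j k‖ ^ 2 + ‖A k j‖ ^ 2 - 2 * (A k j * conj (A j k)).re := by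
    intro j k
    simp only [← Complex.normSq_eq_norm_sq, Complex.normSq_apply, Complex.sub_re, Complex.sub_im, Complex.mul_re, Complex.conj_re, Complex.conj_im]
    ring
  simp only [h, Finset.sum_sub_distrib, Finset.sum_add_distrib, ← Finset.mul_sum, Complex.re_sum]
  rw [Finset.sum_comm (f := fun j k => ‖A j k‖ ^ 2)]; ring

theorem B1 (h : Pin b c p β m O) {v : ι → E → ℂ} (hv : ∀ j, Ts O (v j)) {q : E → ℂ} (hq : Sm q) (hqm : ∀ x ∈ O, ‖q x‖ ^ 2 ≤ m x) :
    (∑ j, ∫ x, ‖q x * v j x‖ ^ 2) / 2 ≤ (∫ x, ‖∑ j, Λs b c β j (v j) x‖ ^ 2)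
      + (∑ j, ∑ k, ∫ x, ‖Λ b c β j (v k) x - Λ b c β k (v j) x‖ ^ 2) / 2 := by
  have hG := h.geo
  have hβ := h.βsm
  have iG : ∀ j k, Integrable (G b c p β v j k) := fun j k => by
    have ht := fun l => ta'_sm (b := b) hG k j l
    have hW : Sm (W b c β k j) := (Sm.V (hG.csm k) (gam_sm hG hβ j)).add (Sm.V (cj_sm (hG.csm j)) (hβ k))
    have hta : ∀ l, Sm (ta b c p k j l) := fun l => Sm.sum' fun a => (om_sm hG k j a).mul (hG.psm a l)
    refine (integrable_finsetSum _ fun l _ => ?_).add ((hv k).conj.mul (hW.mul (hv j).sm)).int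
    refine (((hv k).conj.mul ((hta l).mul (((hv j).Λ hG hβ l).sm.sub ((hβ l).mul (hv j).sm)))).neg.int.add ?_).sub
      ((hv k).conj.mul (((ht l).mul (gam_sm hG hβ l)).mul (hv j).sm)).int
    exact (((((hv k).Λ hG hβ l).mul (ht l).conj).add ((hv k).mul (Sm.V (hG.csm l) (ht l).conj))).conj.mul (hv j).sm).int
  have i5 : ∀ j k, Integrable fun x => Λ b c β k (v j) x * conj (Λ b c β j (v k) x) := fun j k =>
    (((hv k).Λ hG hβ j).conj.mul ((hv j).Λ hG hβ k).sm).int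
  have i6 : ∀ j k, Integrable fun x => Λs b c β j (v j) x * conj (Λs b c β k (v k) x) := fun j k =>
    (((hv k).Λs hG hβ k).conj.mul ((hv j).Λs hG hβ j).sm).int
  have iS : ∀ j k, Integrable fun x => ‖Λ b c β j (v k) x - Λ b c β k (v j) x‖ ^ 2 := fun j k =>
    (((hv k).Λ hG hβ j).sub' ((hv j).Λ hG hβ k)).sq
  have iq : ∀ j, Integrable fun x => ‖q x * v j x‖ ^ 2 := fun j => ((hv j).mul hq).sq
  have e : ∫ x, ‖∑ j, Λs b c β j (v j) x‖ ^ 2 =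
      ∫ x, ((∑ j, ∑ k, Λ b c β k (v j) x * conj (Λ b c β j (v k) x)).re + (∑ j, ∑ k, G b c p β v j k x).re) := by
    have e1 : ∀ x, ‖∑ j, Λs b c β j (v j) x‖ ^ 2 = (∑ j, ∑ k, Λs b c β j (v j) x * conj (Λs b c β k (v k) x)).re := fun x => by
      rw [← Finset.sum_mul_sum, ← map_sum, Complex.mul_conj, Complex.ofReal_re, Complex.normSq_eq_norm_sq]
    simp only [e1, ← Complex.add_re, ← Finset.sum_add_distrib]
    refine (integral_re (integrable_finsetSum _ fun j _ => integrable_finsetSum _ fun k _ => i6 j k)).trans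
      (Eq.trans ?_ (integral_re (integrable_finsetSum _ fun j _ => integrable_finsetSum _ fun k _ => (i5 j k).add (iG j k))).symm)
    congr 1
    rw [integral_finsetSum _ fun j _ => integrable_finsetSum _ fun k _ => i6 j k,
      integral_finsetSum _ fun j _ => integrable_finsetSum _ fun k _ => (i5 j k).add (iG j k)]
    refine Finset.sum_congr rfl fun j _ => ?_
    rw [integral_finsetSum _ fun k _ => i6 j k, integral_finsetSum _ fun k _ => (i5 j k).add (iG j k)]
    exact Finset.sum_congr rfl fun k _ => B0 hG hβ hv j k
  have iL : Integrable fun x => (∑ j, ∑ k, Λ b c β k (v j) x * conj (Λ b c β j (v k) x)).re + (∑ j, ∑ k, G b c p β v j k x).re := by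
    exact (integrable_finsetSum _ fun j _ => integrable_finsetSum _ fun k _ => i5 j k).re.add
      (integrable_finsetSum _ fun j _ => integrable_finsetSum _ fun k _ => iG j k).re
  have iS2 : Integrable fun x => (∑ j, ∑ k, ‖Λ b c β j (v k) x - Λ b c β k (v j) x‖ ^ 2) / 2 :=
    (integrable_finsetSum _ fun j _ => integrable_finsetSum _ fun k _ => iS j k).div_const 2
  have eS : ∫ x, (∑ j, ∑ k, ‖Λ b c β j (v k) x - Λ b c β k (v j) x‖ ^ 2) / 2 =
      (∑ j, ∑ k, ∫ x, ‖Λ b c β j (v k) x - Λ b c β k (v j) x‖ ^ 2) / 2 := by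
    rw [integral_div, integral_finsetSum _ fun j _ => integrable_finsetSum _ fun k _ => iS j k]
    congr 1
    exact Finset.sum_congr rfl fun j _ => integral_finsetSum _ fun k _ => iS j k
  have eq : ∫ x, (∑ j, ‖q x * v j x‖ ^ 2) / 2 = (∑ j, ∫ x, ‖q x * v j x‖ ^ 2) / 2 := by
    rw [integral_div, integral_finsetSum _ fun j _ => iq j]
  rw [e, ← eS, ← eq, ← integral_add iL iS2]
  refine integral_mono ((integrable_finsetSum _ fun j _ => iq j).div_const 2) (iL.add iS2) fun x => ?_
  rw [skew fun j k => Λ b c β j (v k) x]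
  by_cases hx : x ∈ O
  · obtain ⟨B, ε, m1, w, h1, h2, h3, h4, h5, h6, h7, h8, h9, h10, h11⟩ := h.pin x hx
    have := pw (v := fun j => v j x) (A := fun l j => Λ b c β l (v j) x) h1 h2 h3 h4 h5 h6 h7 h8 h9 h10 h11
    have h12 : (∑ j, ‖q x * v j x‖ ^ 2) ≤ m x * ∑ j, ‖v j x‖ ^ 2 := by
      rw [Finset.mul_sum]
      refine Finset.sum_le_sum fun j _ => ?_
      rw [norm_mul, mul_pow]; gcongr; exact hqm x hx
    simp only [G] 
    linarith
  · have h1 : ∀ j, v j x = 0 := fun j => (hv j).zero_of hx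
    have h2 : ∀ l j, Λ b c β l (v j) x = 0 := fun l j => ((hv j).Λ hG hβ l).zero_of hx
    simp [G, h1, h2]

theorem B1' (h : Pin b c p β m O) {v : ι → E → ℂ} (hv : ∀ j, Ts O (v j)) {q : E → ℂ} (hq : Sm q) (hqm : ∀ x ∈ O, ‖q x‖ ^ 2 ≤ m x) :
    (∑ j, N2 fun x => q x * v j x) ≤ 2 * (N2 fun x => ∑ j, Λs b c β j (v j) x)
      + (∑ j, ∑ k, N2 fun x => Λ b c β j (v k) x - Λ b c β k (v j) x) := by
  have hG := h.geo
  have hβ := h.βsm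
  have t1 : ∀ j, Ts O fun x => q x * v j x := fun j => (hv j).mul hq
  have t2 : Ts O fun x => ∑ j, Λs b c β j (v j) x := Ts.sum fun j => (hv j).Λs hG hβ j
  have t3 : ∀ j k, Ts O fun x => Λ b c β j (v k) x - Λ b c β k (v j) x := fun j k => ((hv k).Λ hG hβ j).sub' ((hv j).Λ hG hβ k)
  have := B1 h hv hq hqm
  have i : ∀ f : E → ℂ, 0 ≤ ∫ x, ‖f x‖ ^ 2 := fun f => integral_nonneg fun x => by positivity
  simp only [fun j => (t1 j).N2, t2.N2, fun j k => (t3 j k).N2]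
  have e2 : ∑ j, ∑ k, ENNReal.ofReal (∫ x, ‖Λ b c β j (v k) x - Λ b c β k (v j) x‖ ^ 2) =
      ENNReal.ofReal (∑ j, ∑ k, ∫ x, ‖Λ b c β j (v k) x - Λ b c β k (v j) x‖ ^ 2) := by
    rw [ENNReal.ofReal_sum_of_nonneg fun j _ => Finset.sum_nonneg fun k _ => i _]
    exact Finset.sum_congr rfl fun j _ => (ENNReal.ofReal_sum_of_nonneg fun k _ => i _).symm
  rw [e2, ← ENNReal.ofReal_sum_of_nonneg fun j _ => i (fun x => q x * v j x),
    show (2:ℝ≥0∞) = ENNReal.ofReal 2 by simp, ← ENNReal.ofReal_mul (by norm_num), ← ENNReal.ofReal_add]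
  · apply ENNReal.ofReal_le_ofReal; linarith
  · have := i fun x => ∑ j, Λs b c β j (v j) x
    linarith
  · exact Finset.sum_nonneg fun j _ => Finset.sum_nonneg fun k _ => i _

theorem B2 (h : Pin b c p β m O) (hO : IsOpen O) {v : ι → E → ℂ} {T : E → ℂ} {S : ι → ι → E → ℂ} {q : E → ℂ} (hq : Sm q) (hqm : ∀ x ∈ O, ‖q x‖ ^ 2 ≤ m x)
    (hvm : ∀ j, Measurable (v j)) (hv : ∀ j, MemLp (v j) 2) (hc : ∀ j, HasCompactSupport (v j)) (hs : ∀ j, tsupport (v j) ⊆ O)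
    (hTm : Measurable T) (hT : MemLp T 2) (hSm : ∀ j k, Measurable (S j k)) (hS : ∀ j k, MemLp (S j k) 2)
    {C : ℝ} (hC : ∀ j a x, ‖fderiv ℝ (c j a) x‖ ≤ C) (hβ : ∀ j x, ‖β j x‖ ≤ C) (hγ : ∀ j x, ‖gam b c β j x‖ ≤ C) (hqC : ∀ x, ‖q x‖ ≤ C)
    (wT : ∀ g, Ts univ g → ∫ x, ∑ j, v j x * Pt b (cj (c j)) g x = ∫ x, T x * g x)
    (wS : ∀ j k g, Ts univ g → ∫ x, (v k x * Pt b (c j) g x - v j x * Pt b (c k) g x) = ∫ x, S j k x * g x) :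
    (∑ j, N2 fun x => q x * v j x) ≤ 2 * (N2 fun x => - T x + ∑ j, gam b c β j x * v j x)
      + (∑ j, ∑ k, N2 fun x => S j k x + (β j x * v k x - β k x * v j x)) := by
  have hG := h.geo
  have hC' : ∀ j a x, ‖fderiv ℝ (cj (c j) a) x‖ ≤ C := fun j a x => by
    have h1 : cj (c j) a = Complex.conjLIE ∘ (c j a) := by ext; simp [cj]
    rw [h1]
    have := (Complex.conjLIE.toContinuousLinearEquiv.comp_fderiv (f := c j a) (x := x))
    refine le_trans (le_of_eq ?_) (hC j a x)
    exact (congrArg norm this).trans (Complex.conjLIE.toLinearIsometry.norm_toContinuousLinearMap_comp (g := fderiv ℝ (c j a) x))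
  have lT := FR1 (b := b) hvm hv hTm hT (fun j a => cj_sm (hG.csm j) a) hC' wT
  have lv := fun j => R_L2T (hvm j) (hv j)
  have lS : ∀ j k, L2T (fun ν x => V b (c j) (R ν (v k)) x - V b (c k) (R ν (v j)) x) (S j k) := fun j k => by
    have := FR1 (b := b) (v := ![v k, v j]) (C := ![c j, fun a x => - c k a x]) (h := S j k) (Λ := C)
      (by rw [Fin.forall_fin_two]; exact ⟨hvm k, hvm j⟩) (by rw [Fin.forall_fin_two]; exact ⟨hv k, hv j⟩) (hSm j k) (hS j k)
      (by rw [Fin.forall_fin_two]; exact ⟨hG.csm j, fun a => (hG.csm k a).neg⟩)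
      (by rw [Fin.forall_fin_two]; exact ⟨hC j, fun a x => by simpa using hC k a x⟩)
      (fun g hg => by
        rw [← wS j k g hg]
        refine integral_congr_ae (.of_forall fun x => ?_)
        have e : Pt b (fun a x => - c k a x) g x = - Pt b (c k) g x := by
          simp only [Pt, neg_mul, D_neg, Finset.sum_neg_distrib]
        simp [Fin.sum_univ_two, e, sub_eq_add_neg])
    refine this.congr fun ν x => ?_
    simp [Fin.sum_univ_two, V, sub_eq_add_neg]
  have mβ := fun j => (h.βsm j).continuous.aestronglyMeasurable (μ := (volume : Measure E))
  have mγ := fun j => (gam_sm hG h.βsm j).continuous.aestronglyMeasurable (μ := (volume : Measure E))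
  have q1 := fun j => ((lv j).mul (hq.continuous.aestronglyMeasurable) hqC).lim
  have q2 := (lT.neg.add (L2T.sum (s := Finset.univ) fun j => (lv j).mul (mγ j) (hγ j))).lim
  have q3 := fun j k => ((lS j k).add (((lv k).mul (mβ j) (hβ j)).sub ((lv j).mul (mβ k) (hβ k)))).lim
  refine le_of_tendsto_of_tendsto (tendsto_finsetSum _ fun j _ => q1 j)
    ((ENNReal.Tendsto.const_mul (a := 2) q2 (.inr (by simp))).add (tendsto_finsetSum _ fun j _ => tendsto_finsetSum _ fun k _ => q3 j k)) ?_
  filter_upwards [eventually_all.2 fun j => R_ts (hv j) (hc j) hO (hs j)] with ν hν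
  refine (B1' h hν hq hqm).trans (le_of_eq ?_)
  congr 2
  · congr 1; ext x; simp only [Λs, Finset.sum_add_distrib, Finset.sum_neg_distrib]
  · ext j; congr 1; ext k; congr 1; ext x; simp only [Λ]; ring

end apriori2
end NN

namespace NN
open MeasureTheory Filter Topology Set
open scoped ContDiff ComplexConjugate ENNReal

section radial
set_option linter.unusedSectionVars false
variable {E : Type*} [NormedAddCommGroup E] [InnerProductSpace ℝ E]

def rc (x : E) : ℂ := ((‖x‖ ^ 2 : ℝ) : ℂ)
def sR (r : ℝ) (x : E) : ℝ := r ^ 2 - ‖x‖ ^ 2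
/-- radial function -/
def fs (r : ℝ) (f : ℝ → ℝ) (x : E) : ℂ := ((f (sR r x) : ℝ) : ℂ)

theorem rc_sm : Sm (rc (E := E)) := Complex.ofRealCLM.contDiff.comp (contDiff_norm_sq ℝ)
theorem sR_sm (r : ℝ) : ContDiff ℝ ∞ (sR (E := E) r) := contDiff_const.sub (contDiff_norm_sq ℝ)
theorem rc_conj (x : E) : conj (rc x) = rc x := Complex.conj_ofReal _

theorem sR_pos {r : ℝ} (hr : 0 < r) {x : E} : 0 < sR r x ↔ x ∈ Metric.ball (0:E) r := by
  rw [sR, sub_pos, mem_ball_zero_iff, sq_lt_sq₀ (norm_nonneg _) hr.le]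

theorem fs_sm {r : ℝ} {f : ℝ → ℝ} (hf : ContDiff ℝ ∞ f) : Sm (fs (E := E) r f) :=
  Complex.ofRealCLM.contDiff.comp (hf.comp (sR_sm r))

theorem fs_smOn {r : ℝ} (hr : 0 < r) {f : ℝ → ℝ} (hf : ContDiffOn ℝ ∞ f (Ioi 0)) : ContDiffOn ℝ ∞ (fs (E := E) r f) (Metric.ball 0 r) :=
  Complex.ofRealCLM.contDiff.comp_contDiffOn (hf.comp (sR_sm r).contDiffOn fun _ hx => (sR_pos hr).2 hx)

theorem fs_da {r : ℝ} {f : ℝ → ℝ} {x : E} (hf : DifferentiableAt ℝ f (sR r x)) : DifferentiableAt ℝ (fs r f) x :=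
  Complex.ofRealCLM.differentiableAt.comp x (hf.comp x ((sR_sm r).differentiable (by simp) x))

theorem fs_D {r : ℝ} {f : ℝ → ℝ} {x : E} {f' : ℝ} (hf : HasDerivAt f f' (sR r x)) (e : E) :
    D e (fs r f) x = - f' * D e rc x := by
  have h0 : HasFDerivAt (fun y : E => ‖y‖ ^ 2) (fderiv ℝ (fun y : E => ‖y‖ ^ 2) x) x :=
    ((contDiff_norm_sq ℝ).differentiable (n := ∞) (by simp) x).hasFDerivAt
  have h1 := Complex.ofRealCLM.hasFDerivAt.comp x (hf.comp_hasFDerivAt x (h0.const_sub (r ^ 2)))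
  have h2 := Complex.ofRealCLM.hasFDerivAt.comp x h0
  have e1 : fderiv ℝ (fs r f) x = _ := h1.fderiv
  have e2 : fderiv ℝ (rc (E := E)) x = _ := h2.fderiv
  rw [D, D, e1, e2]
  simp

theorem fs_ts [FiniteDimensional ℝ E] {r : ℝ} (hr : 0 < r) {f : ℝ → ℝ} (hf : ContDiff ℝ ∞ f) {t₀ : ℝ} (h0 : 0 < t₀)
    (h : ∀ t ≤ t₀, f t = 0) : Ts (Metric.ball (0:E) r) (fs r f) := by
  have hs : tsupport (fs (E := E) r f) ⊆ {x | t₀ ≤ sR r x} := by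
    refine closure_minimal (fun x hx => ?_) (isClosed_le continuous_const (sR_sm r).continuous)
    by_contra hc
    exact hx (by simp [fs, h _ (not_le.1 hc).le])
  have hb : {x : E | t₀ ≤ sR r x} ⊆ Metric.ball 0 r := fun x hx => (sR_pos hr).1 (h0.trans_le hx)
  exact ⟨fs_sm hf, (isCompact_closedBall (0:E) r).of_isClosed_subset (isClosed_tsupport _)
    ((hs.trans hb).trans Metric.ball_subset_closedBall), hs.trans hb⟩

/-- cutoff -/
def ct (ν : ℝ) (t : ℝ) : ℝ := Real.smoothTransition (4 * ν * t - 1)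
theorem ct_one {ν t : ℝ} (h : 1 / 2 ≤ ν * t) : ct ν t = 1 := Real.smoothTransition.one_of_one_le (by linarith)
theorem ct_zero {ν t : ℝ} (h : ν * t ≤ 1 / 4) : ct ν t = 0 := Real.smoothTransition.zero_of_nonpos (by linarith)
theorem ct_sm (ν : ℝ) : ContDiff ℝ ∞ (ct ν) :=
  Real.smoothTransition.contDiff.comp ((contDiff_const.mul contDiff_id).sub contDiff_const)
theorem ct_mul {ν : ℝ} (hν : 0 < ν) {f : ℝ → ℝ} (hf : ContDiffOn ℝ ∞ f (Ioi 0)) : ContDiff ℝ ∞ fun t => ct ν t * f t := by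
  refine contDiff_iff_contDiffAt.2 fun t => ?_
  rcases lt_or_ge 0 t with h | h
  · exact (ct_sm ν).contDiffAt.mul (hf.contDiffAt (Ioi_mem_nhds h))
  · have : (fun t => ct ν t * f t) =ᶠ[𝓝 t] fun _ => 0 := by
      filter_upwards [Iio_mem_nhds (show t < 1 / (4 * ν) from h.trans_lt (by positivity))] with y hy
      have hy : y < 1 / (4 * ν) := hy
      rw [lt_div_iff₀ (by positivity)] at hy
      rw [ct_zero (by linarith), zero_mul]
    exact contDiffAt_const.congr_of_eventuallyEq this
theorem ct_z {ν : ℝ} (hν : 0 < ν) {f : ℝ → ℝ} : ∀ t ≤ 1 / (4 * ν), ct ν t * f t = 0 := fun t ht => by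
  rw [le_div_iff₀ (by positivity)] at ht
  rw [ct_zero (by linarith), zero_mul]

def ps (t : ℝ) : ℝ := t * Real.smoothTransition (t - 1)
theorem ps_sm : ContDiff ℝ ∞ ps := contDiff_id.mul (Real.smoothTransition.contDiff.comp (contDiff_id.sub contDiff_const))
theorem ps_z {t : ℝ} (h : t ≤ 1) : ps t = 0 := by simp [ps, Real.smoothTransition.zero_of_nonpos (sub_nonpos.2 h)]
theorem ps_id {t : ℝ} (h : 2 ≤ t) : ps t = t := by simp [ps, Real.smoothTransition.one_of_one_le (show 1 ≤ t - 1 by linarith)]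
theorem ps_d : ∃ L, 0 ≤ L ∧ (∀ t, |deriv ps t| ≤ L) := by
  have hc : Continuous (deriv ps) := ps_sm.continuous_deriv (by simp)
  obtain ⟨M, hM⟩ := (isCompact_Icc (a := (1:ℝ)) (b := 2)).exists_bound_of_continuousOn hc.continuousOn
  refine ⟨max M 1, by positivity, fun t => ?_⟩
  by_cases h1 : t < 1
  · have : ps =ᶠ[𝓝 t] fun _ => 0 := by filter_upwards [Iio_mem_nhds h1] with y hy using ps_z (le_of_lt hy)
    rw [this.deriv_eq]; simp
  by_cases h2 : 2 < t
  · have : ps =ᶠ[𝓝 t] id := by filter_upwards [Ioi_mem_nhds h2] with y hy using ps_id (le_of_lt hy)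
    rw [this.deriv_eq]; simp
  · exact (hM t ⟨not_lt.1 h1, not_lt.1 h2⟩).trans (le_max_left _ _)
theorem ps_dz {t : ℝ} (h : t < 1) : deriv ps t = 0 := by
  have : ps =ᶠ[𝓝 t] fun _ => 0 := by filter_upwards [Iio_mem_nhds h] with y hy using ps_z (le_of_lt hy)
  rw [this.deriv_eq]; simp

/-- the cutoff multiplier -/
def et (ν : ℝ) (t : ℝ) : ℝ := ps (ν * t) / ν
theorem et_sm (ν : ℝ) : ContDiff ℝ ∞ (et ν) := (ps_sm.comp (contDiff_const.mul contDiff_id)).div_const _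
theorem et_z {ν : ℝ} (hν : 0 < ν) : ∀ t ≤ 1 / ν, et ν t = 0 := fun t ht => by
  rw [le_div_iff₀ hν] at ht
  rw [et, ps_z (by linarith), zero_div]
theorem et_d {ν : ℝ} (hν : 0 < ν) (t : ℝ) : HasDerivAt (et ν) (deriv ps (ν * t)) t := by
  have h := ((ps_sm.differentiable (by simp) (ν * t)).hasDerivAt.comp t ((hasDerivAt_id t).const_mul ν)).div_const ν
  rw [mul_one, mul_div_assoc, div_self hν.ne', mul_one] at h
  exact h
theorem et_le {ν : ℝ} (hν : 0 < ν) {t : ℝ} (ht : 0 ≤ t) : 0 ≤ et ν t ∧ et ν t ≤ t := by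
  have h1 := Real.smoothTransition.nonneg (ν * t - 1)
  have h2 := Real.smoothTransition.le_one (ν * t - 1)
  have : et ν t = t * Real.smoothTransition (ν * t - 1) := by rw [et, ps]; field_simp
  rw [this]
  exact ⟨by positivity, by nlinarith⟩

variable {α : Type*} [Fintype α] {b : α → E} {ξ : α → E → ℂ}

theorem D_mulT {Ω : Set E} {a G : E → ℂ} (hΩ : IsOpen Ω) (ha : ContDiffOn ℝ ∞ a Ω) (hG : Ts Ω G) (e x : E) :
    D e (fun y => a y * G y) x = a x * D e G x + D e a x * G x := by
  by_cases hx : x ∈ Ω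
  · rw [D_mul ((ha.contDiffAt (hΩ.mem_nhds hx)).differentiableAt (by simp)) (hG.sm.da x)]; ring
  · rw [((hG.mulOn ha hΩ).D e).zero_of hx, (hG.D e).zero_of hx, hG.zero_of hx]; simp

theorem V_mulT {Ω : Set E} {a G : E → ℂ} (hΩ : IsOpen Ω) (ha : ContDiffOn ℝ ∞ a Ω) (hG : Ts Ω G) (x : E) :
    V b ξ (fun y => a y * G y) x = a x * V b ξ G x + V b ξ a x * G x := by
  simp only [V, D_mulT hΩ ha hG, Finset.mul_sum, Finset.sum_mul, ← Finset.sum_add_distrib]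
  exact Finset.sum_congr rfl fun a _ => by ring

theorem Pt_mulT {Ω : Set E} {a G : E → ℂ} (hΩ : IsOpen Ω) (hξ : ∀ a, Sm (ξ a)) (ha : ContDiffOn ℝ ∞ a Ω) (hG : Ts Ω G) (x : E) :
    Pt b ξ (fun y => a y * G y) x = a x * Pt b ξ G x - V b ξ a x * G x := by
  rw [Pt_eq hξ (hG.mulOn ha hΩ).sm, Pt_eq hξ hG.sm, V_mulT hΩ ha hG]; ring

theorem V_fs {r : ℝ} {f : ℝ → ℝ} {x : E} {f' : ℝ} (hf : HasDerivAt f f' (sR r x)) :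
    V b ξ (fs r f) x = - f' * V b ξ rc x := by
  simp only [V, fs_D hf, Finset.mul_sum]
  exact Finset.sum_congr rfl fun a _ => by ring

/-- exponential weights -/
def ex (K : ℝ) (t : ℝ) : ℝ := Real.exp (K / (2 * t))
theorem ex_sm (K : ℝ) : ContDiffOn ℝ ∞ (ex K) (Ioi 0) := by
  refine Real.contDiff_exp.comp_contDiffOn (contDiffOn_const.div (contDiffOn_const.mul contDiffOn_id) fun t ht => ?_)
  have : (0:ℝ) < t := ht
  simp; positivity
theorem ex_d (K : ℝ) {t : ℝ} (ht : 0 < t) : HasDerivAt (ex K) (- (K / (2 * t ^ 2)) * ex K t) t := by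
  have h1 : HasDerivAt (fun t : ℝ => K / (2 * t)) (- (K / (2 * t ^ 2))) t := by
    have := (((hasDerivAt_id t).const_mul 2).inv (by simp; positivity)).const_mul K
    refine (this.congr_deriv ?_).congr_of_eventuallyEq (.of_forall fun y => ?_)
    · simp only [id]; field_simp
    · simp [div_eq_mul_inv]
  exact h1.exp.congr_deriv (mul_comm _ _)
end radial
end NN

namespace NN
open MeasureTheory Filter Topology Set
open scoped ContDiff ComplexConjugate ENNReal

section solve
set_option linter.unusedSectionVars false
variable {E : Type*} [NormedAddCommGroup E] [InnerProductSpace ℝ E]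
variable {ι α : Type*} [Fintype ι] [Fintype α] [DecidableEq ι]

structure Dat (b : α → E) (c : ι → α → E → ℂ) (p : α → ι → E → ℂ) (r B ε C0 : ℝ) : Prop where
  geo : Geo b c p
  r0 : 0 < r
  r1 : r ≤ 1
  B0 : 0 ≤ B
  ε0 : 0 ≤ ε
  εB : 2 * ε * (Fintype.card ι : ℝ) ^ 2 * (B + 4) ≤ 1 / 2
  cd : ∀ j a x, ‖fderiv ℝ (c j a) x‖ ≤ C0
  cm : ∀ x ∈ Metric.ball (0:E) r, ∀ j k a, V b (c j) (c k a) x = V b (c k) (c j a) x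
  kb : ∀ x ∈ Metric.ball (0:E) r, ∀ j, ‖kap b c j x‖ ≤ 1
  kd : ∀ x ∈ Metric.ball (0:E) r, ∀ j k, ‖V b (c k) (kap b c j) x‖ ≤ ε
  t1 : ∀ x ∈ Metric.ball (0:E) r, ∀ k j l, ‖ta b c p k j l x‖ ≤ ε
  t2 : ∀ x ∈ Metric.ball (0:E) r, ∀ k j l, ‖ta' b c p k j l x‖ ≤ ε
  t3 : ∀ x ∈ Metric.ball (0:E) r, ∀ k j l, ‖V b (c l) (fun y => conj (ta' b c p k j l y)) x‖ ≤ ε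
  w1 : ∀ x ∈ Metric.ball (0:E) r, ∀ j, ‖V b (c j) rc x‖ ≤ B
  w2 : ∀ x ∈ Metric.ball (0:E) r, ∀ j k, ‖V b (c k) (V b (cj (c j)) rc) x - if j = k then 1 else 0‖ ≤ ε

variable {b : α → E} {c : ι → α → E → ℂ} {p : α → ι → E → ℂ} {r B ε C0 : ℝ}

theorem V_cj {c : α → E → ℂ} {u : E → ℂ} (hu : Sm u) (x : E) : V b (cj c) (fun y => conj (u y)) x = conj (V b c u x) := by
  rw [V_conj hu]; simp [cj]

theorem V_cj_rc (c : α → E → ℂ) (x : E) : V b (cj c) rc x = conj (V b c rc x) := by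
  rw [← V_cj rc_sm]; simp only [rc_conj]

def kf (K ν t : ℝ) : ℝ := ct ν t * (K / (2 * t ^ 2))
theorem inv_on (K : ℝ) : ContDiffOn ℝ ∞ (fun t : ℝ => K / (2 * t ^ 2)) (Ioi 0) :=
  contDiffOn_const.div (contDiffOn_const.mul (contDiffOn_id.pow 2)) fun t ht => by
    have : (0:ℝ) < t := ht
    simp; positivity
theorem kf_sm (K : ℝ) {ν : ℝ} (hν : 0 < ν) : ContDiff ℝ ∞ (kf K ν) := ct_mul hν (inv_on K)
theorem kf_d (K : ℝ) {ν t : ℝ} (hν : 0 < ν) (ht : 1 / 2 < ν * t) : HasDerivAt (kf K ν) (- (K / t ^ 3)) t := by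
  have t0 : 0 < t := by by_contra h; nlinarith
  have h1 : HasDerivAt (fun t : ℝ => K / (2 * t ^ 2)) (- (K / t ^ 3)) t := by
    have := (((hasDerivAt_pow 2 t).const_mul 2).inv (by simp; positivity)).const_mul K
    refine (this.congr_deriv ?_).congr_of_eventuallyEq (.of_forall fun y => ?_)
    · simp; field_simp
    · simp [div_eq_mul_inv]
  refine h1.congr_of_eventuallyEq ?_
  filter_upwards [(continuous_const_mul ν).tendsto t |>.eventually (lt_mem_nhds ht)] with y hy
  rw [kf, ct_one (le_of_lt hy), one_mul]

def bt (b : α → E) (c : ι → α → E → ℂ) (r K ν : ℝ) (j : ι) (x : E) : ℂ := fs r (kf K ν) x * V b (c j) rc x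

theorem pinD (h : Dat b c p r B ε C0) {K ν : ℝ} (hK : 1 ≤ K) (hν : 0 < ν) :
    Pin b c p (bt b c r K ν) (fun x => K / sR r x ^ 2) {x | 1 / 2 < ν * sR r x} := by
  have G := h.geo
  have bsm : ∀ j, Sm (bt b c r K ν j) := fun j => (fs_sm (kf_sm K hν)).mul (Sm.V (G.csm j) rc_sm)
  refine ⟨G, bsm, fun x hx => ?_⟩
  have hx : 1 / 2 < ν * sR r x := hx
  have s0 : 0 < sR r x := by by_contra h; nlinarith
  have hb := (sR_pos h.r0).1 s0
  have s1 : sR r x ≤ 1 := by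
    have := h.r1; have := h.r0; have := sq_nonneg ‖x‖
    unfold sR; nlinarith
  have m1 : 1 ≤ K / sR r x ^ 2 := by
    rw [le_div_iff₀ (by positivity), one_mul]
    exact le_trans (pow_le_one₀ s0.le s1) hK
  have eb : ∀ j, bt b c r K ν j x = (K / sR r x ^ 2 / 2 : ℝ) * V b (c j) rc x := fun j => by
    rw [bt, fs, kf, ct_one hx.le, one_mul]; congr 2; field_simp
  have nb : ∀ l, ‖bt b c r K ν l x‖ ≤ K / sR r x ^ 2 * B / 2 := fun l => by
    rw [eb, norm_mul, Complex.norm_real, Real.norm_of_nonneg (by positivity)]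
    have := h.w1 x hb l
    calc _ ≤ K / sR r x ^ 2 / 2 * B := by gcongr
      _ = _ := by ring
  refine ⟨B, 2 * ε, 2 * (K / sR r x ^ 3), fun j => V b (c j) rc x, m1, by positivity, h.B0, by linarith [h.ε0], h.εB, nb,
    fun l => ?_, fun k j l => (h.t1 x hb k j l).trans (by linarith [h.ε0]),
    fun k j l => (h.t2 x hb k j l).trans (by linarith [h.ε0]), fun k j l => (h.t3 x hb k j l).trans (by linarith [h.ε0]), fun k j => ?_⟩
  · refine (norm_add_le _ _).trans (add_le_add ?_ ?_)
    · rw [norm_neg]; exact h.kb x hb l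
    · rw [RCLike.norm_conj]; exact nb l
  · have f1 := fs_sm (E := E) (r := r) (kf_sm K hν)
    have ks := kap_sm G j
    have e1 : gam b c (bt b c r K ν) j = fun y => - kap b c j y + fs r (kf K ν) y * V b (cj (c j)) rc y := by
      ext y; rw [gam, bt, map_mul, V_cj_rc, fs, Complex.conj_ofReal]
    have e2 : V b (c k) (gam b c (bt b c r K ν) j) x = - V b (c k) (kap b c j) x +
        (V b (c k) (fs r (kf K ν)) x * V b (cj (c j)) rc x + fs r (kf K ν) x * V b (c k) (V b (cj (c j)) rc) x) := by
      rw [e1, V_add ks.neg (f1.mul (Sm.V (cj_sm (G.csm j)) rc_sm)), V_neg, V_mul f1 (Sm.V (cj_sm (G.csm j)) rc_sm)]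
    have e3 : V b (cj (c j)) (bt b c r K ν k) x =
        V b (cj (c j)) (fs r (kf K ν)) x * V b (c k) rc x + fs r (kf K ν) x * V b (cj (c j)) (V b (c k) rc) x := by
      unfold bt; rw [V_mul f1 (Sm.V (G.csm k) rc_sm)]
    have e4 : V b (cj (c j)) (V b (c k) rc) x = conj (V b (c j) (V b (cj (c k)) rc) x) := by
      rw [← V_cj (Sm.V (cj_sm (G.csm k)) rc_sm)]
      congr 1; ext y; rw [V_cj_rc, Complex.conj_conj]
    have e5 : fs r (kf K ν) x = (K / sR r x ^ 2 / 2 : ℝ) := by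
      rw [fs, kf, ct_one hx.le, one_mul]; congr 1; field_simp
    have hd := kf_d K hν hx
    rw [W, e2, e3, e4, V_fs hd, V_fs hd, e5, V_cj_rc]
    set m := K / sR r x ^ 2
    have q1 := h.kd x hb j k
    have q2 := h.w2 x hb j k
    have q3 := h.w2 x hb k j
    rw [← RCLike.norm_conj] at q3
    set X := V b (c k) (V b (cj (c j)) rc) x
    set Y := V b (c j) (V b (cj (c k)) rc) x
    have e6 : conj (Y - if k = j then 1 else 0) = conj Y - if j = k then 1 else 0 := by
      rw [map_sub]; congr 1; simp only [eq_comm (a := k)]; split_ifs <;> simp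
    rw [e6] at q3
    have e7 : - V b (c k) (kap b c j) x + (-((-(K / sR r x ^ 3) : ℝ) : ℂ) * V b (c k) rc x * conj (V b (c j) rc x) + (m / 2 : ℝ) * X)
        + (-((-(K / sR r x ^ 3) : ℝ) : ℂ) * conj (V b (c j) rc x) * V b (c k) rc x + (m / 2 : ℝ) * conj Y)
        - (((2 * (K / sR r x ^ 3) : ℝ):ℂ) * (V b (c k) rc x * conj (V b (c j) rc x)) + if j = k then (m:ℂ) else 0) =
        - V b (c k) (kap b c j) x + ((m / 2 : ℝ) * (X - if j = k then 1 else 0) + (m / 2 : ℝ) * (conj Y - if j = k then 1 else 0)) := by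
      have : (if j = k then (m:ℂ) else 0) = m * if j = k then 1 else 0 := by split_ifs <;> simp
      rw [this]; push_cast; ring
    rw [e7]
    have m0 : 0 ≤ m / 2 := by linarith
    refine (norm_add_le _ _).trans ((add_le_add_right (norm_add_le _ _) _).trans ?_)
    rw [norm_neg, norm_mul, norm_mul, Complex.norm_real, Real.norm_of_nonneg m0]
    have := h.ε0
    nlinarith
end solve
end NN

namespace NN
open MeasureTheory Filter Topology Set
open scoped ContDiff ComplexConjugate ENNReal

section solve2
set_option linter.unusedSectionVars false
variable {E : Type*} [NormedAddCommGroup E] [InnerProductSpace ℝ E]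
  [FiniteDimensional ℝ E] [MeasurableSpace E] [BorelSpace E]
variable {ι α : Type*} [Fintype ι] [Fintype α] [DecidableEq ι]
variable {b : α → E} {c : ι → α → E → ℂ} {p : α → ι → E → ℂ} {r B ε C0 : ℝ}

theorem Ts.bdd {O : Set E} {u : E → ℂ} (hu : Ts O u) : ∃ C, ∀ x, ‖u x‖ ≤ C :=
  hu.sm.continuous.bounded_above_of_compact_support hu.cs

theorem mlb {a f : E → ℂ} (ha : Measurable a) {C : ℝ} (hC : ∀ x, ‖a x‖ ≤ C) (hf : MemLp f 2) : MemLp (fun x => a x * f x) 2 :=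
  ((L2T.const hf).mul ha.aestronglyMeasurable hC).mg

theorem mlT {O : Set E} {a f : E → ℂ} (ha : Ts O a) (hf : MemLp f 2) : MemLp (fun x => a x * f x) 2 :=
  let ⟨_, hC⟩ := ha.bdd
  mlb ha.sm.continuous.measurable hC hf

theorem iT {O : Set E} {a f : E → ℂ} (hf : MemLp f 2) (ha : Ts O a) : Integrable (fun x => f x * a x) :=
  hf.integrable_mul (ha.lp 2)

theorem ms {ι : Type*} [Fintype ι] {f : ι → E → ℂ} (h : ∀ i, MemLp (f i) 2) : MemLp (fun x => ∑ i, f i x) 2 :=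
  memLp_finsetSum _ fun i _ => h i

theorem N2_sum {f : ι → E → ℂ} (hf : ∀ i, Measurable (f i)) : N2 (fun x => ∑ i, f i x) ≤ Fintype.card ι * ∑ i, N2 (f i) := by
  unfold N2
  rw [← lintegral_finsetSum _ fun i _ => by have := hf i; fun_prop, ← lintegral_const_mul' _ _ (by simp)]
  refine lintegral_mono fun x => (pow_le_pow_left' (enorm_sum_le _ _) 2).trans ?_
  have := ENNReal.rpow_sum_le_const_mul_sum_rpow (p := 2) (s := (Finset.univ : Finset ι)) (f := fun i => ‖f i x‖ₑ) (by norm_num)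
  norm_num at this
  exact this

theorem N2_const_mul (a : ℂ) (f : E → ℂ) : N2 (fun x => a * f x) = ‖a‖ₑ ^ 2 * N2 f := by
  unfold N2
  rw [← lintegral_const_mul' _ _ (by finiteness)]
  simp only [enorm_mul, mul_pow]

theorem e_pm {K t : ℝ} : ex K t * ex (-K) t = 1 := by
  rw [ex, ex, ← Real.exp_add, neg_div, add_neg_cancel, Real.exp_zero]

section
variable (h : Dat b c p r B ε C0) {K ν : ℝ} (hν : 0 < ν)
include h hν

theorem eta_ts : Ts (Metric.ball (0:E) r) (fs r (et ν)) := fs_ts h.r0 (et_sm ν) (t₀ := 1 / ν) (by positivity) (et_z hν)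

theorem conjE (σ : ℝ) (ξ : α → E → ℂ) {g : E → ℂ} (hg : Sm g) (x : E) :
    fs r (ex (-σ)) x * V b ξ (fun y => fs r (ex σ) y * (fs r (et ν) y * g y)) x =
      V b ξ (fun y => fs r (et ν) y * g y) x + fs r (kf σ ν) x * V b ξ rc x * (fs r (et ν) x * g x) := by
  have ht := (eta_ts h hν).mul' hg
  rw [V_mulT Metric.isOpen_ball (fs_smOn h.r0 (ex_sm σ)) ht]
  by_cases hx : x ∈ Metric.ball (0:E) r
  · have s0 := (sR_pos h.r0).2 hx
    rw [V_fs (ex_d σ s0)]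
    have e1 : fs r (ex (-σ)) x * fs r (ex σ) x = 1 := by
      rw [fs, fs, ← Complex.ofReal_mul, mul_comm, e_pm, Complex.ofReal_one]
    have e2 : fs r (kf σ ν) x * fs r (et ν) x = ((σ / (2 * sR r x ^ 2) : ℝ) : ℂ) * fs r (et ν) x := by
      by_cases h2 : 1 / 2 ≤ ν * sR r x
      · rw [fs, kf, ct_one h2, one_mul]
      · have : fs r (et ν) x = 0 := by rw [fs, et_z hν _ (by rw [le_div_iff₀ hν]; linarith)]; simp
        rw [this]; simp
    have e3 : fs r (ex σ) x = ((ex σ (sR r x) : ℝ) : ℂ) := rfl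
    push_cast at e2 ⊢
    rw [← e3]
    linear_combination (V b ξ (fun y => fs r (et ν) y * g y) x + σ / (2 * sR r x ^ 2) * V b ξ rc x * (fs r (et ν) x * g x)) * e1
      - V b ξ rc x * g x * e2
  · have h0 := (eta_ts h hν).zero_of hx
    have h1 : V b ξ (fun y => fs r (et ν) y * g y) x = 0 := by
      simp only [V, (ht.D _).zero_of hx, mul_zero, Finset.sum_const_zero]
    simp [h0, h1]

theorem conjP (j : ι) {g : E → ℂ} (hg : Sm g) (x : E) :
    fs r (ex K) x * Pt b (c j) (fun y => fs r (ex (-K)) y * (fs r (et ν) y * g y)) x =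
      fs r (et ν) x * Pt b (c j) g x - V b (c j) (fs r (et ν)) x * g x + bt b c r K ν j x * (fs r (et ν) x * g x) := by
  have ht := (eta_ts h hν).mul' hg
  have e := conjE h hν (-K) (c j) hg x
  have e0 := Pt_mul (b := b) (h.geo.csm j) (eta_ts h hν).sm hg x
  rw [Pt_eq (h.geo.csm j) (ht.mulOn (fs_smOn h.r0 (ex_sm _)) Metric.isOpen_ball).sm]
  rw [Pt_eq (h.geo.csm j) ht.sm] at e0
  rw [neg_neg] at e
  have e1 : fs r (ex K) x * (fs r (ex (-K)) x * (fs r (et ν) x * g x)) = fs r (et ν) x * g x := by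
    rw [← mul_assoc, fs, fs, ← Complex.ofReal_mul, e_pm]; simp
  have e2 : fs r (kf (-K) ν) x = - fs r (kf K ν) x := by simp [fs, kf, neg_div]
  rw [e2] at e
  rw [bt]
  linear_combination -e + e0 - (∑ a, D (b a) (c j a) x) * e1

theorem conjQ (j : ι) {g : E → ℂ} (hg : Sm g) (x : E) :
    fs r (et ν) x * Pt b (cj (c j)) g x = - (fs r (ex (-K)) x * V b (cj (c j)) (fun y => fs r (ex K) y * (fs r (et ν) y * g y)) x)
      + gam b c (bt b c r K ν) j x * (fs r (et ν) x * g x) + V b (cj (c j)) (fs r (et ν)) x * g x := by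
  have ht := (eta_ts h hν).mul' hg
  have e := conjE h hν K (cj (c j)) hg x
  have e0 := Pt_mul (b := b) (cj_sm (h.geo.csm j)) (eta_ts h hν).sm hg x
  rw [Pt_eq (cj_sm (h.geo.csm j)) ht.sm] at e0
  rw [e, gam, bt, map_mul, ← V_cj_rc, kap]
  have e3 : conj (fs r (kf K ν) x) = fs r (kf K ν) x := Complex.conj_ofReal _
  rw [e3]
  linear_combination -e0
end
end solve2
end NN

namespace NN
open MeasureTheory Filter Topology Set
open scoped ContDiff ComplexConjugate ENNReal

section core
set_option linter.unusedSectionVars false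
variable {E : Type*} [NormedAddCommGroup E] [InnerProductSpace ℝ E]
  [FiniteDimensional ℝ E] [MeasurableSpace E] [BorelSpace E]
variable {ι α : Type*} [Fintype ι] [Fintype α] [DecidableEq ι]
variable {b : α → E} {c : ι → α → E → ℂ} {p : α → ι → E → ℂ} {r B ε C0 : ℝ}

theorem N2_sub {f g : E → ℂ} (hf : Measurable f) : N2 (fun x => f x - g x) ≤ 2 * (N2 f + N2 g) := by
  have := N2_add (f := f) (g := fun x => - g x) hf.aestronglyMeasurable
  simpa [sub_eq_add_neg, N2] using this

theorem vb (h : Dat b c p r B ε C0) {L ν : ℝ} (hL : ∀ t, |deriv ps t| ≤ L) (hν : 0 < ν) {ξ : α → E → ℂ}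
    (hξ : ∀ x ∈ Metric.ball (0:E) r, ‖V b ξ rc x‖ ≤ B) (f : E → ℂ) :
    N2 (fun x => V b ξ (fs r (et ν)) x * f x) ≤ ENNReal.ofReal (L * B) ^ 2 * N2 ((Metric.ball (0:E) r).indicator f) := by
  have L0 : 0 ≤ L := (abs_nonneg _).trans (hL 0)
  have h0 := mul_nonneg L0 h.B0
  have e : ENNReal.ofReal (L * B) = ‖((L * B : ℝ) : ℂ)‖ₑ := by
    rw [← ofReal_norm, Complex.norm_real, Real.norm_of_nonneg h0]
  rw [e, ← N2_const_mul]
  refine N2_mono fun x => ?_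
  rw [V_fs (et_d hν _), norm_mul, norm_mul, norm_neg, Complex.norm_real, norm_mul, Complex.norm_real, Real.norm_of_nonneg h0]
  by_cases hx : x ∈ Metric.ball (0:E) r
  · rw [indicator_of_mem hx]
    have := hL (ν * sR r x)
    have := hξ x hx
    rw [Real.norm_eq_abs]
    gcongr
  · have : sR r x ≤ 0 := not_lt.1 fun h' => hx ((sR_pos h.r0).1 h')
    rw [ps_dz (by nlinarith)]
    simp; positivity

theorem C1a (h : Dat b c p r B ε C0) {L ν K : ℝ} (hL : ∀ t, |deriv ps t| ≤ L) (hν : 0 < ν) (hK : 1 ≤ K)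
    {h1 : ι → E → ℂ} {τ : E → ℂ} (hm : ∀ j, Measurable (h1 j)) (hl : ∀ j, MemLp (h1 j) 2) (τm : Measurable τ) (τl : MemLp τ 2)
    (hS : ∀ g, Ts (Metric.ball (0:E) r) g → ∀ j k, ∫ x, h1 k x * (fs r (ex K) x * Pt b (c j) g x) = ∫ x, h1 j x * (fs r (ex K) x * Pt b (c k) g x))
    (hT : ∀ g, Ts (Metric.ball (0:E) r) g → ∫ x, ∑ j, h1 j x * (fs r (ex (-K)) x * V b (cj (c j)) g x) = ∫ x, τ x * (fs r (ex (-K)) x * g x)) :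
    ENNReal.ofReal K * ∑ j, N2 ({x | 2 ≤ ν * sR r x}.indicator (h1 j)) ≤
      4 * N2 τ + 8 * Fintype.card ι * ENNReal.ofReal (L * B) ^ 2 * ∑ j, N2 ((Metric.ball (0:E) r).indicator (h1 j)) := by
  set Ω := Metric.ball (0:E) r
  have oΩ : IsOpen Ω := Metric.isOpen_ball
  have tη := eta_ts h hν
  set η := fs (E := E) r (et ν) with hη
  have ηm := tη.sm.continuous.measurable
  set β := bt b c r K ν
  have P := pinD h hK hν
  have bT : ∀ j, Ts Ω (β j) := fun j => (fs_ts h.r0 (kf_sm K hν) (t₀ := 1 / (4 * ν)) (by positivity) (ct_z hν)).mul' (Sm.V (h.geo.csm j) rc_sm)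
  have γs := fun j => gam_sm h.geo P.βsm j
  have q0 : ContDiffOn ℝ ∞ (fun t : ℝ => Real.sqrt K / t) (Ioi 0) :=
    contDiffOn_const.div contDiffOn_id fun t ht => (ne_of_gt ht)
  have qT : Ts Ω (fs (E := E) r (fun t => ct ν t * (Real.sqrt K / t))) :=
    fs_ts h.r0 (ct_mul hν q0) (t₀ := 1 / (4 * ν)) (by positivity) (ct_z hν)
  set q := fs (E := E) r (fun t => ct ν t * (Real.sqrt K / t))
  have w1' : ∀ j, ∀ x ∈ Ω, ‖V b (cj (c j)) rc x‖ ≤ B := fun j x hx => by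
    rw [V_cj_rc, RCLike.norm_conj]; exact h.w1 x hx j
  have v1 : ∀ j, Ts Ω (V b (c j) η) := fun j => tη.V (h.geo.csm j)
  have v2 : ∀ j, Ts Ω (V b (cj (c j)) η) := fun j => tη.V (cj_sm (h.geo.csm j))
  have mη : ∀ j, MemLp (fun x => η x * h1 j x) 2 := fun j => mlT tη (hl j)
  obtain ⟨C1, hC1⟩ : ∃ C, ∀ j x, ‖β j x‖ ≤ C := by
    choose C hC using fun j => (bT j).bdd
    refine ⟨∑ j, |C j|, fun j x => (hC j x).trans ((le_abs_self _).trans ?_)⟩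
    exact Finset.single_le_sum (f := fun j => |C j|) (fun _ _ => abs_nonneg _) (Finset.mem_univ j)
  obtain ⟨C2, hC2⟩ : ∃ C, ∀ j x, ‖gam b c β j x‖ ≤ C := by
    refine ⟨∑ a, C0 * ‖b a‖ + C1, fun j x => ?_⟩
    rw [gam]
    refine (norm_add_le _ _).trans (add_le_add ?_ (by rw [RCLike.norm_conj]; exact hC1 j x))
    rw [norm_neg, kap]
    refine norm_sum_le_of_le _ fun a _ => ?_
    have : D (b a) (cj (c j) a) x = conj (D (b a) (c j a) x) := D_conj ((h.geo.csm j a).da x) _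
    rw [this, RCLike.norm_conj]
    exact ((fderiv ℝ (c j a) x).le_opNorm _).trans (by gcongr; exact h.cd j a x)
  obtain ⟨C3, hC3⟩ := qT.bdd
  set C := max (max C0 C1) (max C2 C3)
  have γl : ∀ j, MemLp (fun x => gam b c β j x * (η x * h1 j x)) 2 := fun j => mlb (γs j).continuous.measurable (hC2 j) (mη j)
  have γm := fun j => (γs j).continuous.measurable
  have v1m := fun j => (v1 j).sm.continuous.measurable
  have v2m := fun j => (v2 j).sm.continuous.measurable
  have βm := fun j => (P.βsm j).continuous.measurable
  have v2l : ∀ j, MemLp (fun x => V b (cj (c j)) η x * h1 j x) 2 := fun j => mlT (v2 j) (hl j)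
  have ηsup : tsupport η ⊆ {x : E | 1 / 2 < ν * sR r x} := by
    have : IsClosed {x : E | 1 ≤ ν * sR r x} := isClosed_le continuous_const (continuous_const.mul (sR_sm r).continuous)
    refine (closure_minimal (fun x hx => ?_) this).trans fun x hx => by simp only [mem_ofPred_eq] at hx ⊢; linarith
    by_contra h'
    simp only [mem_ofPred_eq, not_le] at h'
    exact hx (by rw [hη, fs, et_z hν _ (by rw [le_div_iff₀ hν]; linarith)]; simp)
  have key := B2 P (v := fun j x => η x * h1 j x) (T := fun x => - (η x * τ x) + ∑ j, gam b c β j x * (η x * h1 j x) + ∑ j, V b (cj (c j)) η x * h1 j x)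
    (S := fun j k x => V b (c j) η x * h1 k x - V b (c k) η x * h1 j x - (β j x * (η x * h1 k x) - β k x * (η x * h1 j x)))
    (q := q) (C := C) (isOpen_lt continuous_const (continuous_const.mul (sR_sm r).continuous)) qT.sm
    (fun x hx => by
      have hx : 1 / 2 < ν * sR r x := hx
      have s0 : 0 < sR r x := by by_contra h'; nlinarith
      rw [show q x = ((Real.sqrt K / sR r x : ℝ) : ℂ) by rw [← one_mul (Real.sqrt K / _), ← ct_one hx.le]; rfl,
        Complex.norm_real, Real.norm_eq_abs, sq_abs, div_pow, Real.sq_sqrt (by linarith)])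
    (fun j => ηm.mul (hm j)) mη (fun j => tη.cs.mul_right) (fun j => (tsupport_mul_subset_left).trans ηsup)
    (by fun_prop) (((mlT tη τl).neg.add (ms γl)).add (ms v2l)) (fun j k => by fun_prop)
    (fun j k => ((mlT (v1 j) (hl k)).sub (mlT (v1 k) (hl j))).sub ((mlT (bT j) (mη k)).sub (mlT (bT k) (mη j))))
    (fun j a x => (h.cd j a x).trans ((le_max_left _ _).trans (le_max_left _ _)))
    (fun j x => (hC1 j x).trans ((le_max_right _ _).trans (le_max_left _ _)))
    (fun j x => (hC2 j x).trans ((le_max_left _ _).trans (le_max_right _ _)))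
    (fun x => (hC3 x).trans ((le_max_right _ _).trans (le_max_right _ _)))
    ?_ ?_
  rotate_left
  · intro g hg
    have tg := tη.mul' hg.sm
    have tG := tg.mulOn (fs_smOn h.r0 (ex_sm K)) oΩ
    have hE := fun j => (tG.V (b := b) (cj_sm (h.geo.csm j))).mulOn (fs_smOn h.r0 (ex_sm (-K))) oΩ
    have e1 := hT _ tG
    have I1 : Integrable fun x => ∑ j, h1 j x * (fs r (ex (-K)) x * V b (cj (c j)) (fun y => fs r (ex K) y * (η y * g y)) x) :=
      integrable_finsetSum _ fun j _ => iT (hl j) (hE j)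
    have I2 : Integrable fun x => (∑ j, gam b c β j x * (η x * h1 j x) + ∑ j, V b (cj (c j)) η x * h1 j x) * g x :=
      iT ((ms γl).add (ms v2l)) hg
    have I3 : Integrable fun x => (η x * τ x) * g x := iT (mlT tη τl) hg
    have e2 : ∫ x, τ x * (fs r (ex (-K)) x * (fs r (ex K) x * (η x * g x))) = ∫ x, (η x * τ x) * g x := by
      refine integral_congr_ae (.of_forall fun x => ?_)
      have : fs r (ex (-K)) x * fs r (ex K) x = 1 := by
        rw [fs, fs, ← Complex.ofReal_mul, mul_comm, e_pm, Complex.ofReal_one]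
      dsimp only
      linear_combination (τ x * η x * g x) * this
    calc _ = ∫ x, ((∑ j, gam b c β j x * (η x * h1 j x) + ∑ j, V b (cj (c j)) η x * h1 j x) * g x - ∑ j, h1 j x * (fs r (ex (-K)) x * V b (cj (c j)) (fun y => fs r (ex K) y * (η y * g y)) x)) := by
          refine integral_congr_ae (.of_forall fun x => ?_)
          dsimp only
          rw [add_mul, Finset.sum_mul, Finset.sum_mul, ← Finset.sum_add_distrib, ← Finset.sum_sub_distrib]
          refine Finset.sum_congr rfl fun j _ => ?_
          have := conjQ h (K := K) hν j hg.sm x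
          linear_combination h1 j x * this
      _ = ∫ x, ((∑ j, gam b c β j x * (η x * h1 j x) + ∑ j, V b (cj (c j)) η x * h1 j x) * g x - (η x * τ x) * g x) := by
          rw [integral_sub I2 I1, integral_sub I2 I3, e1, e2]
      _ = _ := by
          refine integral_congr_ae (.of_forall fun x => ?_)
          dsimp only
          ring
  · intro j k g hg
    have tg := tη.mul' hg.sm
    have tG := tg.mulOn (fs_smOn h.r0 (ex_sm (-K))) oΩ
    have hE := fun j => (tG.Pt (b := b) (h.geo.csm j)).mulOn (fs_smOn h.r0 (ex_sm K)) oΩ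
    have I1 := iT (hl k) (hE j)
    have I2 := iT (hl j) (hE k)
    have e1 := hS _ tG j k
    have Sl : MemLp (fun x => V b (c j) η x * h1 k x - V b (c k) η x * h1 j x - (β j x * (η x * h1 k x) - β k x * (η x * h1 j x))) 2 :=
      ((mlT (v1 j) (hl k)).sub (mlT (v1 k) (hl j))).sub ((mlT (bT j) (mη k)).sub (mlT (bT k) (mη j)))
    have e2 := integral_add (I1.sub I2) (iT Sl hg)
    simp only [Pi.sub_apply] at e2
    rw [integral_sub I1 I2, e1, sub_self, zero_add] at e2
    rw [← e2]
    refine integral_congr_ae (.of_forall fun x => ?_)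
    have q1 := conjP h (K := K) hν j hg.sm x
    have q2 := conjP h (K := K) hν k hg.sm x
    dsimp only
    linear_combination - h1 k x * q1 + h1 j x * q2
  -- final estimates
  set n : ℝ≥0∞ := (Fintype.card ι : ℝ≥0∞) with hn
  set A := ENNReal.ofReal (L * B) ^ 2
  set H := fun j => N2 (Ω.indicator (h1 j))
  have f1 : ENNReal.ofReal K * ∑ j, N2 ({x | 2 ≤ ν * sR r x}.indicator (h1 j)) ≤ ∑ j, N2 fun x => q x * (η x * h1 j x) := by
    rw [Finset.mul_sum]
    refine Finset.sum_le_sum fun j _ => ?_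
    have : ENNReal.ofReal K = ‖((Real.sqrt K : ℝ) : ℂ)‖ₑ ^ 2 := by
      rw [← ofReal_norm, Complex.norm_real, Real.norm_of_nonneg (Real.sqrt_nonneg _), ← ENNReal.ofReal_pow (Real.sqrt_nonneg _), Real.sq_sqrt (by linarith)]
    rw [this, ← N2_const_mul]
    refine N2_mono fun x => ?_
    by_cases hx : 2 ≤ ν * sR r x
    · have s0 : 0 < sR r x := by by_contra h'; nlinarith
      rw [indicator_of_mem (by exact hx)]
      refine le_of_eq (congrArg norm ?_)
      have e1 : q x = ((Real.sqrt K / sR r x : ℝ) : ℂ) := by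
        rw [← one_mul (Real.sqrt K / _), ← ct_one (show 1/2 ≤ ν * sR r x by linarith)]; rfl
      have e2 : η x = (sR r x : ℂ) := by
        rw [hη, fs, et, ps_id hx, mul_div_cancel_left₀ _ hν.ne']
      rw [e1, e2]; push_cast
      have : (sR r x : ℂ) ≠ 0 := by exact_mod_cast s0.ne'
      field_simp
    · rw [indicator_of_notMem (by exact hx), mul_zero, norm_zero]; exact norm_nonneg _
  have f2 : (N2 fun x => - (- (η x * τ x) + ∑ j, gam b c β j x * (η x * h1 j x) + ∑ j, V b (cj (c j)) η x * h1 j x) + ∑ j, gam b c β j x * (η x * h1 j x)) ≤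
      2 * N2 τ + 2 * (n * (A * ∑ j, H j)) := by
    have e : (fun x => - (- (η x * τ x) + ∑ j, gam b c β j x * (η x * h1 j x) + ∑ j, V b (cj (c j)) η x * h1 j x) + ∑ j, gam b c β j x * (η x * h1 j x)) =
      fun x => η x * τ x - ∑ j, V b (cj (c j)) η x * h1 j x := by ext x; ring
    rw [e]
    refine (N2_sub (ηm.mul τm)).trans ?_
    rw [mul_add]
    gcongr
    · refine N2_mono fun x => ?_
      rw [Pi.mul_apply, norm_mul]
      refine mul_le_of_le_one_left (norm_nonneg _) ?_
      by_cases hx : x ∈ Ω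
      · have s0 := (sR_pos h.r0).2 hx
        have := et_le hν s0.le
        rw [hη, fs, Complex.norm_real, Real.norm_of_nonneg this.1]
        refine this.2.trans ?_
        rw [sR]; nlinarith [h.r0, h.r1, sq_nonneg ‖x‖]
      · rw [tη.zero_of hx]; simp
    · refine (N2_sum fun j => by fun_prop).trans ?_
      gcongr
      rw [Finset.mul_sum]
      exact Finset.sum_le_sum fun j _ => vb h hL hν (w1' j) _
  have f3 : (∑ j, ∑ k, N2 fun x => V b (c j) η x * h1 k x - V b (c k) η x * h1 j x - (β j x * (η x * h1 k x) - β k x * (η x * h1 j x)) + (β j x * (η x * h1 k x) - β k x * (η x * h1 j x)))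
      ≤ 4 * (n * (A * ∑ j, H j)) := by
    have : ∀ j k, (N2 fun x => V b (c j) η x * h1 k x - V b (c k) η x * h1 j x - (β j x * (η x * h1 k x) - β k x * (η x * h1 j x)) + (β j x * (η x * h1 k x) - β k x * (η x * h1 j x))) ≤ 2 * (A * H k + A * H j) := fun j k => by
      simp only [sub_add_cancel]
      refine (N2_sub ((v1m j).mul (hm k))).trans ?_
      gcongr
      · exact vb h hL hν (fun x hx => h.w1 x hx j) _
      · exact vb h hL hν (fun x hx => h.w1 x hx k) _
    refine (Finset.sum_le_sum fun j _ => Finset.sum_le_sum fun k _ => this j k).trans (le_of_eq ?_)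
    simp only [← Finset.mul_sum, Finset.sum_add_distrib, Finset.sum_const, Finset.card_univ, nsmul_eq_mul, ← hn]
    ring
  refine f1.trans (key.trans ((add_le_add (mul_le_mul_right f2 2) f3).trans (le_of_eq ?_)))
  ring
end core
end NN

namespace NN
open MeasureTheory Filter Topology Set
open scoped ContDiff ComplexConjugate ENNReal

section core
set_option linter.unusedSectionVars false
variable {E : Type*} [NormedAddCommGroup E] [InnerProductSpace ℝ E]
  [FiniteDimensional ℝ E] [MeasurableSpace E] [BorelSpace E]
variable {ι α : Type*} [Fintype ι] [Fintype α] [DecidableEq ι]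
variable {b : α → E} {c : ι → α → E → ℂ} {p : α → ι → E → ℂ} {r B ε C0 : ℝ}

theorem N2_lim (hr : 0 < r) {f : E → ℂ} (hf : Measurable f) :
    Tendsto (fun k : ℕ => N2 ({x | 2 ≤ ((k : ℝ) + 1) * sR r x}.indicator f)) atTop (𝓝 (N2 ((Metric.ball (0:E) r).indicator f))) := by
  have hs : Continuous (sR (E := E) r) := (sR_sm r).continuous
  have hA : ∀ k : ℕ, MeasurableSet {x : E | 2 ≤ ((k : ℝ) + 1) * sR r x} := fun k =>
    (isClosed_le continuous_const (continuous_const.mul hs)).measurableSet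
  refine lintegral_tendsto_of_tendsto_of_monotone (fun k => ((hf.indicator (hA k)).enorm.pow_const 2).aemeasurable) (.of_forall fun x => ?_) (.of_forall fun x => ?_)
  · intro k l hkl
    dsimp only
    gcongr 1
    by_cases hx : x ∈ {x : E | 2 ≤ ((k : ℝ) + 1) * sR r x}
    · have : x ∈ {x : E | 2 ≤ ((l : ℝ) + 1) * sR r x} := by
        simp only [mem_ofPred_eq] at hx ⊢
        have s0 : 0 < sR r x := by by_contra h'; nlinarith [(Nat.cast_nonneg k : (0:ℝ) ≤ k)]
        have : (k:ℝ) ≤ l := by exact_mod_cast hkl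
        nlinarith
      rw [indicator_of_mem hx, indicator_of_mem this]
    · rw [indicator_of_notMem hx]; simp
  · refine tendsto_const_nhds.congr' ?_
    by_cases hx : x ∈ Metric.ball (0:E) r
    · have s0 := (sR_pos hr).2 hx
      obtain ⟨N, hN⟩ := exists_nat_gt (2 / sR r x)
      filter_upwards [eventually_ge_atTop N] with k hk
      have : x ∈ {x : E | 2 ≤ ((k : ℝ) + 1) * sR r x} := by
        rw [div_lt_iff₀ s0] at hN
        have : (N:ℝ) ≤ k := by exact_mod_cast hk
        simp only [mem_ofPred_eq]; nlinarith
      rw [indicator_of_mem hx, indicator_of_mem this]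
    · filter_upwards with k
      have : x ∉ {x : E | 2 ≤ ((k : ℝ) + 1) * sR r x} := by
        simp only [mem_ofPred_eq, not_le]
        have : sR r x ≤ 0 := not_lt.1 fun h' => hx ((sR_pos hr).1 h')
        nlinarith [(Nat.cast_nonneg k : (0:ℝ) ≤ k)]
      rw [indicator_of_notMem hx, indicator_of_notMem this]

theorem C1 (h : Dat b c p r B ε C0) {L K : ℝ} (hL : ∀ t, |deriv ps t| ≤ L) (hK : K = 8 * Fintype.card ι * (L * B) ^ 2 + 4)
    {h1 : ι → E → ℂ} {τ : E → ℂ} (hm : ∀ j, Measurable (h1 j)) (hl : ∀ j, MemLp (h1 j) 2) (τm : Measurable τ) (τl : MemLp τ 2)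
    (hS : ∀ g, Ts (Metric.ball (0:E) r) g → ∀ j k, ∫ x, h1 k x * (fs r (ex K) x * Pt b (c j) g x) = ∫ x, h1 j x * (fs r (ex K) x * Pt b (c k) g x))
    (hT : ∀ g, Ts (Metric.ball (0:E) r) g → ∫ x, ∑ j, h1 j x * (fs r (ex (-K)) x * V b (cj (c j)) g x) = ∫ x, τ x * (fs r (ex (-K)) x * g x)) :
    ∑ j, N2 ((Metric.ball (0:E) r).indicator (h1 j)) ≤ N2 τ := by
  have L0 : 0 ≤ L := (abs_nonneg _).trans (hL 0)
  have h0 := mul_nonneg L0 h.B0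
  have key := le_of_tendsto (ENNReal.Tendsto.const_mul (a := ENNReal.ofReal K) (tendsto_finsetSum Finset.univ fun j _ => N2_lim h.r0 (hm j)) (.inr (by simp)))
    (.of_forall fun k : ℕ => C1a h hL (ν := k + 1) (by positivity) (by rw [hK]; nlinarith [mul_nonneg (Nat.cast_nonneg (α := ℝ) (Fintype.card ι)) (sq_nonneg (L * B))]) hm hl τm τl hS hT)
  set S := ∑ j, N2 ((Metric.ball (0:E) r).indicator (h1 j))
  have hS' : S ≠ ⊤ := (ENNReal.sum_lt_top.2 fun j _ => N2_lt ((hl j).indicator Metric.isOpen_ball.measurableSet)).ne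
  rw [hK, ENNReal.ofReal_add (by positivity) (by norm_num), ENNReal.ofReal_mul (by positivity), ENNReal.ofReal_mul (by positivity),
    ENNReal.ofReal_pow h0, ENNReal.ofReal_natCast, add_mul, add_comm] at key
  norm_num at key
  have h2 := (ENNReal.add_le_add_iff_right (by finiteness)).1 key
  exact (ENNReal.mul_le_mul_iff_right (by norm_num) (by norm_num)).1 h2
end core
end NN

namespace NN
open MeasureTheory Filter Topology Set
open scoped ContDiff ComplexConjugate ENNReal

section rz
set_option linter.unusedSectionVars false
variable {E : Type*} [NormedAddCommGroup E] [InnerProductSpace ℝ E]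
  [FiniteDimensional ℝ E] [MeasurableSpace E] [BorelSpace E]

theorem riesz {X H : Type*} [AddCommGroup X] [Module ℂ X] [NormedAddCommGroup H] [InnerProductSpace ℂ H] [CompleteSpace H]
    (A : X →ₗ[ℂ] H) (l : X →ₗ[ℂ] ℂ) {C : ℝ} (hC : 0 ≤ C) (h : ∀ x, ‖l x‖ ≤ C * ‖A x‖) :
    ∃ U : H, ‖U‖ ≤ C ∧ ∀ x, l x = inner ℂ U (A x) := by
  obtain ⟨s, hs⟩ := A.rangeRestrict.exists_rightInverse_of_surjective A.range_rangeRestrict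
  have hs' : ∀ y, A (s y) = y := fun y => congrArg Subtype.val (LinearMap.congr_fun hs y)
  let g : StrongDual ℂ A.range := (l ∘ₗ s).mkContinuous C fun y => by
    have := h (s y); rwa [hs'] at this
  obtain ⟨f, hf, hn⟩ := exists_extension_norm_eq A.range g
  refine ⟨(InnerProductSpace.toDual ℂ H).symm f, ?_, fun x => ?_⟩
  · rw [LinearIsometryEquiv.norm_map, hn]
    exact LinearMap.mkContinuous_norm_le _ hC _
  · rw [InnerProductSpace.toDual_symm_apply]
    have := hf ⟨A x, x, rfl⟩
    rw [this]
    change l x = l (s _)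
    have h2 := h (x - s ⟨A x, x, rfl⟩)
    rw [map_sub A, hs', sub_self, norm_zero, mul_zero, norm_le_zero_iff, map_sub, sub_eq_zero] at h2
    exact h2

def Xs (κ : Type*) (O : Set E) : Submodule ℂ (κ → E → ℂ) where
  carrier := {G | ∀ j, Ts O (G j)}
  add_mem' h h' j := (h j).add (h' j)
  zero_mem' j := Ts.zero O
  smul_mem' a G h j := (h j).mul (a := fun _ => a) contDiff_const

theorem N2_toLp {f : E → ℂ} (hf : MemLp f 2) : N2 f = ENNReal.ofReal ‖hf.toLp f‖ ^ 2 := by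
  rw [ofReal_norm, Lp.enorm_toLp, N2_eq]

theorem N2_Lp (f : Lp ℂ 2 (volume : Measure E)) : N2 f = ENNReal.ofReal ‖f‖ ^ 2 := by
  rw [ofReal_norm, Lp.enorm_def, N2_eq]

theorem riesz2 {κ : Type*} {O : Set E} (A : (κ → E → ℂ) → E → ℂ) (l : (κ → E → ℂ) → ℂ) (hA : ∀ G, (∀ j, Ts O (G j)) → MemLp (A G) 2)
    (Aa : ∀ G G', (∀ j, Ts O (G j)) → (∀ j, Ts O (G' j)) → A (G + G') = A G + A G')
    (As : ∀ (a : ℂ) G, (∀ j, Ts O (G j)) → A (a • G) = a • A G)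
    (la : ∀ G G', (∀ j, Ts O (G j)) → (∀ j, Ts O (G' j)) → l (G + G') = l G + l G')
    (ls : ∀ (a : ℂ) G, (∀ j, Ts O (G j)) → l (a • G) = a • l G) {C : ℝ} (hC : 0 ≤ C)
    (hb : ∀ G, (∀ j, Ts O (G j)) → ENNReal.ofReal ‖l G‖ ^ 2 ≤ ENNReal.ofReal C ^ 2 * N2 (A G)) :
    ∃ u : E → ℂ, Measurable u ∧ MemLp u 2 ∧ N2 u ≤ ENNReal.ofReal C ^ 2 ∧ ∀ G, (∀ j, Ts O (G j)) → l G = ∫ x, u x * A G x := by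
  let A' : Xs κ O →ₗ[ℂ] Lp ℂ 2 (volume : Measure E) :=
    { toFun := fun G => (hA G.1 G.2).toLp _
      map_add' := fun G G' => by
        rw [← MemLp.toLp_add]; exact MemLp.toLp_congr _ _ (by rw [← Aa _ _ G.2 G'.2]; rfl)
      map_smul' := fun a G => by
        rw [RingHom.id_apply, ← MemLp.toLp_const_smul]; exact MemLp.toLp_congr _ _ (by rw [← As _ _ G.2]; rfl) }
  let l' : Xs κ O →ₗ[ℂ] ℂ :=
    { toFun := fun G => l G.1
      map_add' := fun G G' => la _ _ G.2 G'.2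
      map_smul' := fun a G => ls _ _ G.2 }
  obtain ⟨U, hU, hU2⟩ := riesz A' l' hC fun G => by
    have := hb G.1 G.2
    rw [N2_toLp (hA G.1 G.2), ← mul_pow, ← ENNReal.ofReal_mul hC, ← ENNReal.ofReal_pow (by positivity), ← ENNReal.ofReal_pow (by positivity),
      ENNReal.ofReal_le_ofReal_iff (by positivity)] at this
    exact le_of_sq_le_sq this (by positivity)
  have hm := (Lp.stronglyMeasurable U).measurable
  refine ⟨fun x => conj (U x), Complex.continuous_conj.measurable.comp hm, (Lp.memLp U).star, ?_, fun G hG => ?_⟩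
  · have : N2 (fun x => conj (U x)) = N2 U := le_antisymm (N2_mono fun x => by simp) (N2_mono fun x => by simp)
    rw [this, N2_Lp]; gcongr
  · have := hU2 ⟨G, hG⟩
    change l G = _ at this
    rw [this, L2.inner_def]
    refine integral_congr_ae ?_
    filter_upwards [(hA G hG).coeFn_toLp] with x hx
    change inner ℂ (U x) ((hA G hG).toLp _ x) = _
    rw [hx]; simp [mul_comm]
end rz
section pi
set_option linter.unusedSectionVars false
variable {E : Type*} [NormedAddCommGroup E] [InnerProductSpace ℝ E]
  [FiniteDimensional ℝ E] [MeasurableSpace E] [BorelSpace E] {ι : Type*} [Fintype ι]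

abbrev HH (E ι : Type*) [NormedAddCommGroup E] [InnerProductSpace ℝ E]
  [FiniteDimensional ℝ E] [MeasurableSpace E] [BorelSpace E] [Fintype ι] := PiLp 2 fun _ : ι => Lp ℂ 2 (volume : Measure E)

def el (f : ι → E → ℂ) (hf : ∀ j, MemLp (f j) 2) : HH E ι := WithLp.toLp 2 fun j => (hf j).toLp (f j)

theorem inner_el {f : ι → E → ℂ} (hf : ∀ j, MemLp (f j) 2) (U : HH E ι) : inner ℂ (el f hf) U = ∑ j, ∫ x, conj (f j x) * U j x := by
  rw [PiLp.inner_apply]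
  refine Finset.sum_congr rfl fun j _ => ?_
  rw [L2.inner_def]
  refine integral_congr_ae ?_
  filter_upwards [(hf j).coeFn_toLp] with x hx
  change inner ℂ ((hf j).toLp _ x) _ = _
  rw [hx]; simp [mul_comm]

theorem inner_elel {f g : ι → E → ℂ} (hf : ∀ j, MemLp (f j) 2) (hg : ∀ j, MemLp (g j) 2) : inner ℂ (el f hf) (el g hg) = ∑ j, ∫ x, conj (f j x) * g j x := by
  rw [inner_el]
  refine Finset.sum_congr rfl fun j _ => integral_congr_ae ?_
  filter_upwards [(hg j).coeFn_toLp] with x hx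
  change _ * ((hg j).toLp _ x) = _
  rw [hx]

theorem norm_el {f : ι → E → ℂ} (hf : ∀ j, MemLp (f j) 2) : ENNReal.ofReal ‖el f hf‖ ^ 2 = ∑ j, N2 (f j) := by
  rw [← ENNReal.ofReal_pow (by positivity), PiLp.norm_sq_eq_of_L2, ENNReal.ofReal_sum_of_nonneg (fun _ _ => by positivity)]
  refine Finset.sum_congr rfl fun j _ => ?_
  rw [N2_toLp (hf j), ENNReal.ofReal_pow (by positivity)]; rfl

theorem el_coe (U : HH E ι) : el (fun j => (U j : E → ℂ)) (fun j => Lp.memLp _) = U := by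
  ext1 j; exact Lp.toLp_coeFn _ (Lp.memLp _)
end pi
end NN

namespace NN
open MeasureTheory Filter Topology Set
open scoped ContDiff ComplexConjugate ENNReal

section sol
set_option linter.unusedSectionVars false
variable {E : Type*} [NormedAddCommGroup E] [InnerProductSpace ℝ E]
  [FiniteDimensional ℝ E] [MeasurableSpace E] [BorelSpace E]
variable {ι α : Type*} [Fintype ι] [Fintype α] [DecidableEq ι]
variable {b : α → E} {c : ι → α → E → ℂ} {p : α → ι → E → ℂ} {r B ε C0 : ℝ}

theorem Pt_add {ξ : α → E → ℂ} (hξ : ∀ a, Sm (ξ a)) {u v : E → ℂ} (hu : Sm u) (hv : Sm v) (x : E) :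
    Pt b ξ (fun y => u y + v y) x = Pt b ξ u x + Pt b ξ v x := by
  rw [Pt_eq hξ (hu.add hv), Pt_eq hξ hu, Pt_eq hξ hv, V_add hu hv]; ring

theorem Pt_smul {ξ : α → E → ℂ} (hξ : ∀ a, Sm (ξ a)) {u : E → ℂ} (hu : Sm u) (a : ℂ) (x : E) :
    Pt b ξ (fun y => a * u y) x = a * Pt b ξ u x := by
  rw [Pt_mul hξ contDiff_const hu]
  simp [V, D_const]

theorem Pt_conj {ξ : α → E → ℂ} (hξ : ∀ a, Sm (ξ a)) {u : E → ℂ} (hu : Sm u) (x : E) :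
    Pt b (cj ξ) (fun y => conj (u y)) x = conj (Pt b ξ u x) := by
  simp only [Pt, map_sum, map_neg]
  refine Finset.sum_congr rfl fun a _ => ?_
  rw [← D_conj (Sm.da ((hξ a).mul hu) x)]
  simp [cj]

def Fz (b : α → E) (c : ι → α → E → ℂ) (r K : ℝ) (z : E → ℂ) (j : ι) : E → ℂ :=
  (Metric.ball (0:E) r).indicator fun x => fs r (ex (-K)) x * V b (c j) z x

theorem em (h : Dat b c p r B ε C0) {K x} (hK : 0 ≤ K) (hx : x ∈ Metric.ball (0:E) r) : ‖fs r (ex (-K)) x‖ ≤ 1 := by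
  have s0 := (sR_pos h.r0).2 hx
  rw [fs, Complex.norm_real, ex, Real.norm_of_nonneg (Real.exp_pos _).le, Real.exp_le_one_iff, neg_div, neg_nonpos]
  positivity

theorem fs_mb {f : ℝ → ℝ} (hf : Measurable f) : Measurable (fs (E := E) r f) :=
  Complex.measurable_ofReal.comp (hf.comp (sR_sm r).continuous.measurable)

theorem ex_mb (K : ℝ) : Measurable (ex K) := by unfold ex; fun_prop

theorem bl {f : E → ℂ} (hf : Sm f) : MemLp ((Metric.ball (0:E) r).indicator f) 2 := by
  obtain ⟨C, hC⟩ := (isCompact_closedBall (0:E) r).exists_bound_of_continuousOn hf.continuous.continuousOn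
  rw [memLp_indicator_iff_restrict Metric.isOpen_ball.measurableSet]
  have : IsFiniteMeasure (volume.restrict (Metric.ball (0:E) r)) := ⟨by simpa using measure_ball_lt_top⟩
  refine MemLp.of_bound hf.continuous.aestronglyMeasurable C ?_
  exact (ae_restrict_iff' Metric.isOpen_ball.measurableSet).2 (.of_forall fun x hx => hC x (Metric.ball_subset_closedBall hx))

theorem Fz_le (h : Dat b c p r B ε C0) {K} (hK : 0 ≤ K) (z : E → ℂ) (j : ι) (x : E) :
    ‖Fz b c r K z j x‖ ≤ ‖(Metric.ball (0:E) r).indicator (V b (c j) z) x‖ := by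
  by_cases hx : x ∈ Metric.ball (0:E) r
  · rw [Fz, indicator_of_mem hx, indicator_of_mem hx, norm_mul]
    exact mul_le_of_le_one_left (norm_nonneg _) (em h hK hx)
  · rw [Fz, indicator_of_notMem hx]; simp

theorem Fz_l (h : Dat b c p r B ε C0) {K} (hK : 0 ≤ K) {z : E → ℂ} (hz : Sm z) (j : ι) : MemLp (Fz b c r K z j) 2 := by
  refine (bl (r := r) (hz.V (b := b) (h.geo.csm j))).mono ?_ (.of_forall (Fz_le h hK z j))
  exact (((fs_mb (ex_mb _)).mul (hz.V (h.geo.csm j)).continuous.measurable).indicator Metric.isOpen_ball.measurableSet).aestronglyMeasurable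

/-- tuple for compatibility -/
def tp (b : α → E) (c : ι → α → E → ℂ) (r K : ℝ) (g : E → ℂ) (j k l : ι) (x : E) : ℂ :=
  (if l = k then conj (fs r (ex K) x * Pt b (c j) g x) else 0) - (if l = j then conj (fs r (ex K) x * Pt b (c k) g x) else 0)

theorem tT (h : Dat b c p r B ε C0) (K : ℝ) {g : E → ℂ} (hg : Ts (Metric.ball (0:E) r) g) (j : ι) :
    Ts (Metric.ball (0:E) r) fun x => fs r (ex K) x * Pt b (c j) g x :=
  (hg.Pt (h.geo.csm j)).mulOn (fs_smOn h.r0 (ex_sm K)) Metric.isOpen_ball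

theorem tpT (h : Dat b c p r B ε C0) (K : ℝ) {g : E → ℂ} (hg : Ts (Metric.ball (0:E) r) g) (j k l : ι) :
    Ts (Metric.ball (0:E) r) (tp b c r K g j k l) := by
  refine Ts.sub' ?_ ?_
  · split_ifs
    · exact (tT h K hg j).conj
    · exact Ts.zero _
  · split_ifs
    · exact (tT h K hg k).conj
    · exact Ts.zero _

theorem tp_sum (h : Dat b c p r B ε C0) (K : ℝ) {g : E → ℂ} (hg : Ts (Metric.ball (0:E) r) g) (j k : ι) {U : ι → E → ℂ} (hU : ∀ l, MemLp (U l) 2) :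
    ∑ l, ∫ x, conj (tp b c r K g j k l x) * U l x = (∫ x, U k x * (fs r (ex K) x * Pt b (c j) g x)) - ∫ x, U j x * (fs r (ex K) x * Pt b (c k) g x) := by
  have : ∀ l, ∫ x, conj (tp b c r K g j k l x) * U l x = (if l = k then ∫ x, U l x * (fs r (ex K) x * Pt b (c j) g x) else 0)
      - (if l = j then ∫ x, U l x * (fs r (ex K) x * Pt b (c k) g x) else 0) := fun l => by
    have e1 := iT (hU l) (tT h K hg j)
    have e2 := iT (hU l) (tT h K hg k)
    have : (fun x => conj (tp b c r K g j k l x) * U l x) = fun x => (if l = k then U l x * (fs r (ex K) x * Pt b (c j) g x) else 0)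
      - (if l = j then U l x * (fs r (ex K) x * Pt b (c k) g x) else 0) := by
      ext x; rw [tp]; split_ifs <;> simp <;> ring
    rw [this, integral_sub]
    · split_ifs <;> simp
    · split_ifs; exacts [e1, by simp]
    · split_ifs; exacts [e2, by simp]
  simp_rw [this]
  rw [Finset.sum_sub_distrib]
  simp

def KK (b : α → E) (c : ι → α → E → ℂ) (r K : ℝ) : Submodule ℂ (HH E ι) :=
  (Submodule.span ℂ {w | ∃ g j k, Ts (Metric.ball (0:E) r) g ∧ ∃ hl, w = el (tp b c r K g j k) hl})ᗮ

theorem KK_iff (h : Dat b c p r B ε C0) {K : ℝ} {U : HH E ι} : U ∈ KK b c r K ↔ ∀ g, Ts (Metric.ball (0:E) r) g → ∀ j k,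
    ∫ x, U k x * (fs r (ex K) x * Pt b (c j) g x) = ∫ x, U j x * (fs r (ex K) x * Pt b (c k) g x) := by
  constructor
  · intro hU g hg j k
    have := (Submodule.mem_orthogonal _ _).1 hU _ (Submodule.subset_span ⟨g, j, k, hg, fun l => (tpT h K hg j k l).lp 2, rfl⟩)
    rw [inner_el, tp_sum h K hg j k (fun l => Lp.memLp _)] at this
    exact sub_eq_zero.1 this
  · intro hU
    refine (Submodule.mem_orthogonal _ _).2 fun w hw => ?_
    induction hw using Submodule.span_induction with
    | mem w hw =>
      obtain ⟨g, j, k, hg, hl, rfl⟩ := hw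
      rw [inner_el, tp_sum h K hg j k (fun l => Lp.memLp _), hU g hg j k, sub_self]
    | zero => simp
    | add x y _ _ hx hy => rw [inner_add_left, hx, hy, add_zero]
    | smul a x _ hx => rw [inner_smul_left, hx, mul_zero]

theorem Fz_mem (h : Dat b c p r B ε C0) {K} (hK : 0 ≤ K) {z : E → ℂ} (hz : Sm z) : el (Fz b c r K z) (Fz_l h hK hz) ∈ KK b c r K := by
  rw [KK_iff h]
  intro g hg j k
  have key : ∀ j k, ∫ x, (el (Fz b c r K z) (Fz_l h hK hz)) k x * (fs r (ex K) x * Pt b (c j) g x) = ∫ x, V b (c j) (V b (c k) z) x * g x := fun j k => by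
    rw [ibpV (h.geo.csm j) (hz.V (h.geo.csm k)) hg]
    refine integral_congr_ae ?_
    filter_upwards [(Fz_l h hK hz k).coeFn_toLp] with x hx
    change (Fz_l h hK hz k).toLp _ x * _ = _
    rw [hx, Fz]
    by_cases hx : x ∈ Metric.ball (0:E) r
    · rw [indicator_of_mem hx]
      have : fs r (ex (-K)) x * fs r (ex K) x = 1 := by
        rw [fs, fs, ← Complex.ofReal_mul, mul_comm, e_pm, Complex.ofReal_one]
      linear_combination V b (c k) z x * Pt b (c j) g x * this
    · rw [(hg.Pt (h.geo.csm j)).zero_of hx]; simp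
  rw [key, key]
  refine integral_congr_ae (.of_forall fun x => ?_)
  dsimp only
  by_cases hx : x ∈ Metric.ball (0:E) r
  · congr 1
    rw [← sub_eq_zero, V_comm (h.geo.csm j) (h.geo.csm k) hz, V]
    exact Finset.sum_eq_zero fun a _ => by rw [h.cm x hx j k a, sub_self, zero_mul]
  · rw [hg.zero_of hx]; simp

theorem solve (h : Dat b c p r B ε C0) {L K : ℝ} (hL : ∀ t, |deriv ps t| ≤ L) (hK : K = 8 * Fintype.card ι * (L * B) ^ 2 + 4)
    {z : E → ℂ} (hz : Sm z) : ∃ u : E → ℂ, Measurable u ∧ MemLp u 2 ∧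
      N2 u ≤ ENNReal.ofReal (ex K (r ^ 2 / 2)) ^ 2 * ∑ j, N2 ((Metric.ball (0:E) r).indicator (V b (c j) z)) ∧
      ∀ g, Ts (Metric.ball (0:E) (r / 2)) g → ∀ j, ∫ x, u x * Pt b (c j) g x = ∫ x, V b (c j) z x * g x := by
  set Ω := Metric.ball (0:E) r
  have K0 : 0 ≤ K := by rw [hK]; positivity
  have oΩ : IsOpen Ω := Metric.isOpen_ball
  have pm : ∀ x : E, fs r (ex (-K)) x * fs r (ex K) x = 1 := fun x => by
    rw [fs, fs, ← Complex.ofReal_mul, mul_comm, e_pm, Complex.ofReal_one]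
  have rl : ∀ (σ : ℝ) (x : E), conj (fs r (ex σ) x) = fs r (ex σ) x := fun σ x => Complex.conj_ofReal _
  set F := el (Fz b c r K z) (Fz_l h K0 hz)
  have fsm := fun j => hz.V (b := b) (h.geo.csm j)
  let A : (ι → E → ℂ) → E → ℂ := fun G x => fs r (ex K) x * ∑ j, Pt b (c j) (G j) x
  let l : (ι → E → ℂ) → ℂ := fun G => ∑ j, ∫ x, V b (c j) z x * G j x
  have lI : ∀ {G : ι → E → ℂ}, (∀ j, Ts Ω (G j)) → ∀ j, Integrable fun x => V b (c j) z x * G j x :=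
    fun hG j => ((hG j).mul (fsm j)).int
  have AT : ∀ G, (∀ j, Ts Ω (G j)) → Ts Ω (A G) := fun G hG =>
    (Ts.sum fun j => (hG j).Pt (h.geo.csm j)).mulOn (fs_smOn h.r0 (ex_sm K)) oΩ
  have R := riesz2 (O := Ω) A l (fun G hG => (AT G hG).lp 2) ?_ ?_ ?_ ?_ (C := ‖F‖) (norm_nonneg _) ?_
  rotate_left
  · intro G G' hG hG'
    ext x
    simp only [A, Pi.add_apply]
    rw [← mul_add, ← Finset.sum_add_distrib]
    congr 1
    exact Finset.sum_congr rfl fun j _ => Pt_add (h.geo.csm j) (hG j).sm (hG' j).sm x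
  · intro a G hG
    ext x
    simp only [A, Pi.smul_apply, smul_eq_mul]
    rw [mul_left_comm, Finset.mul_sum (a := a)]
    congr 1
    exact Finset.sum_congr rfl fun j _ => Pt_smul (h.geo.csm j) (hG j).sm a x
  · intro G G' hG hG'
    simp only [l, Pi.add_apply, mul_add]
    rw [← Finset.sum_add_distrib]
    exact Finset.sum_congr rfl fun j _ => integral_add (lI hG j) (lI hG' j)
  · intro a G hG
    simp only [l, Pi.smul_apply, smul_eq_mul, mul_left_comm _ a]
    rw [Finset.mul_sum]
    exact Finset.sum_congr rfl fun j _ => integral_const_mul _ _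
  · intro G hG
    have hT := fun j => ((hG j).mulOn (fs_smOn h.r0 (ex_sm K)) oΩ).conj
    set hh := el (fun j x => conj (fs r (ex K) x * G j x)) fun j => (hT j).lp 2
    have : (KK b c r K).HasOrthogonalProjection := by
      have : CompleteSpace (KK b c r K) := (Submodule.isClosed_orthogonal _).completeSpace_coe
      exact Submodule.HasOrthogonalProjection.ofCompleteSpace _
    set h1 := (KK b c r K).starProjection hh
    have h1K : h1 ∈ KK b c r K := Submodule.starProjection_apply_mem _ _
    have h1o : hh - h1 ∈ (KK b c r K)ᗮ := Submodule.sub_starProjection_mem_orthogonal _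
    have proj : ∀ {w : E → ℂ} (hw : Sm w), ∑ j, ∫ x, conj (Fz b c r K w j x) * h1 j x = ∑ j, ∫ x, conj (Fz b c r K w j x) * conj (fs r (ex K) x * G j x) := fun {w} hw => by
      rw [← inner_el (Fz_l h K0 hw) h1, ← inner_elel (Fz_l h K0 hw)]
      have := Submodule.inner_right_of_mem_orthogonal (Fz_mem h K0 hw) h1o
      rw [inner_sub_right, sub_eq_zero] at this
      exact this.symm
    have tT := (AT G hG).conj
    have core := C1 h hL hK (h1 := fun j => h1 j) (τ := fun x => conj (A G x)) (fun j => (Lp.stronglyMeasurable _).measurable) (fun j => Lp.memLp _)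
      tT.sm.continuous.measurable (tT.lp 2) ((KK_iff h).1 h1K) ?_
    · have e1 : conj (l G) = inner ℂ F (el (fun j => Ω.indicator (h1 j)) fun j => (Lp.memLp _).indicator oΩ.measurableSet) := by
        rw [inner_elel]
        trans ∑ j, ∫ x, conj (Fz b c r K z j x) * h1 j x
        · rw [proj hz]
          simp only [l, map_sum]
          refine Finset.sum_congr rfl fun j _ => ?_
          rw [← integral_conj]
          refine integral_congr_ae (.of_forall fun x => ?_)
          dsimp only
          rw [← map_mul]
          congr 1
          by_cases hx : x ∈ Ω
          · rw [Fz, indicator_of_mem hx]; linear_combination - (V b (c j) z x * G j x) * pm x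
          · rw [(hG j).zero_of hx]; simp
        · refine Finset.sum_congr rfl fun j _ => integral_congr_ae (.of_forall fun x => ?_)
          dsimp only
          by_cases hx : x ∈ Ω
          · rw [indicator_of_mem hx]
          · rw [Fz, indicator_of_notMem hx]; simp
      have e2 := norm_inner_le_norm (𝕜 := ℂ) F (el (fun j => Ω.indicator (h1 j)) fun j => (Lp.memLp _).indicator oΩ.measurableSet)
      rw [← e1, RCLike.norm_conj] at e2
      refine (pow_le_pow_left' (ENNReal.ofReal_le_ofReal e2) 2).trans ?_
      rw [ENNReal.ofReal_mul (norm_nonneg _), mul_pow]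
      gcongr
      rw [norm_el]
      exact core.trans (N2_mono fun x => by simp)
    · intro g hg
      have p1 := proj hg.conj.sm
      have e0 : ∀ j x, conj (Fz b c r K (fun y => conj (g y)) j x) = fs r (ex (-K)) x * V b (cj (c j)) g x := fun j x => by
        by_cases hx : x ∈ Ω
        · rw [Fz, indicator_of_mem hx, map_mul, rl]
          congr 1
          rw [V_conj hg.sm]; simp; rfl
        · rw [Fz, indicator_of_notMem hx, (hg.V (b := b) (cj_sm (h.geo.csm j))).zero_of hx]; simp
      have tV := fun j => (hg.V (b := b) (cj_sm (h.geo.csm j))).mulOn (fs_smOn h.r0 (ex_sm (-K))) oΩ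
      rw [integral_finsetSum _ fun j _ => iT (Lp.memLp _) (tV j)]
      simp only [e0] at p1
      simp only [mul_comm (h1 _ _)]
      rw [p1]
      trans ∑ j, ∫ x, g x * Pt b (cj (c j)) (fun y => conj (G j y)) x
      · refine Finset.sum_congr rfl fun j _ => ?_
        rw [← ibpV (cj_sm (h.geo.csm j)) hg.sm (hG j).conj]
        refine integral_congr_ae (.of_forall fun x => ?_)
        dsimp only
        rw [map_mul, rl]
        linear_combination V b (cj (c j)) g x * conj (G j x) * pm x
      · rw [← integral_finsetSum _ fun j _ => (((hG j).conj.Pt (b := b) (cj_sm (h.geo.csm j))).mul hg.sm).int]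
        refine integral_congr_ae (.of_forall fun x => ?_)
        simp only [A, map_mul, map_sum, rl, ← Finset.mul_sum]
        simp only [Pt_conj (h.geo.csm _) (hG _).sm]
        linear_combination -(g x * ∑ j, conj (Pt b (c j) (G j) x)) * pm x
  · obtain ⟨u, um, ul, uN, hu⟩ := R
    have sr : ∀ x ∈ Metric.ball (0:E) (r / 2), r ^ 2 / 2 ≤ sR r x := fun x hx => by
      rw [mem_ball_zero_iff] at hx
      rw [sR]; nlinarith [norm_nonneg x, h.r0]
    have eb : ∀ x, ‖(Metric.ball (0:E) (r / 2)).indicator (fs r (ex K)) x‖ ≤ ex K (r ^ 2 / 2) := fun x => by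
      by_cases hx : x ∈ Metric.ball (0:E) (r / 2)
      · rw [indicator_of_mem hx, fs, Complex.norm_real, ex, Real.norm_of_nonneg (Real.exp_pos _).le, ex]
        have := sr x hx
        have := h.r0
        gcongr
      · rw [indicator_of_notMem hx]; simp [ex, Real.exp_nonneg]
    have mb : Measurable ((Metric.ball (0:E) (r / 2)).indicator (fs r (ex K))) :=
      (fs_mb (ex_mb _)).indicator Metric.isOpen_ball.measurableSet
    refine ⟨fun x => (Metric.ball (0:E) (r / 2)).indicator (fs r (ex K)) x * u x, mb.mul um, mlb mb eb ul, ?_, ?_⟩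
    · have e0 : 0 ≤ ex K (r ^ 2 / 2) := (Real.exp_pos _).le
      have : ENNReal.ofReal (ex K (r ^ 2 / 2)) = ‖((ex K (r ^ 2 / 2) : ℝ) : ℂ)‖ₑ := by
        rw [← ofReal_norm, Complex.norm_real, Real.norm_of_nonneg e0]
      calc _ ≤ N2 fun x => ((ex K (r ^ 2 / 2) : ℝ) : ℂ) * u x := N2_mono fun x => by
            rw [norm_mul, norm_mul, Complex.norm_real, Real.norm_of_nonneg e0]; gcongr; exact eb x
        _ ≤ _ := by
          rw [N2_const_mul, ← this]
          gcongr
          refine uN.trans ?_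
          rw [norm_el]
          exact Finset.sum_le_sum fun j _ => N2_mono (Fz_le h K0 z j)
    · intro g hg j
      have hg' : Ts Ω g := hg.mono (Metric.ball_subset_ball (by linarith [h.r0]))
      have t : ∀ k, Ts Ω ((Pi.single j g : ι → E → ℂ) k) := fun k => by
        by_cases hk : k = j
        · subst hk; simpa using hg'
        · rw [Pi.single_eq_of_ne hk]; exact Ts.zero Ω
      have := hu _ t
      have z1 : l (Pi.single j g) = ∫ x, V b (c j) z x * g x := by
        simp only [l]
        rw [Finset.sum_eq_single j (fun k _ hk => by simp [hk]) (by simp)]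
        simp
      rw [← z1, this]
      refine integral_congr_ae (.of_forall fun x => ?_)
      dsimp only [A]
      rw [Finset.sum_eq_single j (fun k _ hk => by simp [hk, Pt, D_const]) (by simp), Pi.single_eq_same]
      by_cases hx : x ∈ Metric.ball (0:E) (r / 2)
      · rw [indicator_of_mem hx]; ring
      · rw [(hg.Pt (h.geo.csm j)).zero_of hx]; simp
end sol
end NN

namespace NN
open MeasureTheory Filter Topology Set
open scoped ContDiff ComplexConjugate ENNReal

section sq
set_option linter.unusedSectionVars false
variable {E : Type*} [NormedAddCommGroup E] [InnerProductSpace ℝ E] [FiniteDimensional ℝ E]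
variable {F F' G : Type*} [NormedAddCommGroup F] [NormedSpace ℝ F] [NormedAddCommGroup F'] [NormedSpace ℝ F'] [NormedAddCommGroup G] [NormedSpace ℝ G]

structure Bd (f : ℕ → E → F) : Prop where
  sm : ∀ i, ContDiff ℝ ∞ (f i)
  bd : ∀ m, ∃ C : ℝ, ∀ i x, ‖iteratedFDeriv ℝ m (f i) x‖ ≤ C

structure Z (f : ℕ → E → F) : Prop where
  sm : ∀ i, ContDiff ℝ ∞ (f i)
  z : ∀ m, ∃ C : ℕ → ℝ, Tendsto C atTop (𝓝 0) ∧ ∀ i x, ‖iteratedFDeriv ℝ m (f i) x‖ ≤ C i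

theorem Z.Bd {f : ℕ → E → F} (h : Z f) : Bd f := ⟨h.sm, fun m => by
  obtain ⟨C, hC, hb⟩ := h.z m
  obtain ⟨K, hK⟩ := hC.bddAbove_range
  exact ⟨K, fun i x => (hb i x).trans (hK ⟨i, rfl⟩)⟩⟩

theorem sm_at {f : E → F} (h : ContDiff ℝ ∞ f) (m : ℕ) (x : E) : ContDiffAt ℝ m f x := (h.of_le (by exact_mod_cast le_top)).contDiffAt

theorem Z.add {f g : ℕ → E → F} (hf : Z f) (hg : Z g) : Z fun i x => f i x + g i x := by
  refine ⟨fun i => (hf.sm i).add (hg.sm i), fun m => ?_⟩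
  obtain ⟨C, hC, h1⟩ := hf.z m
  obtain ⟨C', hC', h2⟩ := hg.z m
  refine ⟨fun i => C i + C' i, by simpa using hC.add hC', fun i x => ?_⟩
  rw [fun_iteratedFDeriv_add_apply (sm_at (hf.sm i) m x) (sm_at (hg.sm i) m x)]
  exact norm_add_le_of_le (h1 i x) (h2 i x)

theorem Bd.add {f g : ℕ → E → F} (hf : Bd f) (hg : Bd g) : Bd fun i x => f i x + g i x := by
  refine ⟨fun i => (hf.sm i).add (hg.sm i), fun m => ?_⟩
  obtain ⟨C, h1⟩ := hf.bd m
  obtain ⟨C', h2⟩ := hg.bd m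
  refine ⟨C + C', fun i x => ?_⟩
  rw [fun_iteratedFDeriv_add_apply (sm_at (hf.sm i) m x) (sm_at (hg.sm i) m x)]
  exact norm_add_le_of_le (h1 i x) (h2 i x)

theorem clm_le (T : F →L[ℝ] G) {f : E → F} (hf : ContDiff ℝ ∞ f) (m : ℕ) (x : E) :
    ‖iteratedFDeriv ℝ m (fun y => T (f y)) x‖ ≤ ‖T‖ * ‖iteratedFDeriv ℝ m f x‖ :=
  T.norm_iteratedFDeriv_comp_left (sm_at hf m x) le_rfl

theorem Z.clm {f : ℕ → E → F} (T : F →L[ℝ] G) (hf : Z f) : Z fun i x => T (f i x) := by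
  refine ⟨fun i => T.contDiff.comp (hf.sm i), fun m => ?_⟩
  obtain ⟨C, hC, h1⟩ := hf.z m
  exact ⟨fun i => ‖T‖ * C i, by simpa using hC.const_mul ‖T‖, fun i x => (clm_le T (hf.sm i) m x).trans (mul_le_mul_of_nonneg_left (h1 i x) (norm_nonneg _))⟩

theorem Bd.clm {f : ℕ → E → F} (T : F →L[ℝ] G) (hf : Bd f) : Bd fun i x => T (f i x) := by
  refine ⟨fun i => T.contDiff.comp (hf.sm i), fun m => ?_⟩
  obtain ⟨C, h1⟩ := hf.bd m
  exact ⟨‖T‖ * C, fun i x => (clm_le T (hf.sm i) m x).trans (mul_le_mul_of_nonneg_left (h1 i x) (norm_nonneg _))⟩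

theorem Z.fd {f : ℕ → E → F} (hf : Z f) : Z fun i => fderiv ℝ (f i) := by
  refine ⟨fun i => (hf.sm i).fderiv_right (by simp), fun m => ?_⟩
  obtain ⟨C, hC, h1⟩ := hf.z (m + 1)
  exact ⟨C, hC, fun i x => by rw [norm_iteratedFDeriv_fderiv]; exact h1 i x⟩

theorem Bd.fd {f : ℕ → E → F} (hf : Bd f) : Bd fun i => fderiv ℝ (f i) := by
  refine ⟨fun i => (hf.sm i).fderiv_right (by simp), fun m => ?_⟩
  obtain ⟨C, h1⟩ := hf.bd (m + 1)
  exact ⟨C, fun i x => by rw [norm_iteratedFDeriv_fderiv]; exact h1 i x⟩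

theorem bil_le (T : F →L[ℝ] F' →L[ℝ] G) {f : E → F} {g : E → F'} (hf : ContDiff ℝ ∞ f) (hg : ContDiff ℝ ∞ g) (m : ℕ) (x : E) :
    ‖iteratedFDeriv ℝ m (fun y => T (f y) (g y)) x‖ ≤ ‖T‖ * ∑ k ∈ Finset.range (m + 1), (m.choose k : ℝ) * ‖iteratedFDeriv ℝ k f x‖ * ‖iteratedFDeriv ℝ (m - k) g x‖ :=
  T.norm_iteratedFDeriv_le_of_bilinear hf hg x (by exact_mod_cast le_top)

theorem Bd.bil {f : ℕ → E → F} {g : ℕ → E → F'} (T : F →L[ℝ] F' →L[ℝ] G) (hf : Bd f) (hg : Bd g) : Bd fun i x => T (f i x) (g i x) := by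
  refine ⟨fun i => (T.contDiff.comp (hf.sm i)).clm_apply (hg.sm i), fun m => ?_⟩
  choose C h1 using hf.bd
  choose C' h2 using hg.bd
  refine ⟨‖T‖ * ∑ k ∈ Finset.range (m + 1), (m.choose k : ℝ) * C k * C' (m - k), fun i x => (bil_le T (hf.sm i) (hg.sm i) m x).trans ?_⟩
  have := fun k => (norm_nonneg _).trans (h1 k i x)
  refine mul_le_mul_of_nonneg_left (Finset.sum_le_sum fun k _ => mul_le_mul (mul_le_mul_of_nonneg_left (h1 _ i x) (by positivity)) (h2 _ i x) (norm_nonneg _) (mul_nonneg (by positivity) (this k))) (by positivity)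

theorem Z.bil {f : ℕ → E → F} {g : ℕ → E → F'} (T : F →L[ℝ] F' →L[ℝ] G) (hf : Z f) (hg : NN.Bd g) : Z fun i x => T (f i x) (g i x) := by
  refine ⟨fun i => (T.contDiff.comp (hf.sm i)).clm_apply (hg.sm i), fun m => ?_⟩
  choose C hC h1 using hf.z
  choose C' h2 using hg.bd
  refine ⟨fun i => ‖T‖ * ∑ k ∈ Finset.range (m + 1), (m.choose k : ℝ) * C k i * C' (m - k), ?_, fun i x => (bil_le T (hf.sm i) (hg.sm i) m x).trans ?_⟩
  · have : Tendsto (fun i => ‖T‖ * ∑ k ∈ Finset.range (m + 1), (m.choose k : ℝ) * C k i * C' (m - k)) atTop (𝓝 (‖T‖ * ∑ k ∈ Finset.range (m + 1), (m.choose k : ℝ) * 0 * C' (m - k))) :=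
      (tendsto_finsetSum _ fun k _ => ((hC k).const_mul _).mul_const _).const_mul _
    simpa using this
  · have := fun k => (norm_nonneg _).trans (h1 k i x)
    refine mul_le_mul_of_nonneg_left (Finset.sum_le_sum fun k _ => mul_le_mul (mul_le_mul_of_nonneg_left (h1 _ i x) (by positivity)) (h2 _ i x) (norm_nonneg _) (mul_nonneg (by positivity) (this k))) (by positivity)

theorem Z.neg {f : ℕ → E → F} (h : Z f) : Z fun i x => - f i x := h.clm (-ContinuousLinearMap.id ℝ F)
theorem Bd.neg {f : ℕ → E → F} (h : Bd f) : Bd fun i x => - f i x := h.clm (-ContinuousLinearMap.id ℝ F)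
theorem Z.sub {f g : ℕ → E → F} (hf : Z f) (hg : Z g) : Z fun i x => f i x - g i x := by simpa only [sub_eq_add_neg] using hf.add hg.neg
theorem Bd.sub {f g : ℕ → E → F} (hf : Bd f) (hg : Bd g) : Bd fun i x => f i x - g i x := by simpa only [sub_eq_add_neg] using hf.add hg.neg
theorem Bd.const (a : F) : Bd fun (_ : ℕ) (_ : E) => a := ⟨fun _ => contDiff_const, fun m => by
  rcases m with _ | m
  · exact ⟨‖a‖, fun _ _ => by simp⟩
  · exact ⟨0, fun _ _ => by rw [iteratedFDeriv_succ_const]; simp⟩⟩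
theorem Bd.cs {f : E → F} (hf : ContDiff ℝ ∞ f) (h : HasCompactSupport f) : Bd fun (_ : ℕ) => f := ⟨fun _ => hf, fun m => by
  obtain ⟨C, hC⟩ := (hf.continuous_iteratedFDeriv (m := m) (by exact_mod_cast le_top)).bounded_above_of_compact_support (h.iteratedFDeriv m)
  exact ⟨C, fun _ => hC⟩⟩
theorem Z.zero : Z fun (_ : ℕ) (_ : E) => (0 : F) := ⟨fun _ => contDiff_const, fun _ => ⟨0, tendsto_const_nhds, fun _ _ => by
  simp [iteratedFDeriv_fun_zero]⟩⟩

variable {f g : ℕ → E → ℂ}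
theorem Bd.mul (hf : Bd f) (hg : Bd g) : Bd fun i x => f i x * g i x := Bd.bil (ContinuousLinearMap.mul ℝ ℂ) hf hg
theorem Z.mul (hf : Z f) (hg : NN.Bd g) : Z fun i x => f i x * g i x := Z.bil (ContinuousLinearMap.mul ℝ ℂ) hf hg
theorem Z.mul' (hf : NN.Bd f) (hg : Z g) : Z fun i x => f i x * g i x := by simpa only [mul_comm] using hg.mul hf
theorem Bd.D (e : E) (hf : Bd f) : Bd fun i => D e (f i) := hf.fd.clm (ContinuousLinearMap.apply ℝ ℂ e)
theorem Z.D (e : E) (hf : Z f) : Z fun i => D e (f i) := hf.fd.clm (ContinuousLinearMap.apply ℝ ℂ e)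
theorem Bd.conj (hf : Bd f) : Bd fun i x => conj (f i x) := hf.clm (Complex.conjCLE : ℂ →L[ℝ] ℂ)
theorem Z.conj (hf : Z f) : Z fun i x => conj (f i x) := hf.clm (Complex.conjCLE : ℂ →L[ℝ] ℂ)
theorem Bd.sum {κ : Type*} {s : Finset κ} {f : κ → ℕ → E → ℂ} (h : ∀ k, Bd (f k)) : Bd fun i x => ∑ k ∈ s, f k i x := by
  classical
  induction s using Finset.induction_on with
  | empty => simpa using Z.zero.Bd
  | insert a s ha ih => simp only [Finset.sum_insert ha]; exact (h a).add ih
theorem Z.sum {κ : Type*} {s : Finset κ} {f : κ → ℕ → E → ℂ} (h : ∀ k, Z (f k)) : Z fun i x => ∑ k ∈ s, f k i x := by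
  classical
  induction s using Finset.induction_on with
  | empty => simpa using Z.zero
  | insert a s ha ih => simp only [Finset.sum_insert ha]; exact (h a).add ih
theorem Bd.b0 {f : ℕ → E → F} (hf : Bd f) : ∃ C, ∀ i x, ‖f i x‖ ≤ C := by simpa using hf.bd 0
theorem Z.z0 {f : ℕ → E → F} (hf : Z f) : ∃ C : ℕ → ℝ, Tendsto C atTop (𝓝 0) ∧ ∀ i x, ‖f i x‖ ≤ C i := by simpa using hf.z 0
theorem Z.ev {f : ℕ → E → F} (hf : Z f) {ε : ℝ} (h : 0 < ε) : ∀ᶠ i in atTop, ∀ x, ‖f i x‖ ≤ ε := by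
  obtain ⟨C, hC, h1⟩ := hf.z0
  filter_upwards [hC.eventually_le_const h] with i hi x using (h1 i x).trans hi
theorem Bd.sh {f : ℕ → E → F} (hf : Bd f) (N : ℕ) : Bd fun i => f (i + N) := ⟨fun _ => hf.sm _, fun m => let ⟨C, h⟩ := hf.bd m; ⟨C, fun _ => h _⟩⟩
theorem Z.sh {f : ℕ → E → F} (hf : Z f) (N : ℕ) : Z fun i => f (i + N) := ⟨fun _ => hf.sm _, fun m => let ⟨C, hC, h⟩ := hf.z m; ⟨fun i => C (i + N), hC.comp (tendsto_add_atTop_nat N), fun _ => h _⟩⟩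
end sq
end NN

namespace NN
open MeasureTheory Filter Topology Set
open scoped ContDiff ComplexConjugate ENNReal

section reg
set_option linter.unusedSectionVars false
variable {E : Type*} [NormedAddCommGroup E] [InnerProductSpace ℝ E] [FiniteDimensional ℝ E] [MeasurableSpace E] [BorelSpace E]
variable {α ι : Type*} [Fintype α] [Fintype ι] {b : α → E} {r r' : ℝ}

theorem csi {f g : E → ℂ} (hf : MemLp f 2) (hg : MemLp g 2) : ‖∫ x, f x * g x‖ₑ ^ 2 ≤ N2 f * N2 g := by
  rw [N2_eq, N2_eq, ← mul_pow]
  refine pow_le_pow_left' ((enorm_integral_le_lintegral_enorm _).trans ?_) 2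
  have := eLpNorm_smul_le_mul_eLpNorm (p := 2) (q := 2) (r := 1) hg.1 hf.1
  rwa [eLpNorm_one_eq_lintegral_enorm] at this

theorem W1 {c : ι → α → E → ℂ} {Λ : ℝ} (hcs : ∀ j a, Sm (c j a)) (hΛ : ∀ j a x, ‖fderiv ℝ (c j a) x‖ ≤ Λ)
    (hEl : ∀ w, Ts univ w → ∑ a, N2 (D (b a) w) ≤ 16 * ∑ j, N2 (V b (c j) w)) {v : E → ℂ} {h : ι → E → ℂ}
    (vm : Measurable v) (vl : MemLp v 2) (vc : HasCompactSupport v) (hm : ∀ j, Measurable (h j)) (hl : ∀ j, MemLp (h j) 2)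
    (eq : ∀ g, Ts univ g → ∀ j, ∫ x, v x * Pt b (c j) g x = ∫ x, h j x * g x) (a : α) :
    ∃ w, Measurable w ∧ MemLp w 2 ∧ N2 w ≤ 16 * ∑ j, N2 (h j) ∧ ∀ g, Ts univ g → ∫ x, v x * D (b a) g x = - ∫ x, w x * g x := by
  set S := 16 * ∑ j, N2 (h j)
  have hS : S ≠ ⊤ := by
    have := fun j => (N2_lt (hl j)).ne
    simp [S, ENNReal.mul_eq_top, this]
  have hC : ENNReal.ofReal (√ S.toReal) ^ 2 = S := by
    rw [← ENNReal.ofReal_pow (by positivity), Real.sq_sqrt (by positivity), ENNReal.ofReal_toReal hS]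
  have key : ∀ g, Ts univ g → ‖∫ x, v x * D (b a) g x‖ₑ ^ 2 ≤ S * N2 g := fun g hg => by
    have ev : ∀ᶠ ν in atTop, Ts univ (R ν v) := R_ts vl vc isOpen_univ (subset_univ _)
    have fr : ∀ j, L2T (fun ν => V b (c j) (R ν v)) (h j) := fun j => by
      have := FR1 (ι := Unit) (b := b) (v := fun _ => v) (C := fun _ => c j) (fun _ => vm) (fun _ => vl) (hm j) (hl j) (fun _ => hcs j) (fun _ => hΛ j) (by simpa using fun g hg => eq g hg j)
      simpa using this
    have l1 : Tendsto (fun ν => (16 * ∑ j, N2 (V b (c j) (R ν v))) * N2 g) atTop (𝓝 (S * N2 g)) :=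
      ENNReal.Tendsto.mul_const (ENNReal.Tendsto.const_mul (tendsto_finsetSum _ fun j _ => (fr j).lim) (.inr (by simp))) (.inr (N2_lt (hg.lp 2)).ne)
    have l2 : Tendsto (fun ν => ‖∫ x, R ν v x * D (b a) g x‖ₑ ^ 2) atTop (𝓝 (‖∫ x, v x * D (b a) g x‖ₑ ^ 2)) := by
      refine ((ENNReal.continuous_pow 2).tendsto _).comp ((continuous_enorm.tendsto _).comp ?_)
      rw [tendsto_iff_edist_tendsto_0]
      have h2 : Tendsto (fun ν => edist (∫ x, R ν v x * D (b a) g x) (∫ x, v x * D (b a) g x) ^ 2) atTop (𝓝 0) := by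
        have := ENNReal.Tendsto.mul_const (b := N2 (D (b a) g)) (R_L2T vm vl).t (.inr (N2_lt ((hg.D _).lp 2)).ne)
        rw [zero_mul] at this
        refine tendsto_of_tendsto_of_tendsto_of_le_of_le' tendsto_const_nhds this (.of_forall fun _ => zero_le) ?_
        filter_upwards [ev] with ν hν
        rw [edist_eq_enorm_sub, ← integral_sub (iT (hν.lp 2) (hg.D _)) (iT vl (hg.D _))]
        simp only [← sub_mul]
        exact csi ((hν.lp 2).sub vl) ((hg.D _).lp 2)
      rw [ENNReal.tendsto_nhds_zero] at h2 ⊢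
      exact fun ε h => (h2 (ε ^ 2) (ENNReal.pow_pos h 2)).mono fun ν hν => (ENNReal.pow_le_pow_left_iff two_ne_zero).1 hν
    refine le_of_tendsto_of_tendsto l2 l1 ?_
    filter_upwards [ev] with ν hν
    have := ibp hν.sm hg (b a)
    rw [← enorm_neg, ← this]
    refine (csi ((hν.D _).lp 2) (hg.lp 2)).trans (mul_le_mul_left ((Finset.single_le_sum (f := fun a => N2 (D (b a) (R ν v))) (fun _ _ => zero_le) (Finset.mem_univ a)).trans (hEl _ hν)) _)
  have R := riesz2 (κ := Unit) (O := (univ : Set E)) (fun G => G ()) (fun G => - ∫ x, v x * D (b a) (G ()) x) (C := √ S.toReal) (fun G hG => (hG ()).lp 2) (fun _ _ _ _ => rfl) (fun _ _ _ => rfl) ?_ ?_ (by positivity) ?_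
  rotate_left
  · intro G G' hG hG'
    have : ∀ x, D (b a) ((G + G') ()) x = D (b a) (G ()) x + D (b a) (G' ()) x := fun x => D_add ((hG ()).sm.da x) ((hG' ()).sm.da x) _
    simp only [this, mul_add]
    rw [integral_add (iT vl ((hG ()).D _)) (iT vl ((hG' ()).D _))]; ring
  · intro t G hG
    have : ∀ x, D (b a) ((t • G) ()) x = t * D (b a) (G ()) x := fun x => by
      have := D_mul (u := fun _ => t) (e := b a) (by fun_prop) ((hG ()).sm.da x)
      simp only [D_const, zero_mul, zero_add] at this; exact this
    simp only [this, mul_left_comm _ t, integral_const_mul, smul_eq_mul, mul_neg]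
  · intro G hG
    rw [ofReal_norm, enorm_neg, hC]
    exact key _ (hG ())
  obtain ⟨w, wm, wl, wn, hw⟩ := R
  exact ⟨w, wm, wl, hC ▸ wn, fun g hg => by rw [← hw (fun _ => g) (fun _ => hg)]; simp⟩
end reg
end NN

namespace NN
open MeasureTheory Filter Topology Set
open scoped ContDiff ComplexConjugate ENNReal

section reg
set_option linter.unusedSectionVars false
variable {E : Type*} [NormedAddCommGroup E] [InnerProductSpace ℝ E] [FiniteDimensional ℝ E] [MeasurableSpace E] [BorelSpace E]
variable {α ι : Type*} [Fintype α] [Fintype ι] {b : α → E} {r r' : ℝ}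

theorem cut (h0 : 0 < r') (h : r' < r) : ∃ χ : E → ℂ, Ts (Metric.ball 0 r) χ ∧ ∀ x ∈ Metric.ball (0:E) r', χ x = 1 := by
  have hd : 0 < r ^ 2 - r' ^ 2 := by nlinarith
  refine ⟨fs r (ct (1 / (2 * (r ^ 2 - r' ^ 2)))), fs_ts (h0.trans h) (ct_sm _) (t₀ := (r ^ 2 - r' ^ 2) / 2) (by positivity) fun t ht => ct_zero ?_, fun x hx => ?_⟩
  · rw [div_mul_eq_mul_div, div_le_iff₀ (by positivity)]; linarith
  · rw [fs, ct_one]; · simp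
    rw [mem_ball_zero_iff] at hx
    rw [div_mul_eq_mul_div, le_div_iff₀ (by positivity), sR]
    nlinarith [norm_nonneg x]

structure S0 (u : ℕ → E → ℂ) : Prop where
  m : ∀ i, Measurable (u i)
  l : ∀ i, MemLp (u i) 2
  t : Tendsto (fun i => N2 (u i)) atTop (𝓝 0)

theorem S0.add {u v : ℕ → E → ℂ} (hu : S0 u) (hv : S0 v) : S0 fun i x => u i x + v i x := by
  refine ⟨fun i => (hu.m i).add (hv.m i), fun i => (hu.l i).add (hv.l i), ?_⟩
  have := ENNReal.Tendsto.const_mul (a := 2) (hu.t.add hv.t) (by simp)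
  simp only [add_zero, mul_zero] at this
  exact tendsto_of_tendsto_of_tendsto_of_le_of_le tendsto_const_nhds this (fun _ => zero_le) fun i => N2_add (hu.m i).aestronglyMeasurable

theorem S0.mul {u φ : ℕ → E → ℂ} (hφ : Bd φ) (hu : S0 u) : S0 fun i x => φ i x * u i x := by
  obtain ⟨C, hC⟩ := hφ.b0
  have hm := fun i => (hφ.sm i).continuous.measurable
  refine ⟨fun i => (hm i).mul (hu.m i), fun i => mlb (hm i) (hC i) (hu.l i), ?_⟩
  have := ENNReal.Tendsto.const_mul (a := ‖(C : ℂ)‖ₑ ^ 2) hu.t (.inr (by finiteness))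
  rw [mul_zero] at this
  refine tendsto_of_tendsto_of_tendsto_of_le_of_le tendsto_const_nhds this (fun _ => zero_le) fun i => ?_
  rw [← N2_const_mul]
  refine N2_mono fun x => ?_
  rw [norm_mul, norm_mul, Complex.norm_real]
  exact mul_le_mul_of_nonneg_right ((hC i x).trans (le_abs_self C)) (norm_nonneg _)

theorem S0.zero : S0 fun (_ : ℕ) (_ : E) => (0 : ℂ) := ⟨fun _ => measurable_const, fun _ => MemLp.zero, by simp [N2]⟩

def WD (b : α → E) (r : ℝ) (a : α) (u v : ℕ → E → ℂ) : Prop :=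
  ∀ i g, Ts (Metric.ball 0 r) g → ∫ x, u i x * D (b a) g x = - ∫ x, v i x * g x

def SH (b : α → E) : ℕ → ℝ → (ℕ → E → ℂ) → Prop
  | 0, _, u => S0 u
  | m + 1, r, u => S0 u ∧ ∀ a, ∃ v, WD b r a u v ∧ SH b m r v

theorem SH.s0 : ∀ {m : ℕ} {u : ℕ → E → ℂ}, SH b m r u → S0 u
  | 0, _, h => h
  | _ + 1, _, h => h.1

theorem SH.down : ∀ {m : ℕ} {u : ℕ → E → ℂ}, SH b (m + 1) r u → SH b m r u
  | 0, _, h => h.1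
  | _ + 1, _, h => ⟨h.1, fun a => let ⟨v, h1, h2⟩ := h.2 a; ⟨v, h1, h2.down⟩⟩

theorem SH.rm (hr : r' ≤ r) : ∀ {m : ℕ} {u : ℕ → E → ℂ}, SH b m r u → SH b m r' u
  | 0, _, h => h
  | _ + 1, _, h => ⟨h.1, fun a => let ⟨v, h1, h2⟩ := h.2 a; ⟨v, fun i g hg => h1 i g (hg.mono (Metric.ball_subset_ball hr)), h2.rm hr⟩⟩

theorem SH.add : ∀ {m : ℕ} {u v : ℕ → E → ℂ}, SH b m r u → SH b m r v → SH b m r fun i x => u i x + v i x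
  | 0, _, _, hu, hv => S0.add hu hv
  | m + 1, u, v, hu, hv => ⟨hu.1.add hv.1, fun a => by
    obtain ⟨u', h1, h2⟩ := hu.2 a
    obtain ⟨v', h3, h4⟩ := hv.2 a
    refine ⟨_, fun i g hg => ?_, h2.add h4⟩
    simp only [add_mul]
    rw [integral_add (iT (hu.1.l i) (hg.D _)) (iT (hv.1.l i) (hg.D _)), integral_add (iT (h2.s0.l i) hg) (iT (h4.s0.l i) hg), h1 i g hg, h3 i g hg]; ring⟩

theorem SH.mul {φ : ℕ → E → ℂ} (hφ : Bd φ) : ∀ {m : ℕ} {u : ℕ → E → ℂ}, SH b m r u → SH b m r fun i x => φ i x * u i x := by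
  intro m
  induction m generalizing φ with
  | zero => exact fun hu => S0.mul hφ hu
  | succ m ih =>
    refine fun {u} hu => ⟨hu.1.mul hφ, fun a => ?_⟩
    obtain ⟨u', h1, h2⟩ := hu.2 a
    refine ⟨_, fun i g hg => ?_, (ih hφ h2).add (ih (hφ.D (b a)) hu.down)⟩
    have e := h1 i _ (hg.mul (hφ.sm i))
    have e2 : ∀ x, φ i x * u i x * D (b a) g x = u i x * D (b a) (fun y => φ i y * g y) x - u i x * (D (b a) (φ i) x * g x) := fun x => by
      rw [D_mul (Sm.da (hφ.sm i) x) (hg.sm.da x)]; ring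
    have i2 := iT (hu.1.l i) (hg.mul (Sm.D (hφ.sm i) (b a)))
    have i3 := iT (h2.s0.l i) (hg.mul (hφ.sm i))
    simp only [e2, add_mul]
    rw [integral_sub (iT (hu.1.l i) ((hg.mul (hφ.sm i)).D _)) i2, e, integral_add]
    · rw [neg_add, sub_eq_add_neg]; congr 3 <;> ext x <;> ring
    · exact i3.congr (.of_forall fun x => by ring)
    · exact i2.congr (.of_forall fun x => by ring)

theorem SH.zero : ∀ {m : ℕ}, SH b m r fun (_ : ℕ) (_ : E) => (0 : ℂ)
  | 0 => S0.zero
  | _ + 1 => ⟨S0.zero, fun _ => ⟨_, fun i g hg => by simp, SH.zero⟩⟩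

theorem SH.sum {κ : Type*} {s : Finset κ} {m : ℕ} {f : κ → ℕ → E → ℂ} (h : ∀ k, SH b m r (f k)) : SH b m r fun i x => ∑ k ∈ s, f k i x := by
  classical
  induction s using Finset.induction_on with
  | empty => simpa using SH.zero
  | insert a s ha ih => simp only [Finset.sum_insert ha]; exact (h a).add ih

theorem SH.sub {m : ℕ} {u v : ℕ → E → ℂ} (hu : SH b m r u) (hv : SH b m r v) : SH b m r fun i x => u i x - v i x := by
  have := hu.add (hv.mul (Bd.const (-1)))
  simpa [sub_eq_add_neg] using this

theorem Z.SH {ρ : ℝ} : ∀ {m : ℕ} {f : ℕ → E → ℂ} (_ : Z f) (_ : ∀ i, ∀ x ∉ Metric.closedBall (0:E) ρ, f i x = 0), NN.SH b m r f := by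
  have h0 : ∀ {f : ℕ → E → ℂ} (_ : Z f) (_ : ∀ i, ∀ x ∉ Metric.closedBall (0:E) ρ, f i x = 0), S0 f := fun {f} hf hs => by
    have hK : MeasurableSet (Metric.closedBall (0:E) ρ) := measurableSet_closedBall
    have hI : MemLp ((Metric.closedBall (0:E) ρ).indicator fun _ => (1:ℂ)) 2 := memLp_indicator_const 2 hK 1 (.inr measure_closedBall_lt_top.ne)
    obtain ⟨C, hC, h1⟩ := hf.z0
    have e : ∀ i, f i = fun x => f i x * (Metric.closedBall (0:E) ρ).indicator (fun _ => 1) x := fun i => by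
      ext x; by_cases hx : x ∈ Metric.closedBall (0:E) ρ <;> simp [hx, hs i x]
    refine ⟨fun i => (hf.sm i).continuous.measurable, fun i => ?_, ?_⟩
    · rw [e i]; exact mlb (hf.sm i).continuous.measurable (h1 i) hI
    · have : Tendsto (fun i => ‖(C i : ℂ)‖ₑ ^ 2 * N2 ((Metric.closedBall (0:E) ρ).indicator fun _ => (1:ℂ))) atTop (𝓝 (‖((0:ℝ) : ℂ)‖ₑ ^ 2 * N2 ((Metric.closedBall (0:E) ρ).indicator fun _ => (1:ℂ)))) :=
        ENNReal.Tendsto.mul_const (((ENNReal.continuous_pow 2).tendsto _).comp ((continuous_enorm.tendsto _).comp ((Complex.continuous_ofReal.tendsto _).comp hC))) (.inr (N2_lt hI).ne)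
      simp only [Complex.ofReal_zero, enorm_zero, ne_eq, OfNat.ofNat_ne_zero, not_false_eq_true, zero_pow, zero_mul] at this
      refine tendsto_of_tendsto_of_tendsto_of_le_of_le tendsto_const_nhds this (fun _ => zero_le) fun i => ?_
      rw [← N2_const_mul, e i]
      refine N2_mono fun x => ?_
      rw [norm_mul, norm_mul, Complex.norm_real]
      exact mul_le_mul_of_nonneg_right ((h1 i x).trans (le_abs_self _)) (norm_nonneg _)
  intro m
  induction m with
  | zero => exact h0
  | succ m ih =>
    refine fun {f} hf hs => ⟨h0 hf hs, fun a => ⟨_, fun i g hg => ?_, ih (hf.D (b a)) fun i x hx => ?_⟩⟩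
    · rw [ibp (hf.sm i) hg, neg_neg]
    · rw [D_congr Metric.isClosed_closedBall.isOpen_compl (hs i) hx, D_const]

variable {c : ℕ → ι → α → E → ℂ}

theorem reg0 (hb : ∀ j a, Bd fun i => c i j a) (hEl : ∀ i w, Ts univ w → ∑ a, N2 (D (b a) w) ≤ 16 * ∑ j, N2 (V b (c i j) w))
    (h0 : 0 < r') (h : r' < r) {u : ℕ → E → ℂ} {f : ι → ℕ → E → ℂ} (hu : S0 u) (hf : ∀ j, S0 (f j))
    (eq : ∀ i g, Ts (Metric.ball 0 r) g → ∀ j, ∫ x, u i x * Pt b (c i j) g x = ∫ x, f j i x * g x) : SH b 1 r' u := by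
  obtain ⟨χ, hχ, h1⟩ := cut (E := E) h0 h
  have Bχ : Bd fun (_ : ℕ) => χ := .cs hχ.sm hχ.cs
  have hv : S0 fun i x => χ x * u i x := hu.mul Bχ
  have BV : ∀ j, Bd fun i => V b (c i j) χ := fun j => Bd.sum fun a => (hb j a).mul (Bχ.D (b a))
  have hh : ∀ j, S0 fun i x => χ x * f j i x + V b (c i j) χ x * u i x := fun j => ((hf j).mul Bχ).add (hu.mul (BV j))
  refine ⟨hu, fun a => ?_⟩
  have : ∀ i, ∃ w, Measurable w ∧ MemLp w 2 ∧ N2 w ≤ 16 * ∑ j, N2 (fun x => χ x * f j i x + V b (c i j) χ x * u i x) ∧ ∀ g, Ts univ g → ∫ x, χ x * u i x * D (b a) g x = - ∫ x, w x * g x := fun i => by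
    choose C hC using fun j a => (hb j a).fd.b0
    refine W1 (c := c i) (Λ := ∑ j, ∑ a, |C j a|) (fun j a => (hb j a).sm i) (fun j a x => (hC j a i x).trans ((le_abs_self _).trans ?_)) (hEl i) (hv.m i) (hv.l i) (hχ.cs.mul_right) (fun j => (hh j).m i) (fun j => (hh j).l i) (fun g hg j => ?_) a
    · exact (Finset.single_le_sum (f := fun a => |C j a|) (fun _ _ => abs_nonneg _) (Finset.mem_univ a)).trans
        (Finset.single_le_sum (f := fun j => ∑ a, |C j a|) (fun _ _ => Finset.sum_nonneg fun _ _ => abs_nonneg _) (Finset.mem_univ j))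
    · have hc := fun a => (hb j a).sm i
      have hg' := hχ.mul' hg.sm
      have hV : Ts (Metric.ball 0 r) (fun x => V b (c i j) χ x * g x) := (hχ.V hc).mul' hg.sm
      have e : ∀ x, χ x * u i x * Pt b (c i j) g x = u i x * Pt b (c i j) (fun y => χ y * g y) x + u i x * (V b (c i j) χ x * g x) := fun x => by
        rw [Pt_mul hc hχ.sm hg.sm]; ring
      simp only [e, add_mul]
      rw [integral_add (iT (hu.l i) (hg'.Pt hc)) (iT (hu.l i) hV), eq i _ hg', integral_add]
      · congr 2 <;> ext x <;> ring
      · exact (iT ((hf j).l i) hg').congr (.of_forall fun x => by ring)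
      · exact (iT (hu.l i) hV).congr (.of_forall fun x => by ring)
  choose w wm wl wn hw using this
  refine ⟨w, fun i g hg => ?_, wm, wl, ?_⟩
  · rw [← hw i g (hg.mono (subset_univ _))]
    refine integral_congr_ae (.of_forall fun x => ?_)
    by_cases hx : x ∈ Metric.ball (0:E) r'
    · simp [h1 x hx]
    · simp [(hg.D (b a)).zero_of hx]
  · have : Tendsto (fun i => 16 * ∑ j, N2 (fun x => χ x * f j i x + V b (c i j) χ x * u i x)) atTop (𝓝 (16 * ∑ j : ι, 0)) :=
      ENNReal.Tendsto.const_mul (tendsto_finsetSum _ fun j _ => (hh j).t) (.inr (by simp))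
    rw [Finset.sum_const_zero, mul_zero] at this
    exact tendsto_of_tendsto_of_tendsto_of_le_of_le tendsto_const_nhds this (fun _ => zero_le) wn

theorem reg (hb : ∀ j a, Bd fun i => c i j a) (hEl : ∀ i w, Ts univ w → ∑ a, N2 (D (b a) w) ≤ 16 * ∑ j, N2 (V b (c i j) w)) :
    ∀ (m : ℕ) {r r' : ℝ} (_ : 0 < r') (_ : r' < r) {u : ℕ → E → ℂ} {f : ι → ℕ → E → ℂ} (_ : S0 u) (_ : ∀ j, SH b m r (f j))
    (_ : ∀ i g, Ts (Metric.ball 0 r) g → ∀ j, ∫ x, u i x * Pt b (c i j) g x = ∫ x, f j i x * g x), SH b (m + 1) r' u := by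
  intro m
  induction m with
  | zero => intro r r' h0 h u f hu hf eq; exact reg0 hb hEl h0 h hu hf eq
  | succ m ih =>
    intro r r' h0 h u f hu hf eq
    obtain ⟨s, hs, hs'⟩ := exists_between h
    have H := ih (h0.trans hs) hs' hu (fun j => (hf j).down) eq
    choose v hv1 hv2 using H.2
    refine ⟨hu, fun a => ⟨v a, fun i g hg => hv1 a i g (hg.mono (Metric.ball_subset_ball hs.le)), ?_⟩⟩
    choose fa hfa hfs using fun j => (hf j).2 a
    refine ih h0 hs (hv2 a).s0 (f := fun j i x => fa j i x - ∑ e, D (b a) (c i j e) x * v e i x)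
      (fun j => ((hfs j).rm hs'.le).sub (SH.sum fun e => (hv2 e).mul ((hb j e).D (b a)))) fun i g hg j => ?_
    have hc := fun a => (hb j a).sm i
    have hdc : ∀ e, Ts (Metric.ball 0 s) (fun x => D (b a) (c i j e) x * g x) := fun e => hg.mul (Sm.D (hc e) _)
    have e1 := hv1 a i _ (hg.Pt (b := b) hc)
    have e2 : ∀ x, D (b a) (Pt b (c i j) g) x = Pt b (c i j) (D (b a) g) x - ∑ e, D (b e) (fun y => D (b a) (c i j e) y * g y) x := fun x => by
      have : D (b a) (Pt b (c i j) g) x = ∑ e, D (b a) (fun y => - D (b e) (fun z => c i j e z * g z) y) x :=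
        D_sum (u := fun e y => - D (b e) (fun z => c i j e z * g z) y) (fun e _ => Sm.da ((hg.mul (hc e)).D _).neg.sm x) (b a)
      rw [this, Pt, ← Finset.sum_sub_distrib]
      refine Finset.sum_congr rfl fun e _ => ?_
      rw [D_neg, D_comm (hg.mul (hc e)).sm]
      have : D (b a) (fun z => c i j e z * g z) = fun y => D (b a) (c i j e) y * g y + c i j e y * D (b a) g y := by
        ext y; rw [D_mul (Sm.da (hc e) y) (hg.sm.da y)]
      rw [this, D_add (Sm.da (hdc e).sm x) (Sm.da ((hg.D _).mul (hc e)).sm x)]; ring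
    have i1 := iT (hu.l i) ((hg.D (b a)).Pt (b := b) hc)
    have i2 := fun e => iT (hu.l i) ((hdc e).D (b e))
    have i3 := fun e => iT ((hv2 e).s0.l i) (hdc e)
    simp only [e2, mul_sub, Finset.mul_sum] at e1
    rw [integral_sub i1 (integrable_finsetSum _ fun e _ => i2 e), integral_finsetSum _ fun e _ => i2 e, eq i _ ((hg.D _).mono (Metric.ball_subset_ball hs'.le)),
      hfa j i g (hg.mono (Metric.ball_subset_ball hs'.le)), Finset.sum_congr rfl fun e _ => hv1 e i _ (hdc e)] at e1
    simp only [sub_mul, Finset.sum_mul]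
    have i4 : ∀ e, Integrable fun x => D (b a) (c i j e) x * v e i x * g x := fun e => (i3 e).congr (.of_forall fun x => by ring)
    rw [integral_sub (iT ((hfs j).s0.l i) hg) (integrable_finsetSum _ fun e _ => i4 e), integral_finsetSum _ fun e _ => i4 e]
    rw [Finset.sum_neg_distrib] at e1
    have : ∑ e, ∫ x, D (b a) (c i j e) x * v e i x * g x = ∑ e, ∫ x, v e i x * (D (b a) (c i j e) x * g x) :=
      Finset.sum_congr rfl fun e _ => by congr 1; ext x; ring
    rw [this]; linear_combination e1
end reg
end NN

namespace NN
open MeasureTheory Filter Topology Set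
open scoped ContDiff ComplexConjugate ENNReal FourierTransform

section sob
set_option linter.unusedSectionVars false
variable {E : Type*} [NormedAddCommGroup E] [InnerProductSpace ℝ E] [FiniteDimensional ℝ E] [MeasurableSpace E] [BorelSpace E]
variable {α : Type*} [Fintype α] {b : α → E} {r r' : ℝ}

def ek (ξ x : E) : ℂ := Complex.exp (((-2 * Real.pi * inner ℝ x ξ : ℝ) : ℂ) * Complex.I)
theorem ek_n (ξ x : E) : ‖ek ξ x‖ = 1 := Complex.norm_exp_ofReal_mul_I _
theorem ek_d (ξ x : E) : HasFDerivAt (ek ξ) (ek ξ x • ((Complex.I : ℂ) • Complex.ofRealCLM.comp ((-2 * Real.pi) • innerSL ℝ ξ))) x := by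
  have h1 : HasFDerivAt (fun x : E => (-2 * Real.pi * inner ℝ x ξ : ℝ)) ((-2 * Real.pi) • innerSL ℝ ξ) x := by
    have := (innerSL ℝ ξ).hasFDerivAt (x := x) |>.const_mul (-2 * Real.pi)
    simpa only [innerSL_apply_apply, real_inner_comm] using this
  have h2 := ((Complex.ofRealCLM.hasFDerivAt.comp x h1).mul_const Complex.I).cexp
  exact h2
theorem ek_D (ξ e x : E) : D e (ek ξ) x = -(2 * Real.pi * inner ℝ e ξ : ℝ) * Complex.I * ek ξ x := by
  rw [D, (ek_d ξ x).fderiv]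
  simp [real_inner_comm]; ring
theorem ek_sm (ξ : E) : Sm (ek ξ) :=
  ((Complex.ofRealCLM.contDiff.comp (contDiff_const.mul (contDiff_id.inner ℝ contDiff_const))).mul contDiff_const).cexp

theorem four (u χ : E → ℂ) (ξ : E) : 𝓕 (fun x => u x * χ x) ξ = ∫ x, u x * (χ x * ek ξ x) := by
  rw [Real.fourier_eq']
  exact integral_congr_ae (.of_forall fun x => by simp only [ek, smul_eq_mul]; ring)

theorem dec (hb : ∀ ξ, ‖ξ‖ ≤ ∑ a, |inner ℝ (b a) ξ|) : ∀ (m : ℕ) {u : ℕ → E → ℂ} {χ : E → ℂ} (_ : SH b m r u) (_ : Ts (Metric.ball 0 r) χ),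
    ∃ C : ℕ → ℝ, Tendsto C atTop (𝓝 0) ∧ ∀ i ξ, ‖ξ‖ ^ m * ‖∫ x, u i x * (χ x * ek ξ x)‖ ≤ C i := by
  intro m
  induction m with
  | zero =>
    intro u χ hu hχ
    have hu : S0 u := hu
    have hN := (N2_lt (hχ.lp 2)).ne
    refine ⟨fun i => √ (N2 (u i) * N2 χ).toReal, ?_, fun i ξ => ?_⟩
    · have h1 := ENNReal.Tendsto.mul_const (b := N2 χ) hu.t (.inr hN)
      rw [zero_mul] at h1
      have := (Real.continuous_sqrt.tendsto _).comp ((ENNReal.tendsto_toReal (by simp)).comp h1)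
      simpa [Function.comp_def] using this
    · have hx := hχ.mul' (ek_sm ξ)
      have h1 := csi (hu.l i) (hx.lp 2)
      have h2 : N2 (fun x => χ x * ek ξ x) = N2 χ := by simp [N2, enorm_mul, ← ofReal_norm, ek_n]
      rw [h2] at h1
      rw [pow_zero, one_mul]
      refine Real.le_sqrt_of_sq_le ?_
      have h3 := ENNReal.toReal_mono (ENNReal.mul_ne_top (N2_lt (hu.l i)).ne hN) h1
      simpa using h3
  | succ m ih =>
    intro u χ hu hχ
    choose v hv1 hv2 using hu.2
    choose C1 hC1 h1 using fun a => ih hu.down (hχ.D (b a))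
    choose C2 hC2 h2 using fun a => ih (hv2 a) hχ
    refine ⟨fun i => ∑ a, (C1 a i + C2 a i), ?_, fun i ξ => ?_⟩
    · have : Tendsto (fun i => ∑ a, (C1 a i + C2 a i)) atTop (𝓝 (∑ a : α, (0 + 0))) := tendsto_finsetSum _ fun a _ => (hC1 a).add (hC2 a)
      simpa using this
    · set I := ∫ x, u i x * (χ x * ek ξ x)
      have key : ∀ a, |inner ℝ (b a) ξ| * (‖ξ‖ ^ m * ‖I‖) ≤ C1 a i + C2 a i := fun a => by
        have e := hv1 a i _ (hχ.mul' (ek_sm ξ))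
        have i1 := iT (hu.1.l i) ((hχ.D (b a)).mul' (ek_sm ξ))
        have i2 := iT (hu.1.l i) (hχ.mul' (ek_sm ξ))
        have e2 : ∀ x, u i x * D (b a) (fun y => χ y * ek ξ y) x = u i x * (D (b a) χ x * ek ξ x) - (2 * Real.pi * inner ℝ (b a) ξ : ℝ) * Complex.I * (u i x * (χ x * ek ξ x)) := fun x => by
          rw [D_mul (hχ.sm.da x) (Sm.da (ek_sm ξ) x), ek_D]; ring
        simp only [e2] at e
        rw [integral_sub i1 (i2.const_mul _), integral_const_mul] at e
        have e3 : ((2 * Real.pi * inner ℝ (b a) ξ : ℝ) : ℂ) * Complex.I * I = (∫ x, u i x * (D (b a) χ x * ek ξ x)) + ∫ x, v a i x * (χ x * ek ξ x) := by linear_combination -e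
        have e4 := congrArg norm e3
        rw [norm_mul, norm_mul, Complex.norm_I, mul_one, Complex.norm_real, Real.norm_eq_abs, abs_mul, abs_of_pos Real.two_pi_pos] at e4
        have e5 := e4.le.trans (norm_add_le _ _)
        have p1 : (1:ℝ) ≤ 2 * Real.pi := by linarith [Real.pi_gt_three]
        have p2 : |inner ℝ (b a) ξ| * ‖I‖ ≤ 2 * Real.pi * |inner ℝ (b a) ξ| * ‖I‖ := by
          have : 0 ≤ |inner ℝ (b a) ξ| * ‖I‖ := by positivity
          nlinarith
        have p3 := mul_le_mul_of_nonneg_left (p2.trans e5) (pow_nonneg (norm_nonneg ξ) m)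
        linarith [h1 a i ξ, h2 a i ξ]
      calc ‖ξ‖ ^ (m + 1) * ‖I‖ = ‖ξ‖ * (‖ξ‖ ^ m * ‖I‖) := by ring
        _ ≤ (∑ a, |inner ℝ (b a) ξ|) * (‖ξ‖ ^ m * ‖I‖) := mul_le_mul_of_nonneg_right (hb ξ) (by positivity)
        _ ≤ _ := by rw [Finset.sum_mul]; exact Finset.sum_le_sum fun a _ => key a

theorem sob (hb : ∀ ξ, ‖ξ‖ ≤ ∑ a, |inner ℝ (b a) ξ|) (h0 : 0 < r') (hr : r' < r) {u : ℕ → E → ℂ} (hu : ∀ m, SH b m r u) :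
    ∃ w : ℕ → E → ℂ, Z w ∧ ∀ i g, Ts (Metric.ball 0 r') g → ∫ x, w i x * g x = ∫ x, u i x * g x := by
  obtain ⟨χ, hχ, h1⟩ := cut (E := E) h0 hr
  choose C hC hCb using fun m => dec hb m (hu m) hχ
  have hu0 : S0 u := hu 0
  have hi : ∀ i, Integrable fun x => u i x * χ x := fun i => iT (hu0.l i) hχ
  let G : ℕ → E → ℂ := fun i => 𝓕⁻ (fun x => u i x * χ x)
  have cF : ∀ {f : E → ℂ}, Integrable f → Continuous (𝓕 f) := fun {f} hf =>
    VectorFourier.fourierIntegral_continuous Real.continuous_fourierChar (by exact continuous_inner) hf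
  have hGe : ∀ i ξ, G i ξ = 𝓕 (fun x => u i x * χ x) (-ξ) := fun i ξ => Real.fourierInv_eq_fourier_neg _ _
  have hGc : ∀ i, Continuous (G i) := fun i => by
    have : G i = fun ξ => 𝓕 (fun x => u i x * χ x) (-ξ) := funext (hGe i)
    rw [this]; exact (cF (hi i)).comp continuous_neg
  have hGb : ∀ m i ξ, ‖ξ‖ ^ m * ‖G i ξ‖ ≤ C m i := fun m i ξ => by
    rw [hGe, four]; simpa using hCb m i (-ξ)
  set d := Module.finrank ℝ E
  let K : ℕ → ℕ → ℝ := fun k i => ∑ j ∈ Finset.range (d + 1 + 1), C (j + k) i * ((d + 1).choose j : ℝ)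
  have hK : ∀ k, Tendsto (K k) atTop (𝓝 0) := fun k => by
    have : Tendsto (K k) atTop (𝓝 (∑ j ∈ Finset.range (d + 1 + 1), 0 * ((d + 1).choose j : ℝ))) := tendsto_finsetSum _ fun j _ => (hC _).mul_const _
    simpa using this
  have hGK : ∀ k i ξ, ‖ξ‖ ^ k * ‖G i ξ‖ ≤ K k i * (1 + ‖ξ‖) ^ (-((d + 1 : ℕ) : ℝ)) := fun k i ξ => by
    rw [Real.rpow_neg (by positivity), Real.rpow_natCast, ← div_eq_mul_inv, le_div_iff₀ (by positivity), add_comm 1, add_pow, Finset.mul_sum]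
    refine Finset.sum_le_sum fun j _ => ?_
    rw [one_pow, mul_one, ← mul_assoc]
    refine mul_le_mul_of_nonneg_right ((le_of_eq ?_).trans (hGb (j + k) i ξ)) (by positivity)
    rw [pow_add]; ring
  have iB : Integrable fun ξ : E => (1 + ‖ξ‖) ^ (-((d + 1 : ℕ) : ℝ)) := integrable_one_add_norm (by push_cast; linarith)
  have iG : ∀ i (k : ℕ), Integrable fun ξ => ‖ξ‖ ^ k * ‖G i ξ‖ := fun i k =>
    (iB.const_mul (K k i)).mono' ((continuous_norm.pow k).mul (hGc i).norm).aestronglyMeasurable (.of_forall fun ξ => by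
      rw [Real.norm_of_nonneg (by positivity)]; exact hGK k i ξ)
  have iG0 : ∀ i, Integrable (G i) := fun i => (integrable_norm_iff (hGc i).aestronglyMeasurable).1 (by simpa using iG i 0)
  refine ⟨fun i => 𝓕 (G i), ⟨fun i => Real.contDiff_fourier (N := ⊤) fun k _ => iG i k, fun k => ?_⟩, fun i g hg => ?_⟩
  · refine ⟨fun i => (2 * Real.pi * ‖innerSL (E := E) ℝ‖) ^ k * (K k i * ∫ ξ : E, (1 + ‖ξ‖) ^ (-((d + 1 : ℕ) : ℝ))), by simpa using ((hK k).mul_const _).const_mul _, fun i x => ?_⟩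
    rw [Real.iteratedFDeriv_fourier (N := ⊤) (fun k _ => iG i k) (hGc i).aestronglyMeasurable (n := k) le_top]
    refine (VectorFourier.norm_fourierIntegral_le_integral_norm _ _ _ _ _).trans ?_
    beta_reduce
    rw [← integral_const_mul, ← integral_const_mul]
    refine integral_mono_of_nonneg (.of_forall fun _ => norm_nonneg _) ((iB.const_mul _).const_mul _) (.of_forall fun ξ => ?_)
    refine (VectorFourier.norm_fourierPowSMulRight_le _ _ _ _).trans ?_
    rw [mul_assoc]
    exact mul_le_mul_of_nonneg_left (hGK k i ξ) (by positivity)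
  · have gi := hg.int
    let s := hg.cs.toSchwartzMap hg.sm
    have hs : (s : E → ℂ) = g := rfl
    have fi : Integrable (𝓕 g) := (𝓕 s).integrable
    have inv : 𝓕⁻ (𝓕 g) = g := hg.sm.continuous.fourierInv_fourier_eq gi fi
    have sa : ∀ {f g : E → ℂ}, Integrable f → Integrable g → ∫ x, 𝓕 f x * g x = ∫ x, f x * 𝓕 g x := fun {f g} hf hg => by
      have := VectorFourier.integral_fourierIntegral_smul_eq_flip (L := innerₗ E) Real.continuous_fourierChar continuous_inner hf hg
      rw [flip_innerₗ] at this; exact this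
    rw [sa (iG0 i) gi]
    calc ∫ x, G i x * 𝓕 g x = ∫ x, G i (-x) * 𝓕 g (-x) := (integral_neg_eq_self (fun x => G i x * 𝓕 g x) volume).symm
      _ = ∫ x, 𝓕 (fun x => u i x * χ x) x * 𝓕 g (-x) := by simp only [hGe, neg_neg]
      _ = ∫ x, u i x * χ x * 𝓕⁻ (𝓕 g) x := by rw [sa (hi i) fi.comp_neg, Real.fourierInv_eq_fourier_comp_neg]
      _ = _ := by
        rw [inv]
        refine integral_congr_ae (.of_forall fun x => ?_)
        by_cases hx : x ∈ Metric.ball (0:E) r'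
        · simp [h1 x hx]
        · simp [hg.zero_of hx]
end sob
end NN

namespace NN
open MeasureTheory Filter Topology Set
open scoped ContDiff ComplexConjugate ENNReal

section el
set_option linter.unusedSectionVars false
variable {E : Type*} [NormedAddCommGroup E] [InnerProductSpace ℝ E] [FiniteDimensional ℝ E] [MeasurableSpace E] [BorelSpace E]
variable {ι : Type*} [Fintype ι] [DecidableEq ι] {b : ι × Bool → E} {c : ι → ι × Bool → E → ℂ}

def cst (j : ι) (a : ι × Bool) : ℂ := if a.1 = j then (if a.2 then Complex.I / 2 else 1 / 2) else 0

theorem V_cst (j : ι) (u : E → ℂ) (x : E) : V b (fun a _ => cst j a) u x = 1 / 2 * D (b (j, false)) u x + Complex.I / 2 * D (b (j, true)) u x := by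
  simp only [V, cst, Fintype.sum_prod_type, Fintype.sum_bool]
  rw [Finset.sum_eq_single j (fun k _ hk => by simp [hk]) (by simp)]; simp; ring

theorem el_pair {w : E → ℂ} (hw : Ts univ w) (e f : E) :
    ∫ x, ‖1 / 2 * D e w x + Complex.I / 2 * D f w x‖ ^ 2 = 1 / 4 * ((∫ x, ‖D e w x‖ ^ 2) + ∫ x, ‖D f w x‖ ^ 2) := by
  have i1 : Integrable fun x => D e w x * conj (D f w x) := ((hw.D e).mul' (hw.D f).conj.sm).int
  have h : (∫ x, D e w x * conj (D f w x)) = ∫ x, D f w x * conj (D e w x) := by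
    have q : ∀ g, (fun x => conj (D g w x)) = D g fun y => conj (w y) := fun g => funext fun x => (D_conj (hw.sm.da x) g).symm
    have q1 : ∀ x, conj (D f w x) = D f (fun y => conj (w y)) x := fun x => congrFun (q f) x
    have q2 : ∀ x, conj (D e w x) = D e (fun y => conj (w y)) x := fun x => congrFun (q e) x
    simp only [q1, q2]
    rw [ibp hw.sm (hw.conj.D _), ibp hw.sm (hw.conj.D _)]
    simp only [D_comm hw.conj.sm e f]
  have h2 : (∫ x, (D e w x * conj (D f w x)).im) = 0 := by
    have e1 : (∫ x, (D e w x * conj (D f w x)).im) = (∫ x, D e w x * conj (D f w x)).im := integral_im i1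
    have e2 : conj (∫ x, D e w x * conj (D f w x)) = ∫ x, D e w x * conj (D f w x) := by
      rw [← integral_conj, h]; simp [mul_comm]
    rw [e1]; exact Complex.conj_eq_iff_im.1 e2
  have i2 : Integrable fun x => (D e w x * conj (D f w x)).im := i1.im
  have p : ∀ x, ‖1 / 2 * D e w x + Complex.I / 2 * D f w x‖ ^ 2 = 1 / 4 * (‖D e w x‖ ^ 2 + ‖D f w x‖ ^ 2) + 1 / 2 * (D e w x * conj (D f w x)).im := fun x => by
    simp only [← Complex.normSq_eq_norm_sq, Complex.normSq_apply]
    simp; ring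
  have i3 : Integrable fun x => ‖D e w x‖ ^ 2 + ‖D f w x‖ ^ 2 := (hw.D e).sq.add (hw.D f).sq
  simp only [p]
  rw [integral_add (i3.const_mul _) (i2.const_mul _), integral_const_mul, integral_const_mul, integral_add (hw.D e).sq (hw.D f).sq, h2]
  ring

theorem ell {δ : ℝ} (hc : ∀ j a, Sm (c j a)) (hδ : ∀ j a x, ‖c j a x - cst j a‖ ≤ δ) (hs : 16 * (Fintype.card ι * (δ ^ 2 * Fintype.card (ι × Bool))) ≤ 1)
    {w : E → ℂ} (hw : Ts univ w) : ∑ a, N2 (D (b a) w) ≤ 16 * ∑ j, N2 (V b (c j) w) := by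
  have p : ∀ j x, ‖1 / 2 * D (b (j, false)) w x + Complex.I / 2 * D (b (j, true)) w x‖ ^ 2 ≤ 2 * ‖V b (c j) w x‖ ^ 2 + 2 * (δ ^ 2 * Fintype.card (ι × Bool)) * ∑ a, ‖D (b a) w x‖ ^ 2 := fun j x => by
    have e : 1 / 2 * D (b (j, false)) w x + Complex.I / 2 * D (b (j, true)) w x = V b (c j) w x - ∑ a, (c j a x - cst j a) * D (b a) w x := by
      rw [← V_cst]; simp [V, sub_mul]
    have e2 : ‖∑ a, (c j a x - cst j a) * D (b a) w x‖ ≤ δ * ∑ a, ‖D (b a) w x‖ := by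
      rw [Finset.mul_sum]
      refine norm_sum_le_of_le _ fun a _ => ?_
      rw [norm_mul]; gcongr; exact hδ j a x
    have e3 := sq_sum_le_card_mul_sum_sq (s := Finset.univ) (f := fun a => ‖D (b a) w x‖)
    rw [Finset.card_univ] at e3
    have e4 := norm_sub_le (V b (c j) w x) (∑ a, (c j a x - cst j a) * D (b a) w x)
    have e5 : ‖∑ a, (c j a x - cst j a) * D (b a) w x‖ ^ 2 ≤ δ ^ 2 * (Fintype.card (ι × Bool) * ∑ a, ‖D (b a) w x‖ ^ 2) := by
      refine (pow_le_pow_left₀ (norm_nonneg _) e2 2).trans ?_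
      rw [mul_pow]; gcongr
    rw [e]
    refine (pow_le_pow_left₀ (norm_nonneg _) e4 2).trans ?_
    nlinarith [sq_nonneg (‖V b (c j) w x‖ - ‖∑ a, (c j a x - cst j a) * D (b a) w x‖)]
  have sD := fun a => (hw.D (b a)).sq
  have sV := fun j => (Ts.V (b := b) (hc j) hw).sq
  have I1 : ∀ j, 1 / 4 * ((∫ x, ‖D (b (j, false)) w x‖ ^ 2) + ∫ x, ‖D (b (j, true)) w x‖ ^ 2) ≤ 2 * (∫ x, ‖V b (c j) w x‖ ^ 2) + 2 * (δ ^ 2 * Fintype.card (ι × Bool)) * ∑ a, ∫ x, ‖D (b a) w x‖ ^ 2 := fun j => by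
    rw [← el_pair hw, ← integral_finsetSum _ fun a _ => sD a, ← integral_const_mul, ← integral_const_mul, ← integral_add ((sV j).const_mul _) ((integrable_finsetSum _ fun a _ => sD a).const_mul _)]
    exact integral_mono_of_nonneg (.of_forall fun _ => by positivity) (((sV j).const_mul _).add ((integrable_finsetSum _ fun a _ => sD a).const_mul _)) (.of_forall (p j))
  have I3 : ∑ j, ((∫ x, ‖D (b (j, false)) w x‖ ^ 2) + ∫ x, ‖D (b (j, true)) w x‖ ^ 2) = ∑ a, ∫ x, ‖D (b a) w x‖ ^ 2 := by
    rw [Fintype.sum_prod_type]; simp only [Fintype.sum_bool, add_comm]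
  have I2 := Finset.sum_le_sum fun j (_ : j ∈ Finset.univ) => I1 j
  rw [← Finset.mul_sum, I3, Finset.sum_add_distrib, ← Finset.mul_sum, Finset.sum_const, Finset.card_univ, nsmul_eq_mul] at I2
  have X0 : 0 ≤ ∑ a, ∫ x, ‖D (b a) w x‖ ^ 2 := Finset.sum_nonneg fun a _ => integral_nonneg fun _ => by positivity
  simp only [(hw.D _).N2, (Ts.V (b := b) (hc _) hw).N2]
  rw [← ENNReal.ofReal_sum_of_nonneg (fun a _ => integral_nonneg fun _ => by positivity), ← ENNReal.ofReal_sum_of_nonneg (fun a _ => integral_nonneg fun _ => by positivity),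
    show (16 : ℝ≥0∞) = ENNReal.ofReal 16 by simp, ← ENNReal.ofReal_mul (by norm_num)]
  refine ENNReal.ofReal_le_ofReal ?_
  nlinarith [mul_le_mul_of_nonneg_right hs X0]

/-- weak to strong -/
theorem ws {α : Type*} [Fintype α] {b : α → E} {ξ : α → E → ℂ} {r : ℝ} {u f : E → ℂ} (hξ : ∀ a, Sm (ξ a)) (hu : Sm u) (hf : Sm f)
    (h : ∀ g, Ts (Metric.ball (0:E) r) g → ∫ x, u x * Pt b ξ g x = ∫ x, f x * g x) : ∀ x ∈ Metric.ball (0:E) r, V b ξ u x = f x := by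
  have hd : Sm fun x => V b ξ u x - f x := (Sm.V hξ hu).sub hf
  have z : ∀ᵐ x, x ∈ Metric.ball (0:E) r → V b ξ u x - f x = 0 := by
    refine Metric.isOpen_ball.ae_eq_zero_of_integral_contDiff_smul_eq_zero (hd.continuous.locallyIntegrable.locallyIntegrableOn _) fun g g1 g2 g3 => ?_
    have hg : Ts (Metric.ball (0:E) r) fun x => (g x : ℂ) := by
      refine ⟨Complex.ofRealCLM.contDiff.comp g1, g2.comp_left (g := Complex.ofReal) (by simp), ?_⟩
      exact (closure_mono (fun x hx => by simpa using hx)).trans g3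
    have e := h _ hg
    rw [← ibpV hξ hu hg] at e
    have : ∀ x, g x • (V b ξ u x - f x) = V b ξ u x * g x - f x * g x := fun x => by simp; ring
    simp only [this]
    rw [integral_sub (hg.mul (Sm.V hξ hu)).int (hg.mul hf).int, e, sub_self]
  intro x hx
  by_contra hne
  have ho : IsOpen (Metric.ball (0:E) r ∩ {y | V b ξ u y - f y ≠ 0}) := Metric.isOpen_ball.inter (isOpen_ne_fun hd.continuous continuous_const)
  have hp := ho.measure_pos volume ⟨x, hx, sub_ne_zero.2 hne⟩
  refine hp.ne' (measure_mono_null (fun y hy => ?_) (ae_iff.1 z))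
  simpa using hy
end el
end NN

namespace NN
open MeasureTheory Filter Topology Set
open scoped ContDiff ComplexConjugate ENNReal

section core
set_option linter.unusedSectionVars false
variable {E : Type*} [NormedAddCommGroup E] [InnerProductSpace ℝ E] [FiniteDimensional ℝ E] [MeasurableSpace E] [BorelSpace E]
variable {ι : Type*} [Fintype ι] [DecidableEq ι] {b : ι × Bool → E} {c : ℕ → ι → ι × Bool → E → ℂ} {p : ℕ → ι × Bool → ι → E → ℂ}

theorem fb {κ F : Type*} [Fintype κ] [NormedAddCommGroup F] [NormedSpace ℝ F] {f : κ → ℕ → E → F} (h : ∀ k, Bd (f k)) : ∃ C, 0 ≤ C ∧ ∀ k i x, ‖f k i x‖ ≤ C := by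
  choose C hC using fun k => (h k).b0
  exact ⟨∑ k, |C k|, by positivity, fun k i x => (hC k i x).trans ((le_abs_self _).trans (Finset.single_le_sum (f := fun k => |C k|) (fun _ _ => abs_nonneg _) (Finset.mem_univ k)))⟩

theorem Z.ofc {f : ℕ → E → ℂ} {k : ℂ} (h : Z fun i x => f i x - k) : NN.Bd f ∧ ∀ e, Z fun i => NN.D e (f i) := by
  have B : NN.Bd f := by simpa using h.Bd.add (Bd.const k)
  refine ⟨B, fun e => ?_⟩
  have := h.D e
  refine (funext fun i => funext fun x => ?_ : (fun i => NN.D e (f i)) = _) ▸ this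
  rw [D_sub (Sm.da (B.sm i) x) (Sm.da contDiff_const x), D_const, sub_zero]

theorem Bd.V {ξ : ι × Bool → ℕ → E → ℂ} {f : ℕ → E → ℂ} (h : ∀ a, Bd (ξ a)) (hf : Bd f) : Bd fun i => NN.V b (fun a => ξ a i) (f i) :=
  Bd.sum fun a => (h a).mul (hf.D _)
theorem Z.V {ξ : ι × Bool → ℕ → E → ℂ} {f : ℕ → E → ℂ} (h : ∀ a, NN.Bd (ξ a)) (hf : ∀ e, Z fun i => NN.D e (f i)) : Z fun i => NN.V b (fun a => ξ a i) (f i) :=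
  Z.sum fun a => Z.mul' (h a) (hf _)
theorem Z.Vl {ξ : ι × Bool → ℕ → E → ℂ} {f : ℕ → E → ℂ} (h : ∀ a, Z (ξ a)) (hf : NN.Bd f) : Z fun i => NN.V b (fun a => ξ a i) (f i) :=
  Z.sum fun a => (h a).mul (hf.D _)

theorem core {pst : ι × Bool → ι → ℂ} {z : ι → E → ℂ} {ρ : ℝ} (hb : ∀ ξ, ‖ξ‖ ≤ ∑ a, |inner ℝ (b a) ξ|)
    (zc : ∀ j a, Z fun i x => c i j a x - cst j a) (zp : ∀ a j, Z fun i x => p i a j x - pst a j) (geo : ∀ i, Geo b (c i) (p i))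
    (cm : ∀ i, ∀ x ∈ Metric.ball (0:E) (1 / 2), ∀ j k a, V b (c i j) (c i k a) x = V b (c i k) (c i j a) x)
    (sr : ∀ j k x, V b (fun a _ => cst k a) (V b (fun a _ => conj (cst j a)) rc) x = if j = k then 1 else 0)
    (hz : ∀ k, Sm (z k)) (zz : ∀ j k, Z fun i => V b (c i j) (z k)) (z0 : ∀ j k i, ∀ x ∉ Metric.closedBall (0:E) ρ, V b (c i j) (z k) x = 0) :
    ∃ N, ∃ v : ι → ℕ → E → ℂ, (∀ k, Z (v k)) ∧ ∀ i k j, ∀ x ∈ Metric.ball (0:E) (1 / 16), V b (c (i + N) j) (fun y => z k y - v k i y) x = 0 := by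
  have bc : ∀ j a, Bd fun i => c i j a := fun j a => (zc j a).ofc.1
  have dc : ∀ j a e, Z fun i => D e (c i j a) := fun j a => (zc j a).ofc.2
  have zcc : ∀ j a, Z fun i x => cj (c i j) a x - conj (cst j a) := fun j a => by simpa [cj] using (zc j a).conj
  have bcc : ∀ j a, Bd fun i => cj (c i j) a := fun j a => (zcc j a).ofc.1
  have dcc : ∀ j a e, Z fun i => D e (cj (c i j) a) := fun j a => (zcc j a).ofc.2
  have bp : ∀ a j, Bd fun i => p i a j := fun a j => (zp a j).ofc.1
  have zk : ∀ j, Z fun i => kap b (c i) j := fun j => Z.sum fun a => dcc j a _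
  have zkd : ∀ j k, Z fun i => V b (c i k) (kap b (c i) j) := fun j k => Z.V (bc k) fun e => (zk j).D e
  have zom : ∀ k j a, Z fun i => om b (c i) k j a := fun k j a => (Z.V (bc k) (dcc j a)).sub (Z.V (bcc j) (dc k a))
  have zt1 : ∀ k j l, Z fun i => ta b (c i) (p i) k j l := fun k j l => Z.sum fun a => (zom k j a).mul (bp a l)
  have zt2 : ∀ k j l, Z fun i => ta' b (c i) (p i) k j l := fun k j l => Z.sum fun a => (zom k j a).mul (bp a l).conj
  have zt3 : ∀ k j l, Z fun i => V b (c i l) (fun y => conj (ta' b (c i) (p i) k j l y)) := fun k j l => Z.V (bc l) fun e => (zt2 k j l).conj.D e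
  obtain ⟨Ψ, hΨ, h1⟩ := cut (E := E) (r' := 1 / 2) (r := 1) (by norm_num) (by norm_num)
  let R : E → ℂ := fun x => Ψ x * rc x
  have hR : Bd fun _ : ℕ => R := Bd.cs (hΨ.mul' rc_sm).sm (hΨ.mul' rc_sm).cs
  have eR : ∀ x ∈ Metric.ball (0:E) (1 / 2), R x = rc x := fun x hx => by simp [R, h1 x hx]
  have eV : ∀ ξ : ι × Bool → E → ℂ, ∀ x ∈ Metric.ball (0:E) (1 / 2), V b ξ R x = V b ξ rc x := fun ξ x hx => by
    simp only [V, D_congr Metric.isOpen_ball eR hx]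
  have eVV : ∀ ξ η : ι × Bool → E → ℂ, ∀ x ∈ Metric.ball (0:E) (1 / 2), V b ξ (V b η R) x = V b ξ (V b η rc) x := fun ξ η x hx => by
    unfold V; simp only [← V.eq_def]
    exact Finset.sum_congr rfl fun a _ => by rw [D_congr Metric.isOpen_ball (eV η) hx]
  have zw : ∀ j k, Z fun i x => V b (c i k) (V b (cj (c i j)) R) x - V b (fun a _ => cst k a) (V b (fun a _ => conj (cst j a)) R) x := fun j k => by
    have A := (Z.Vl (b := b) (zc k) (Bd.V (b := b) (bcc j) hR)).add (Z.V (b := b) (fun a => Bd.const (cst k a)) fun e => (Z.Vl (b := b) (zcc j) hR).D e)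
    convert A using 1; funext i x
    have s1 : Sm (V b (cj (c i j)) R) := Sm.V (fun a => (bcc j a).sm i) (hR.sm 0)
    have s2 : Sm (V b (fun a _ => conj (cst j a)) R) := Sm.V (fun a => contDiff_const) (hR.sm 0)
    have e : V b (fun a x => cj (c i j) a x - conj (cst j a)) R = fun x => V b (cj (c i j)) R x - V b (fun a _ => conj (cst j a)) R x := by
      ext x; simp [V, sub_mul]
    beta_reduce
    rw [e]
    have w : ∀ (ξ : ι × Bool → E → ℂ) (f : E → ℂ), V b ξ f x = ∑ a, ξ a x * D (b a) f x := fun _ _ => rfl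
    rw [w, w, w, w]
    simp only [D_sub (Sm.da s1 x) (Sm.da s2 x), ← Finset.sum_add_distrib, ← Finset.sum_sub_distrib]
    exact Finset.sum_congr rfl fun a _ => by ring
  obtain ⟨B, B0, hB⟩ := fb fun j => Bd.V (b := b) (bc j) hR
  obtain ⟨C0, -, hC0⟩ := fb fun q : ι × (ι × Bool) => (bc q.1 q.2).fd
  obtain ⟨L, L0, hL⟩ := ps_d
  obtain ⟨ε, ε0, hε⟩ : ∃ ε : ℝ, 0 < ε ∧ 2 * ε * (Fintype.card ι : ℝ) ^ 2 * (B + 4) ≤ 1 / 2 := by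
    refine ⟨1 / (4 * ((Fintype.card ι : ℝ) ^ 2 * (B + 4) + 1)), by positivity, ?_⟩
    rw [show 2 * (1 / (4 * ((Fintype.card ι : ℝ) ^ 2 * (B + 4) + 1))) * (Fintype.card ι : ℝ) ^ 2 * (B + 4) = (2 * ((Fintype.card ι : ℝ) ^ 2 * (B + 4))) / (4 * ((Fintype.card ι : ℝ) ^ 2 * (B + 4) + 1)) by ring]
    rw [div_le_iff₀ (by positivity)]; linarith
  obtain ⟨δ, δ0, hδ⟩ : ∃ δ : ℝ, 0 < δ ∧ 16 * (Fintype.card ι * (δ ^ 2 * Fintype.card (ι × Bool))) ≤ 1 := by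
    have : Tendsto (fun δ : ℝ => 16 * (Fintype.card ι * (δ ^ 2 * Fintype.card (ι × Bool)))) (𝓝[>] 0) (𝓝 0) := by
      refine tendsto_nhdsWithin_of_tendsto_nhds ?_
      have : Continuous fun δ : ℝ => 16 * (Fintype.card ι * (δ ^ 2 * Fintype.card (ι × Bool))) := by fun_prop
      simpa using this.tendsto 0
    obtain ⟨δ, h, h'⟩ := ((this.eventually_le_const zero_lt_one).and self_mem_nhdsWithin).exists
    exact ⟨δ, h', h⟩
  have ev : ∀ᶠ i in atTop, Dat b (c i) (p i) (1 / 2) B ε C0 ∧ ∀ j a x, ‖c i j a x - cst j a‖ ≤ δ := by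
    filter_upwards [eventually_all.2 fun j => eventually_all.2 fun a => (zc j a).ev δ0, eventually_all.2 fun j => (zk j).ev zero_lt_one,
      eventually_all.2 fun j => eventually_all.2 fun k => (zkd j k).ev ε0,
      eventually_all.2 fun k => eventually_all.2 fun j => eventually_all.2 fun l => (zt1 k j l).ev ε0,
      eventually_all.2 fun k => eventually_all.2 fun j => eventually_all.2 fun l => (zt2 k j l).ev ε0,
      eventually_all.2 fun k => eventually_all.2 fun j => eventually_all.2 fun l => (zt3 k j l).ev ε0,
      eventually_all.2 fun j => eventually_all.2 fun k => (zw j k).ev ε0] with i g1 g2 g3 g4 g5 g6 g7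
    refine ⟨⟨geo i, by norm_num, by norm_num, B0, ε0.le, hε, fun j a x => hC0 (j, a) i x, cm i, fun x _ j => g2 j x, fun x _ j k => g3 j k x, fun x _ k j l => g4 k j l x,
      fun x _ k j l => g5 k j l x, fun x _ k j l => g6 k j l x, fun x hx j => ?_, fun x hx j k => ?_⟩, g1⟩
    · rw [← eV _ x hx]; exact hB j i x
    · rw [← sr j k x, ← eVV _ _ x hx, ← eVV _ _ x hx]; exact g7 j k x
  obtain ⟨N, hN⟩ := eventually_atTop.1 ev
  have Dt := fun i => hN (i + N) (Nat.le_add_left _ _)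
  choose u um ul un uq using fun k i => solve (Dt i).1 hL rfl (hz k)
  have zf : ∀ k j m, SH b m (1 / 4) fun i => V b (c (i + N) j) (z k) := fun k j m => ((zz j k).sh N).SH fun i => z0 j k (i + N)
  have us : ∀ k, S0 (u k) := fun k => by
    refine ⟨um k, ul k, ?_⟩
    have T : Tendsto (fun i => ENNReal.ofReal (ex (8 * Fintype.card ι * (L * B) ^ 2 + 4) ((1 / 2) ^ 2 / 2)) ^ 2 * ∑ j, N2 (V b (c (i + N) j) (z k))) atTop (𝓝 0) := by
      have := ENNReal.Tendsto.const_mul (a := ENNReal.ofReal (ex (8 * Fintype.card ι * (L * B) ^ 2 + 4) ((1 / 2) ^ 2 / 2)) ^ 2) (tendsto_finsetSum (Finset.univ : Finset ι) fun j _ => ((zf k j 0).s0).t) (.inr (by finiteness))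
      simpa using this
    refine tendsto_of_tendsto_of_tendsto_of_le_of_le tendsto_const_nhds T (fun _ => zero_le) fun i => (un k i).trans ?_
    gcongr with j
    refine N2_mono fun x => ?_
    rw [Set.indicator]; split_ifs <;> simp
  have rg : ∀ k m, SH b m (1 / 8) (u k) := fun k m => SH.down <| reg (fun j a => (bc j a).sh N) (fun i w hw => ell (fun j a => (bc j a).sm _) (Dt i).2 hδ hw) m
    (by norm_num) (by norm_num) (us k) (fun j => zf k j m) fun i g hg j => uq k i g (by norm_num; exact hg) j
  choose v vz vq using fun k => sob hb (by norm_num : (0:ℝ) < 1 / 16) (by norm_num) (rg k)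
  refine ⟨N, v, vz, fun i k j x hx => ?_⟩
  have csm := fun a => (bc j a).sm (i + N)
  have key := ws (b := b) csm ((vz k).sm i) (Sm.V (b := b) csm (hz k)) (fun g hg => ?_) x hx
  · have := V_add (b := b) (ξ := c (i + N) j) (hz k) ((vz k).sm i).neg x
    simp only [← sub_eq_add_neg] at this
    rw [this, V_neg, key, add_neg_cancel]
  · rw [vq k i _ (Ts.Pt csm hg)]
    exact uq k i g (hg.mono (Metric.ball_subset_ball (by norm_num))) j
end core
end NN

namespace NN
open MeasureTheory Filter Topology Set
open scoped ContDiff ComplexConjugate ENNReal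

section inv
set_option linter.unusedSectionVars false
variable {E : Type*} [NormedAddCommGroup E] [InnerProductSpace ℝ E] [FiniteDimensional ℝ E]
variable {A : Type*} [NormedRing A] [NormedAlgebra ℝ A] [CompleteSpace A]

theorem inv_ok {q : A} (h : ‖q‖ ≤ 1 / 2) : (1 - q) * Ring.inverse (1 - q) = 1 ∧ Ring.inverse (1 - q) * (1 - q) = 1 ∧ ContDiffAt ℝ ∞ Ring.inverse (1 - q) := by
  have u := isUnit_one_sub_of_norm_lt_one (h.trans_lt (by norm_num))
  refine ⟨Ring.mul_inverse_cancel _ u, Ring.inverse_mul_cancel _ u, ?_⟩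
  obtain ⟨v, hv⟩ := u
  rw [← hv]; exact contDiffAt_ringInverse ℝ v

theorem inv_Bd {Q : ℕ → E → A} (hQ : Z Q) (h : ∀ i x, ‖Q i x‖ ≤ 1 / 2) : Bd (fun i x => Ring.inverse (1 - Q i x)) ∧ Z fun i x => Ring.inverse (1 - Q i x) - 1 := by
  set M : ℕ → E → A := fun i x => Ring.inverse (1 - Q i x)
  have sM : ∀ i, ContDiff ℝ ∞ (M i) := fun i => contDiff_iff_contDiffAt.2 fun x =>
    ContDiffAt.comp (g := Ring.inverse) x (inv_ok (h i x)).2.2 (contDiff_const.sub (hQ.sm i)).contDiffAt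
  have eM : ∀ i x, M i x = 1 + Q i x * M i x := fun i x => by
    have : (1 - Q i x) * M i x = 1 := (inv_ok (h i x)).1
    rw [sub_mul, one_mul, sub_eq_iff_eq_add] at this; exact this
  choose q hq using hQ.Bd.bd
  have hT := ContinuousLinearMap.opNorm_mul_le ℝ A
  have bM : Bd M := ⟨sM, fun m => by
    induction m using Nat.strong_induction_on with
    | _ m ih =>
      choose C hC using ih
      obtain ⟨C1, h1⟩ := (Bd.const (E := E) (1 : A)).bd m
      let C' : ℕ → ℝ := fun k => if hk : k < m then |C k hk| else 0
      have hC' : ∀ k < m, ∀ i x, ‖iteratedFDeriv ℝ k (M i) x‖ ≤ C' k := fun k hk i x => by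
        simp only [C', hk, dif_pos]; exact (hC k hk i x).trans (le_abs_self _)
      refine ⟨2 * (C1 + ∑ k ∈ Finset.range m, (m.choose (k + 1) : ℝ) * q (k + 1) * C' (m - (k + 1))), fun i x => ?_⟩
      have e : iteratedFDeriv ℝ m (M i) x = iteratedFDeriv ℝ m (fun _ : E => (1 : A)) x + iteratedFDeriv ℝ m (fun y => ContinuousLinearMap.mul ℝ A (Q i y) (M i y)) x := by
        have s : ContDiff ℝ ∞ fun y => ContinuousLinearMap.mul ℝ A (Q i y) (M i y) := (hQ.sm i).mul (sM i)
        rw [← iteratedFDeriv_add_apply (sm_at contDiff_const m x) (sm_at s m x)]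
        congr 1; exact funext (eM i)
      have b := bil_le (ContinuousLinearMap.mul ℝ A) (hQ.sm i) (sM i) m x
      rw [Finset.sum_range_succ'] at b
      have b0 : ‖iteratedFDeriv ℝ 0 (Q i) x‖ ≤ 1 / 2 := by simpa using h i x
      have b1 : ∑ k ∈ Finset.range m, (m.choose (k + 1) : ℝ) * ‖iteratedFDeriv ℝ (k + 1) (Q i) x‖ * ‖iteratedFDeriv ℝ (m - (k + 1)) (M i) x‖ ≤
          ∑ k ∈ Finset.range m, (m.choose (k + 1) : ℝ) * q (k + 1) * C' (m - (k + 1)) := by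
        refine Finset.sum_le_sum fun k hk => ?_
        have hk := Finset.mem_range.1 hk
        have := (norm_nonneg _).trans (hq (k + 1) i x)
        gcongr
        · exact hq _ i x
        · exact hC' _ (by omega) i x
      have b2 := norm_add_le (iteratedFDeriv ℝ m (fun _ : E => (1 : A)) x) (iteratedFDeriv ℝ m (fun y => ContinuousLinearMap.mul ℝ A (Q i y) (M i y)) x)
      rw [← e] at b2
      have b3 : 0 ≤ ∑ k ∈ Finset.range m, (m.choose (k + 1) : ℝ) * ‖iteratedFDeriv ℝ (k + 1) (Q i) x‖ * ‖iteratedFDeriv ℝ (m - (k + 1)) (M i) x‖ := by positivity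
      have b4 : ((m.choose 0 : ℕ) : ℝ) * ‖iteratedFDeriv ℝ 0 (Q i) x‖ * ‖iteratedFDeriv ℝ (m - 0) (M i) x‖ ≤ 1 / 2 * ‖iteratedFDeriv ℝ m (M i) x‖ := by
        rw [Nat.choose_zero_right, Nat.cast_one, one_mul]; gcongr; simp
      have b5 := b.trans (mul_le_of_le_one_left (by positivity) hT)
      linarith [h1 i x]⟩
  refine ⟨bM, ?_⟩
  have := Z.bil (ContinuousLinearMap.mul ℝ A) hQ bM
  convert this using 3 with i x
  rw [sub_eq_iff_eq_add']; exact eM i x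

variable {F : Type*} [NormedAddCommGroup F] [NormedSpace ℝ F]

theorem Zcut {χ : E → ℂ} (hχ : Ts (Metric.ball (0:E) (3 / 4)) χ) {f : ℕ → E → F} (hf : ∀ i, ContDiffOn ℝ ∞ (f i) (Metric.ball 0 1))
    (h : ∀ m, ∀ ε > (0:ℝ), ∀ᶠ i in atTop, ∀ x ∈ Metric.closedBall (0:E) (3 / 4), ‖iteratedFDeriv ℝ m (f i) x‖ ≤ ε) : Z fun i x => (χ x).re • f i x := by
  have sχ : ContDiff ℝ ∞ fun x => (χ x).re := Complex.reCLM.contDiff.comp hχ.sm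
  have cχ : HasCompactSupport fun x => (χ x).re := hχ.cs.comp_left (g := Complex.re) rfl
  have b34 : Metric.ball (0:E) (3 / 4) ⊆ Metric.ball 0 1 := Metric.ball_subset_ball (by norm_num)
  have ts : ∀ i, tsupport (fun x => (χ x).re • f i x) ⊆ Metric.ball (0:E) (3 / 4) := fun i =>
    (closure_mono fun x hx => by
      simp only [Function.mem_support] at hx ⊢; intro h0; simp [h0] at hx).trans hχ.sub
  have so : ∀ i, ContDiffOn ℝ ∞ (fun x => (χ x).re • f i x) (Metric.ball 0 1) := fun i => sχ.contDiffOn.smul (hf i)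
  have sm : ∀ i, ContDiff ℝ ∞ fun x => (χ x).re • f i x := fun i => contDiff_iff_contDiffAt.2 fun x => by
    by_cases hx : x ∈ Metric.ball (0:E) 1
    · exact (so i).contDiffAt (Metric.isOpen_ball.mem_nhds hx)
    · have : (fun x => (χ x).re • f i x) =ᶠ[𝓝 x] fun _ => 0 := notMem_tsupport_iff_eventuallyEq.1 fun h => hx (b34 (ts i h))
      exact contDiffAt_const.congr_of_eventuallyEq this
  refine ⟨sm, fun m => ?_⟩
  have bdd : ∀ i, BddAbove (range fun x => ‖iteratedFDeriv ℝ m (fun x => (χ x).re • f i x) x‖) := fun i => by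
    obtain ⟨C, hC⟩ := (Bd.cs (sm i) (cχ.smul_right)).bd m
    exact ⟨C, by rintro _ ⟨x, rfl⟩; exact hC 0 x⟩
  refine ⟨fun i => ⨆ x, ‖iteratedFDeriv ℝ m (fun x => (χ x).re • f i x) x‖, ?_, fun i x => le_ciSup (bdd i) x⟩
  choose q hq using (Bd.cs sχ cχ).bd
  rw [Metric.tendsto_nhds]
  intro ε hε
  have q0 : ∀ k, 0 ≤ q k := fun k => (norm_nonneg _).trans (hq k 0 0)
  set K := ∑ k ∈ Finset.range (m + 1), (m.choose k : ℝ) * q k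
  have K0 : 0 ≤ K := Finset.sum_nonneg fun k _ => mul_nonneg (by positivity) (q0 k)
  have ev : ∀ᶠ i in atTop, ∀ k ∈ Finset.range (m + 1), ∀ x ∈ Metric.closedBall (0:E) (3 / 4), ‖iteratedFDeriv ℝ k (f i) x‖ ≤ ε / (2 * (K + 1)) :=
    (Finset.eventually_all _).2 fun k _ => h k _ (by positivity)
  filter_upwards [ev] with i hi
  rw [dist_zero_right, Real.norm_of_nonneg (Real.iSup_nonneg fun _ => norm_nonneg _)]
  refine (ciSup_le fun x => ?_ : _ ≤ ε / 2).trans_lt (by linarith)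
  by_cases hx : x ∈ Metric.ball (0:E) (3 / 4)
  · have L := norm_iteratedFDerivWithin_smul_le (n := m) sχ.contDiffOn (hf i) Metric.isOpen_ball.uniqueDiffOn (b34 hx) (by exact_mod_cast le_top)
    rw [iteratedFDerivWithin_of_isOpen m Metric.isOpen_ball (b34 hx)] at L
    refine L.trans ?_
    have : ∑ k ∈ Finset.range (m + 1), (m.choose k : ℝ) * q k * (ε / (2 * (K + 1))) ≤ ε / 2 := by
      rw [← Finset.sum_mul, mul_div_assoc', div_le_iff₀ (by positivity)]; nlinarith
    refine (Finset.sum_le_sum fun k hk => ?_).trans this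
    rw [iteratedFDerivWithin_of_isOpen _ Metric.isOpen_ball (b34 hx), iteratedFDerivWithin_of_isOpen _ Metric.isOpen_ball (b34 hx)]
    have := q0 k
    gcongr
    · exact hq k 0 x
    · exact hi _ (Finset.mem_range.2 (by omega)) x (Metric.ball_subset_closedBall hx)
  · rw [image_eq_zero_of_notMem_tsupport fun h => hx (ts i (tsupport_iteratedFDeriv_subset m h)), norm_zero]; positivity
end inv

section cm
variable {E : Type*} [NormedAddCommGroup E] [NormedSpace ℝ E]

/-- commuting frames from integrability -/
theorem frame {J M : E → E →L[ℝ] E} {I : E →L[ℝ] E} {x : E} (dJ : DifferentiableAt ℝ J x) (dM : DifferentiableAt ℝ M x)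
    (hI : I * I = -1) (hJ : ∀ᶠ y in 𝓝 x, J y * J y = -1)
    (hNM : ∀ᶠ y in 𝓝 x, ((1 / 2 : ℝ) • (1 - I * J y)) * M y = 1) (hMN : M x * ((1 / 2 : ℝ) • (1 - I * J x)) = 1)
    (nij : ∀ u v, fderiv ℝ J x (J x u) v - fderiv ℝ J x (J x v) u + J x (fderiv ℝ J x v u) - J x (fderiv ℝ J x u v) = 0) :
    J x * M x = M x * I ∧ (∀ e f, fderiv ℝ M x (M x e) f - fderiv ℝ M x (M x (I e)) (I f) = fderiv ℝ M x (M x f) e - fderiv ℝ M x (M x (I f)) (I e)) ∧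
      ∀ e f, fderiv ℝ M x (M x e) (I f) + fderiv ℝ M x (M x (I e)) f = fderiv ℝ M x (M x f) (I e) + fderiv ℝ M x (M x (I f)) e := by
  set N := (1 / 2 : ℝ) • (1 - I * J x) with hN
  have j2 := hJ.self_of_nhds
  have nm : N * M x = 1 := hNM.self_of_nhds
  have nj : N * J x = I * N := by
    rw [hN, smul_mul_assoc, mul_smul_comm, sub_mul, mul_sub, mul_assoc, j2, ← mul_assoc, hI]; simp [add_comm]
  have jm : J x * M x = M x * I := by
    calc J x * M x = M x * N * (J x * M x) := by rw [hMN, one_mul]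
      _ = M x * (N * J x) * M x := by simp only [mul_assoc]
      _ = M x * I * (N * M x) := by rw [nj]; simp only [mul_assoc]
      _ = _ := by rw [nm, mul_one]
  have a1 : ∀ w v, fderiv ℝ J x w (J x v) = - J x (fderiv ℝ J x w v) := fun w v => by
    have h1 := dJ.hasFDerivAt.clm_comp dJ.hasFDerivAt
    have h2 : HasFDerivAt (fun y => (J y).comp (J y)) (0 : E →L[ℝ] E →L[ℝ] E) x := (hasFDerivAt_const (-1 : E →L[ℝ] E) x).congr_of_eventuallyEq hJ
    have := congrArg (fun L : E →L[ℝ] E →L[ℝ] E => L w v) (h1.unique h2)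
    simp at this
    rw [eq_neg_iff_add_eq_zero, add_comm]; exact this
  have a2 : ∀ w f, fderiv ℝ M x w f = (1 / 2 : ℝ) • M x (I (fderiv ℝ J x w (M x f))) := fun w f => by
    have hK : HasFDerivAt (fun y => (1 / 2 : ℝ) • (1 - I * J y)) ((1 / 2 : ℝ) • (0 - (ContinuousLinearMap.compL ℝ E E E I).comp (fderiv ℝ J x))) x :=
      ((hasFDerivAt_const (1 : E →L[ℝ] E) x).sub ((ContinuousLinearMap.compL ℝ E E E I).hasFDerivAt.comp x dJ.hasFDerivAt)).const_smul (1 / 2 : ℝ)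
    have h1 := hK.clm_comp dM.hasFDerivAt
    have h2 := h1.unique ((hasFDerivAt_const (1 : E →L[ℝ] E) x).congr_of_eventuallyEq hNM)
    have := congrArg (fun L : E →L[ℝ] E →L[ℝ] E => M x (L w f)) h2
    have mn : ∀ y, M x (N y) = y := fun y => congrArg (fun L : E →L[ℝ] E => L y) hMN
    simp [N] at this mn
    rw [mn, ← sub_eq_add_neg, sub_eq_zero] at this; rw [this, one_div]
  have jm' : ∀ e, M x (I e) = J x (M x e) := fun e => (congrArg (fun L : E →L[ℝ] E => L e) jm).symm
  have j2' : ∀ e, J x (J x e) = - e := fun e => congrArg (fun L : E →L[ℝ] E => L e) j2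
  refine ⟨jm, fun e f => ?_, fun e f => ?_⟩
  · simp only [a2, jm', a1]
    have := congrArg (J x) (nij (M x e) (M x f))
    simp only [map_sub, map_add, j2', map_zero] at this
    rw [← smul_sub, ← smul_sub, ← map_sub, ← map_sub, ← map_sub, ← map_sub]
    congr 3
    rw [← sub_eq_zero, ← this]; abel
  · simp only [a2, jm', a1]
    have := nij (M x e) (M x f)
    rw [← smul_add, ← smul_add, ← map_add, ← map_add, ← map_add, ← map_add]
    congr 3
    rw [← sub_eq_zero, ← this]; abel
end cm
end NN

namespace NN
open MeasureTheory Filter Topology Set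
open scoped ContDiff ComplexConjugate ENNReal

section fin
variable {n : ℕ}
/-- real basis -/
def bb (a : Fin n × Bool) : Cn n := EuclideanSpace.single a.1 (if a.2 then Complex.I else 1)
def qq (a : Fin n × Bool) : Cn n →L[ℝ] ℂ := Complex.ofRealCLM.comp (innerSL ℝ (bb a))
def pr (k : Fin n) : Cn n →L[ℝ] ℂ := (EuclideanSpace.proj k : Cn n →L[ℂ] ℂ).restrictScalars ℝ
abbrev En (n : ℕ) := Cn n →L[ℝ] Cn n
abbrev ap (e : Cn n) : En n →L[ℝ] Cn n := ContinuousLinearMap.apply ℝ (Cn n) e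
def gg (j : Fin n) (a : Fin n × Bool) : En n →L[ℝ] ℂ := (1 / 2 : ℂ) • (qq a).comp (ap (bb (j, false))) + (Complex.I / 2) • (qq a).comp (ap (bb (j, true)))
def pp (a : Fin n × Bool) (l : Fin n) : En n →L[ℝ] ℂ := ((Complex.conjCLE : ℂ →L[ℝ] ℂ).comp (pr l)).comp (ap (bb a))
def tt (j k : Fin n) : En n →L[ℝ] ℂ := (1 / 2 : ℂ) • (pr k).comp (ap (bb (j, false))) + (Complex.I / 2) • (pr k).comp (ap (bb (j, true)))

theorem pr_a (k : Fin n) (x : Cn n) : pr k x = x k := rfl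
theorem gg_a (j : Fin n) (a : Fin n × Bool) (L : En n) : gg j a L = 1 / 2 * qq a (L (bb (j, false))) + Complex.I / 2 * qq a (L (bb (j, true))) := rfl
theorem pp_a (a : Fin n × Bool) (l : Fin n) (L : En n) : pp a l L = conj (L (bb a) l) := rfl
theorem tt_a (j k : Fin n) (L : En n) : tt j k L = 1 / 2 * L (bb (j, false)) k + Complex.I / 2 * L (bb (j, true)) k := rfl

theorem inb (x : Cn n) (a : Fin n × Bool) : inner ℝ (bb a) x = if a.2 then (x a.1).im else (x a.1).re := by
  rcases a with ⟨j, _ | _⟩ <;>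
  · rw [PiLp.inner_apply, Finset.sum_eq_single j (fun k _ hk => by simp [bb, hk]) (by simp)]
    simp [bb]
theorem qq_a (a : Fin n × Bool) (x : Cn n) : qq a x = ((if a.2 then (x a.1).im else (x a.1).re : ℝ) : ℂ) := by rw [← inb]; rfl

theorem ex1 (x : Cn n) : x = ∑ j, ((x j).re • bb (j, false) + (x j).im • bb (j, true)) := by
  ext k
  simp only [bb, WithLp.ofLp_sum, Finset.sum_apply, PiLp.add_apply, PiLp.smul_apply]
  rw [Finset.sum_eq_single k (fun j _ hj => by simp [hj.symm]) (by simp)]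
  simp
theorem ex2 (L : Cn n →L[ℝ] ℂ) (x : Cn n) : L x = ∑ j, ((x j).re * L (bb (j, false)) + (x j).im * L (bb (j, true))) := by
  conv_lhs => rw [ex1 x]
  simp
theorem ex3 (L : Cn n →L[ℝ] ℂ) (x : Cn n) : L x = ∑ a, qq a x * L (bb a) := by
  rw [ex2 L x, Fintype.sum_prod_type]
  simp [qq_a, add_comm]

theorem Vg {M : Cn n → En n} (j : Fin n) (u : Cn n → ℂ) (x : Cn n) :
    V bb (fun a x => gg j a (M x)) u x = 1 / 2 * fderiv ℝ u x (M x (bb (j, false))) + Complex.I / 2 * fderiv ℝ u x (M x (bb (j, true))) := by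
  rw [ex3 _ (M x (bb (j, false))), ex3 _ (M x (bb (j, true))), Finset.mul_sum, Finset.mul_sum, ← Finset.sum_add_distrib]
  exact Finset.sum_congr rfl fun a _ => by beta_reduce; rw [gg_a, D]; ring
theorem Vgc {M : Cn n → En n} (j : Fin n) (u : Cn n → ℂ) (x : Cn n) :
    V bb (cj fun a x => gg j a (M x)) u x = 1 / 2 * fderiv ℝ u x (M x (bb (j, false))) - Complex.I / 2 * fderiv ℝ u x (M x (bb (j, true))) := by
  rw [ex3 _ (M x (bb (j, false))), ex3 _ (M x (bb (j, true))), Finset.mul_sum, Finset.mul_sum, ← Finset.sum_sub_distrib]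
  refine Finset.sum_congr rfl fun a _ => ?_
  simp only [cj, gg_a, D, qq_a, map_add, map_mul, map_div₀, Complex.conj_I, Complex.conj_ofReal, map_one, map_ofNat]; ring

theorem g1 (j : Fin n) (a : Fin n × Bool) : gg j a 1 = cst j a := by
  rcases a with ⟨k, _ | _⟩ <;> by_cases h : k = j <;> simp [gg_a, qq_a, cst, bb, h]
theorem t1 (j k : Fin n) : tt j k 1 = 0 := by
  by_cases h : k = j <;> simp [tt_a, bb, h]
  linear_combination (1 / 2 : ℂ) * Complex.I_mul_I

theorem J2 : Jstd n * Jstd n = -1 := by ext x j; simp [Jstd, ← mul_assoc]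
theorem Jb (j : Fin n) : Jstd n (bb (j, false)) = bb (j, true) := by ext k; simp [Jstd, bb]

theorem nle (x : Cn n) : ‖x‖ ≤ ∑ j, ‖x j‖ := by
  have : x = ∑ j, EuclideanSpace.single j (x j) := by
    ext k; simp [Finset.sum_apply]
  conv_lhs => rw [this]
  exact norm_sum_le_of_le _ fun j _ => by simp
theorem hbb (x : Cn n) : ‖x‖ ≤ ∑ a, |inner ℝ (bb a) x| := by
  rw [Fintype.sum_prod_type]
  refine (nle x).trans (Finset.sum_le_sum fun j _ => (Complex.norm_le_abs_re_add_abs_im _).trans ?_)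
  simp [inb, add_comm]

theorem Drc (a : Fin n × Bool) (x : Cn n) : D (bb a) rc x = 2 * qq a x := by
  have := Complex.ofRealCLM.hasFDerivAt.comp x (hasStrictFDerivAt_norm_sq x).hasFDerivAt
  have e : fderiv ℝ (rc (E := Cn n)) x = _ := this.fderiv
  rw [D, e, qq_a, ← inb, real_inner_comm]; simp

theorem srr (j k : Fin n) (x : Cn n) : V bb (fun a _ => cst k a) (V bb (fun a _ => conj (cst j a)) rc) x = if j = k then 1 else 0 := by
  have e : V bb (fun a _ => conj (cst j a)) rc = fun x : Cn n => (Complex.conjCLE : ℂ →L[ℝ] ℂ) (pr j x) := by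
    ext x
    have h := Vgc (M := fun _ => 1) j rc x
    simp only [g1] at h
    refine Eq.trans (show _ = _ from h) ?_
    change 1 / 2 * D (bb (j, false)) rc x - Complex.I / 2 * D (bb (j, true)) rc x = _
    rw [Drc, Drc, qq_a, qq_a]
    change _ = conj (x j)
    apply Complex.ext <;> simp
  have d : ∀ w, D w (fun x : Cn n => (Complex.conjCLE : ℂ →L[ℝ] ℂ) (pr j x)) x = conj (w j) := fun w => by
    rw [D, show (fun x : Cn n => (Complex.conjCLE : ℂ →L[ℝ] ℂ) (pr j x)) = ((Complex.conjCLE : ℂ →L[ℝ] ℂ).comp (pr j)) from rfl, ContinuousLinearMap.fderiv]; rfl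
  rw [e, V_cst, d, d]
  by_cases h : j = k
  · subst h; simp [bb]; linear_combination (-1 / 2 : ℂ) * Complex.I_mul_I
  · simp [bb, h]

theorem geom {J Q : ℕ → Cn n → En n} (hQ : Z Q) (hs : ∀ i x, ‖Q i x‖ ≤ 1 / 2) (h0 : ∀ i, ∀ x ∉ Metric.closedBall (0 : Cn n) (3 / 4), Q i x = 0)
    (hJ : ∀ i, IsComplexStructureOn (J i) (Metric.ball (0 : Cn n) 1))
    (hQJ : ∀ i, ∀ x ∈ Metric.ball (0 : Cn n) (1 / 2), 1 - Q i x = (1 / 2 : ℝ) • (1 - Jstd n * J i x)) :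
    ∃ N, ∃ v : Fin n → ℕ → Cn n → ℂ, (∀ k, Z (v k)) ∧ ∀ i k, ∀ x ∈ Metric.ball (0 : Cn n) (1 / 16), ∀ u,
      fderiv ℝ (fun y => pr k y - v k i y) x (J (i + N) x u) = Complex.I * fderiv ℝ (fun y => pr k y - v k i y) x u := by
  obtain ⟨bM, zM⟩ := inv_Bd hQ hs
  set M : ℕ → Cn n → En n := fun i x => Ring.inverse (1 - Q i x) with hM
  have nm : ∀ i x, (1 - Q i x) * M i x = 1 := fun i x => (inv_ok (hs i x)).1
  have mn : ∀ i x, M i x * (1 - Q i x) = 1 := fun i x => (inv_ok (hs i x)).2.1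
  have mn' : ∀ i x y, M i x ((1 - Q i x) y) = y := fun i x y => congrArg (fun L : En n => L y) (mn i x)
  have M1 : ∀ i, ∀ x ∉ Metric.closedBall (0 : Cn n) (3 / 4), M i x = 1 := fun i x hx => by simp [hM, h0 i x hx]
  have fr : ∀ i, ∀ x ∈ Metric.ball (0 : Cn n) (1 / 2), _ := fun i x hx => by
    have nb : Metric.ball (0 : Cn n) (1 / 2) ∈ 𝓝 x := Metric.isOpen_ball.mem_nhds hx
    have s1 : Metric.ball (0 : Cn n) (1 / 2) ⊆ Metric.ball 0 1 := Metric.ball_subset_ball (by norm_num)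
    have nb1 := mem_of_superset nb s1
    refine frame (J := J i) (M := M i) (I := Jstd n) (x := x) (((hJ i).1.contDiffAt nb1).differentiableAt (by simp)) ((bM.sm i).differentiable (by simp) x) J2 ?_ ?_ ?_ ?_
    · filter_upwards [nb] with y hy using (hJ i).2.1 y (s1 hy)
    · filter_upwards [nb] with y hy; rw [← hQJ i y hy]; exact nm i y
    · rw [← hQJ i x hx]; exact mn i x
    · exact (hJ i).2.2 x (s1 hx)
  have csm : ∀ i j a, Sm fun x => gg j a (M i x) := fun i j a => (gg j a).contDiff.comp (bM.sm i)
  have fz : ∀ i j (k : Fin n), V bb (fun a x => gg j a (M i x)) (pr k) = fun x => tt j k (M i x - 1) := fun i j k => by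
    ext x; rw [Vg, ContinuousLinearMap.fderiv, map_sub, t1, sub_zero]; rfl
  obtain ⟨N, v, vz, hv⟩ := core (b := bb) (c := fun i j a x => gg j a (M i x)) (p := fun i a l x => pp a l (1 - Q i x)) (pst := fun a l => pp a l 1) (z := fun k => pr k) (ρ := 3 / 4) hbb
    (fun j a => by simpa [g1] using zM.clm (gg j a)) (fun a l => by simpa using (hQ.clm (pp a l)).neg)
    (fun i => ⟨csm i, fun a l => (pp a l).contDiff.comp (contDiff_const.sub (hQ.sm i)), fun u _ x a => by
      rw [D, ← mn' i x (bb a)]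
      refine (ex2 ((fderiv ℝ u x).comp (M i x)) ((1 - Q i x) (bb a))).trans (Finset.sum_congr rfl fun l _ => ?_)
      rw [Vg, Vgc, pp_a, Complex.conj_conj]
      generalize ((1 - Q i x) (bb a)).ofLp l = y
      simp only [ContinuousLinearMap.comp_apply]
      have e1 := Complex.re_add_im y
      have e2 : conj y = y.re - y.im * Complex.I := by apply Complex.ext <;> simp
      rw [e2]; conv_rhs => enter [2, 1]; rw [← e1]
      linear_combination ((y.im : ℂ) * fderiv ℝ u x (M i x (bb (l, true)))) * Complex.I_mul_I⟩)
    (fun i x hx j k a => by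
      obtain ⟨-, f1, f2⟩ := fr i x hx
      have d : ∀ k w, fderiv ℝ (fun x => gg k a (M i x)) x w = gg k a (fderiv ℝ (M i) x w) := fun k w => by
        have := ((gg k a).hasFDerivAt.comp x ((bM.sm i).differentiable (by simp) x).hasFDerivAt).fderiv
        exact congrArg (fun L : Cn n →L[ℝ] ℂ => L w) this
      change V bb (fun a x => gg j a (M i x)) (fun x => gg k a (M i x)) x = V bb (fun a x => gg k a (M i x)) (fun x => gg j a (M i x)) x
      rw [Vg, Vg, d, d, d, d]; simp only [gg_a, ← Jb]
      have c1 := congrArg (qq a) (f1 (bb (j, false)) (bb (k, false)))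
      have c2 := congrArg (qq a) (f2 (bb (j, false)) (bb (k, false)))
      simp only [map_sub, map_add] at c1 c2
      linear_combination (1 / 4 : ℂ) * c1 + Complex.I / 4 * c2 + (1 / 4 * (qq a (fderiv ℝ (M i) x (M i x (Jstd n (bb (j, false)))) (Jstd n (bb (k, false)))) - qq a (fderiv ℝ (M i) x (M i x (Jstd n (bb (k, false)))) (Jstd n (bb (j, false)))))) * Complex.I_mul_I)
    srr (fun k => (pr k).contDiff) (fun j k => by simp only [fz]; exact zM.clm (tt j k)) (fun j k i x hx => by simp only [fz]; rw [M1 i x hx]; simp)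
  refine ⟨N, v, vz, fun i k x hx u => ?_⟩
  have hx' : x ∈ Metric.ball (0 : Cn n) (1 / 2) := Metric.ball_subset_ball (by norm_num) hx
  obtain ⟨jm, -, -⟩ := fr (i + N) x hx'
  set L := fderiv ℝ (fun y => pr k y - v k i y) x
  have h1 : ∀ j, L (M (i + N) x (bb (j, true))) = Complex.I * L (M (i + N) x (bb (j, false))) := fun j => by
    have : V bb (fun a x => gg j a (M (i + N) x)) (fun y => pr k y - v k i y) x = 0 := hv i k j x hx
    rw [Vg] at this
    linear_combination (-2 * Complex.I) * this + L (M (i + N) x (bb (j, true))) * Complex.I_mul_I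
  have h2 : ∀ e, L (M (i + N) x (Jstd n e)) = Complex.I * L (M (i + N) x e) := fun e => by
    have e1 := ex2 ((L.comp (M (i + N) x)).comp (Jstd n)) e
    have e2 := ex2 (L.comp (M (i + N) x)) e
    have jj : ∀ j, Jstd n (bb (j, true)) = - bb (j, false) := fun j => by
      rw [← Jb]; exact congrArg (fun L : En n => L (bb (j, false))) J2
    simp only [ContinuousLinearMap.comp_apply, Jb, jj, map_neg, h1] at e1 e2
    rw [e1, e2, Finset.mul_sum]
    refine Finset.sum_congr rfl fun j _ => ?_
    linear_combination (-((e j).im : ℂ) * L (M (i + N) x (bb (j, false)))) * Complex.I_mul_I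
  have jm' : ∀ e, M (i + N) x (Jstd n e) = J (i + N) x (M (i + N) x e) := fun e => (congrArg (fun L : En n => L e) jm).symm
  rw [← mn' (i + N) x u, ← jm', h2]
end fin
end NN

namespace NN
open MeasureTheory Filter Topology Set
open scoped ContDiff ComplexConjugate ENNReal

section fin2
variable {n : ℕ}

theorem fin1 {J : ℕ → Cn n → En n} (hn : 0 < n) (hJ : ∀ i, IsComplexStructureOn (J i) (Metric.ball (0 : Cn n) 1))
    (hc : TendstoLocallySmoothlyOn J (fun _ => Jstd n) (Metric.ball (0 : Cn n) 1)) :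
    ∃ N, ∃ v : Fin n → ℕ → Cn n → ℂ, (∀ k, Z (v k)) ∧ ∀ i k, ∀ x ∈ Metric.ball (0 : Cn n) (1 / 16), ∀ u,
      fderiv ℝ (fun y => pr k y - v k i y) x (J (i + N) x u) = Complex.I * fderiv ℝ (fun y => pr k y - v k i y) x u := by
  have : Nonempty (Fin n) := ⟨⟨0, hn⟩⟩
  obtain ⟨χ, hχ, χ1⟩ := cut (E := Cn n) (r' := 1 / 2) (r := 3 / 4) (by norm_num) (by norm_num)
  have z1 := Zcut hχ (f := fun i x => J i x - Jstd n) (fun i => (hJ i).1.sub contDiffOn_const) (fun m ε hε => by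
    have := Metric.tendstoUniformlyOn_iff.1 (hc (Metric.closedBall 0 (3 / 4)) (Metric.closedBall_subset_ball (by norm_num)) (isCompact_closedBall _ _) m) ε hε
    filter_upwards [this] with i hi x hx
    have hx1 : x ∈ Metric.ball (0 : Cn n) 1 := Metric.closedBall_subset_ball (by norm_num) hx
    have c1 : ContDiffAt ℝ m (J i) x := (((hJ i).1 x hx1).contDiffAt (Metric.isOpen_ball.mem_nhds hx1)).of_le (by exact_mod_cast le_top)
    have e := iteratedFDeriv_sub_apply c1 (contDiffAt_const (c := Jstd n))
    have h := hi x hx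
    rw [dist_comm, dist_eq_norm] at h
    change ‖iteratedFDeriv ℝ m (J i - fun _ => Jstd n) x‖ ≤ ε
    rw [e]; exact h.le)
  have z2 : Z fun i x => (1 / 2 : ℝ) • (Jstd n * ((χ x).re • (J i x - Jstd n))) := z1.clm ((1 / 2 : ℝ) • ContinuousLinearMap.compL ℝ (Cn n) (Cn n) (Cn n) (Jstd n))
  obtain ⟨N0, hN⟩ := eventually_atTop.1 (z2.ev (ε := 1 / 2) (by norm_num))
  obtain ⟨N, v, vz, hv⟩ := geom (J := fun i => J (i + N0)) (z2.sh N0) (fun i x => hN _ (by omega) x)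
    (fun i x hx => by
      rw [hχ.zero_of (fun h => hx (Metric.ball_subset_closedBall h)), Complex.zero_re, show (0 : ℝ) • (J (i + N0) x - Jstd n) = 0 from ContinuousLinearMap.ext fun y => zero_smul ℝ ((J (i + N0) x - Jstd n) y), mul_zero, smul_zero]) (fun i => hJ _) (fun i x hx => by
      simp only [χ1 x hx, Complex.one_re, one_smul, mul_sub, J2]
      module)
  exact ⟨N + N0, v, vz, fun i k x hx u => by rw [← add_assoc]; exact hv i k x hx u⟩

theorem fin2 {v : Fin n → Cn n → ℂ} (hs : ∀ k, Sm (v k)) (hb : ∀ k x, ‖fderiv ℝ (v k) x‖ ≤ 1 / (n + 1)) :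
    Function.Injective (fun (x : Cn n) (j : Fin n) => x j - v j x) ∧
    ∀ x, Function.Bijective fun u : Cn n => (fun j => u j - fderiv ℝ (v j) x u) := by
  have key : ∀ x : Cn n, (∀ j, ‖x j‖ ≤ 1 / (n + 1) * ‖x‖) → x = 0 := fun x h => by
    have h1 := (nle x).trans (Finset.sum_le_sum fun j _ => h j)
    simp only [Finset.sum_const, Finset.card_univ, Fintype.card_fin, nsmul_eq_mul] at h1
    have : (n : ℝ) * (1 / (n + 1) * ‖x‖) = ‖x‖ - ‖x‖ / (n + 1) := by field_simp; ring
    rw [this] at h1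
    have h2 : ‖x‖ / (n + 1) ≤ 0 := by linarith
    have h3 : (0 : ℝ) < n + 1 := by positivity
    rw [div_le_iff₀ h3, zero_mul] at h2
    exact norm_le_zero_iff.1 h2
  constructor
  · intro x y h
    refine sub_eq_zero.1 (key _ fun j => ?_)
    have h1 := congrFun h j
    dsimp only at h1
    have h2 : (x - y) j = v j x - v j y := by rw [PiLp.sub_apply]; linear_combination h1
    rw [h2]
    exact convex_univ.norm_image_sub_le_of_norm_fderiv_le (fun z _ => (hs j).differentiable (by simp) z) (fun z _ => hb j z) (mem_univ _) (mem_univ _)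
  · intro x
    let L : Cn n →ₗ[ℝ] (Fin n → ℂ) := LinearMap.pi fun j => ((pr j - fderiv ℝ (v j) x : Cn n →L[ℝ] ℂ) : Cn n →ₗ[ℝ] ℂ)
    have hL : Function.Injective L := by
      rw [injective_iff_map_eq_zero]
      intro u hu
      refine key u fun j => ?_
      have h1 : u j - fderiv ℝ (v j) x u = 0 := congrFun hu j
      rw [sub_eq_zero.1 h1]
      exact ((fderiv ℝ (v j) x).le_opNorm u).trans (mul_le_mul_of_nonneg_right (hb j x) (norm_nonneg _))
    exact ⟨hL, (LinearMap.injective_iff_surjective_of_finrank_eq_finrank (LinearEquiv.finrank_eq (WithLp.linearEquiv 2 ℝ (Fin n → ℂ)))).1 hL⟩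

theorem fin3 {J : ℕ → Cn n → En n} (hn : 0 < n) (hJ : ∀ i, IsComplexStructureOn (J i) (Metric.ball (0 : Cn n) 1))
    (hc : TendstoLocallySmoothlyOn J (fun _ => Jstd n) (Metric.ball (0 : Cn n) 1)) :
    ∃ i₀, ∃ w : ℕ → Fin n → Cn n → ℂ, (∀ i ≥ i₀, AreJHolomorphicCoordinatesOn (J i) (w i) (Metric.ball 0 (1 / 16))) ∧
      ∀ j, TendstoLocallySmoothlyOn (fun i => w i j) (fun x => x j) (Metric.ball 0 (1 / 16)) := by
  obtain ⟨N, v, vz, hv⟩ := fin1 hn hJ hc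
  obtain ⟨N1, hN⟩ := eventually_atTop.1 (eventually_all.2 fun k => (vz k).fd.ev (ε := 1 / (n + 1)) (by positivity))
  refine ⟨N + N1, fun i k x => pr k x - v k (i - N) x, fun i hi => ?_, fun k K _ _ m => ?_⟩
  · obtain ⟨a, b⟩ := fin2 (v := fun k => v k (i - N)) (fun k => (vz k).sm _) (fun k x => hN _ (by omega) k x)
    refine ⟨fun k => ⟨((pr k).contDiff.sub ((vz k).sm _)).contDiffOn, fun x hx u => ?_⟩, a.injOn, fun x _ => ?_⟩
    · have := hv (i - N) k x hx u
      rwa [Nat.sub_add_cancel (by omega)] at this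
    · convert b x using 4 with u j
      change fderiv ℝ (⇑(pr j) - v j (i - N)) x u = _
      rw [fderiv_sub (pr j).differentiableAt (((vz j).sm _).differentiable (by simp) x), ContinuousLinearMap.fderiv]; rfl
  · obtain ⟨C, hC, hb⟩ := (vz k).z m
    rw [Metric.tendstoUniformlyOn_iff]
    intro ε hε
    filter_upwards [(hC.comp (tendsto_sub_atTop_nat N)).eventually_lt_const hε] with i hi x _
    have e := iteratedFDeriv_sub_apply (i := m) (x := x) ((pr k).contDiff (n := m)).contDiffAt (((vz k).sm (i - N)).of_le (by exact_mod_cast le_top : (m : WithTop ℕ∞) ≤ ((⊤ : ℕ∞) : WithTop ℕ∞))).contDiffAt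
    change dist (iteratedFDeriv ℝ m (pr k) x) (iteratedFDeriv ℝ m (⇑(pr k) - v k (i - N)) x) < ε
    rw [e, dist_eq_norm, sub_sub_cancel]
    exact (hb _ x).trans_lt hi
end fin2
end NN

/-- **Holomorphic coordinates for converging complex structures.**  Let `B ⊂ ℂⁿ` be
the unit ball centered at the origin with standard complex structure `Ĵ` and
`Ĵ`-holomorphic coordinates `(z₁,…,zₙ)`.  If `(Jᵢ)` is a sequence of (integrable)
complex structures on `B` converging locally smoothly to `Ĵ`, then there is a
smaller ball `B̂ ⊂ B` centered at the origin such that for all `i` sufficiently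
large there exist `Jᵢ`-holomorphic coordinates `(z₁⁽ⁱ⁾,…,zₙ⁽ⁱ⁾)` on `B̂` with
`z_j⁽ⁱ⁾ → z_j` locally smoothly on `B̂` as `i → ∞`. -/
theorem holomorphic_coordinates_for_converging_complex_structures
    (n : ℕ) (hn : 0 < n) (J : ℕ → Cn n → (Cn n →L[ℝ] Cn n))
    (hJ : ∀ i, IsComplexStructureOn (J i) (Metric.ball (0 : Cn n) 1))
    (hconv : TendstoLocallySmoothlyOn J (fun _ => Jstd n) (Metric.ball (0 : Cn n) 1)) :
    ∃ r : ℝ, 0 < r ∧ r < 1 ∧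
      ∃ i₀ : ℕ, ∃ w : ℕ → Fin n → Cn n → ℂ,
        (∀ i ≥ i₀, AreJHolomorphicCoordinatesOn (J i) (w i) (Metric.ball (0 : Cn n) r)) ∧
        ∀ j : Fin n,
          TendstoLocallySmoothlyOn (fun i => w i j) (fun x => x j)
            (Metric.ball (0 : Cn n) r) := by
  obtain ⟨i₀, w, h⟩ := NN.fin3 hn hJ hconv
  exact ⟨1 / 16, by norm_num, by norm_num, i₀, w, h⟩

end
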